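/- arXiv:math/0605032 — 2 statements merged into one kernel-verified Lean document; each statement's English description precedes it below -/
import Mathlib

section
/- Let p>1, ω>0, α₀ = 2/√((p−1)ω), and fix a smooth function χ : ℝ → [0,1] with χ = 1 on [−2,2] and χ = 0 outside (−3,3). For 0<ε<1 and ρ>0 set c = ω + (ερ)^{−2}, l = −(2/√c)·max(1, 1/(p−1))·log ε, χ_l(s) = χ(s/l), Φ(r) = χ_l(r−ρ)·Q_c(r−ρ), and Ψ(r) = −d/dr[ χ_l(r−ρ)·Q_c(r−ρ) ] − 2ε(ερ)^{−3}·χ_l(r−ρ)·(∂_cQ_c)(r−ρ), where ∂_cQ_c is the partial derivative in c of the explicit formula for Q_c. For w ∈ C⁴((0,∞), ℝ) define (𝓛w)(r) = w''(r) + w'(r)/r − (ω + (εr)^{−2})·w(r) + p·Φ(r)^{p−1}·w(r). Then there exist ε*>0 and ν>0 such that for every ε ∈ (0, ε*), every ρ ∈ (α₀/(2ε), 2α₀/ε), and every w ∈ C⁴((0,∞), ℝ) with ∫₀^∞ (w² + (Δ_r w)² + (Δ_r² w)² + r^{−4}w²) r dr < ∞ and ∫₀^∞ w(r)Ψ(r)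 r dr = 0, one has ( ∫₀^∞ [ (w(r) − Δ_r w(r))² + r^{−4} w(r)² ] r dr )^{1/2} ≤ ν·( ∫₀^∞ g(r)² r dr )^{1/2}, where g = 𝓛w − ( ∫₀^∞ (𝓛w)(r)Ψ(r) r dr / ∫₀^∞ Ψ(r)² r dr )·Ψ. (A priori form of the uniform invertibility of 𝓐(ε,ρ) = 𝓠𝓛𝓠.) -/
open MeasureTheory Real Filter

/-- The 1D soliton profile `Q_c`. -/
noncomputable def Qc (p c : ℝ) : ℝ → ℝ := fun x =>
  ((p + 1) * c / 2) ^ (1 / (p - 1)) *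
    (1 / Real.cosh ((p - 1) * Real.sqrt c * x / 2)) ^ (2 / (p - 1))

/-- The partial derivative in `c` of the explicit formula for `Q_c`. -/
noncomputable def dQc (p c : ℝ) : ℝ → ℝ := fun x => deriv (fun c' => Qc p c' x) c

/-- The radial Laplacian `Δ_r u = u'' + u'/r`. -/
noncomputable def radLap (u : ℝ → ℝ) : ℝ → ℝ := fun r =>
  deriv (deriv u) r + deriv u r / r

lemma scalar_bound_of_quasimodes {δ η F G Z N A B : ℝ} (hδ : 0 < δ) (hη0 : 0 ≤ η)
    (hη3 : 200 * η ≤ δ) (hF0 : 0 ≤ F) (hG0 : 0 ≤ G) (hZ0 : 0 ≤ Z)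
    (hNX : N ≤ 4 * (Z + |A|)) (hBX : |B| ≤ 2 * (Z + |A|)) (hF : F ≤ 4 * G + 3 * η * N)
    (hmain : δ * Z ^ 2 + δ * A ^ 2
      ≤ F * (Z + |A|) + η * (|A| * N + 2 * |A| * |B| + |A| * Z + |B| * Z)) :
    N ≤ 200 / δ * G := by
  have hA0 : 0 ≤ |A| := abs_nonneg _
  have hB0 : 0 ≤ |B| := abs_nonneg _
  rw [← sq_abs A] at hmain
  generalize |A| = a at *
  generalize |B| = b at *
  obtain ⟨X, hX⟩ : ∃ X, X = Z + a := ⟨_, rfl⟩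
  rw [← hX] at hNX hBX hmain
  have hX0 : 0 ≤ X := by linarith
  have hq : δ * X ^ 2 ≤ 2 * (F * X + η * (10 * X ^ 2)) := by
    have c1 : X ^ 2 ≤ 2 * (Z ^ 2 + a ^ 2) := by
      rw [hX]; nlinarith [sq_nonneg (Z - a)]
    have c2 : a * N + 2 * a * b + a * Z + b * Z ≤ 10 * X ^ 2 := by
      have d1 : a ≤ X := by linarith
      have d2 : Z ≤ X := by linarith
      have f1 : a * N ≤ a * (4 * X) := by gcongr
      have f2 : a * b ≤ a * (2 * X) := by gcongr
      have f3 : a * Z ≤ a * X := by gcongr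
      have f4 : b * Z ≤ (2 * X) * Z := by gcongr
      have f5 : a * X ≤ X * X := by gcongr
      have f6 : Z * X + a * X = X * X := by rw [hX]; ring
      have : 0 ≤ Z * X := by positivity
      linarith [sq_nonneg X]
    have c3 := mul_le_mul_of_nonneg_left c2 hη0
    have c4 := mul_le_mul_of_nonneg_left c1 hδ.le
    linarith
  have hXle : δ * X ≤ 2 * (F + η * (10 * X)) := by
    rcases hX0.eq_or_lt with h | h
    · rw [← h]; simp [hF0]
    · have : X * (δ * X) ≤ X * (2 * (F + η * (10 * X))) := by linarith
      exact le_of_mul_le_mul_left this h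
  have hf4 : F ≤ 4 * G + 12 * (η * X) := by
    have : η * N ≤ η * (4 * X) := by gcongr
    linarith
  have hηX : 200 * (η * X) ≤ δ * X := by
    have := mul_le_mul_of_nonneg_right hη3 hX0
    linarith
  have hfin : δ * X ≤ 40 * G := by linarith
  rw [div_mul_eq_mul_div, le_div_iff₀ hδ]
  have := mul_le_mul_of_nonneg_right hNX hδ.le
  linarith

section HilbertCore
open scoped InnerProductSpace

variable {H : Type*} [NormedAddCommGroup H] [InnerProductSpace ℝ H]

set_option maxHeartbeats 800000 in
lemma norm_bound_of_unit_quasimodes (u φ ψ d f g e₁ e₂ : H) (A B k lam η δ : ℝ)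
    (hδ : 0 < δ) (hlam : δ ≤ lam) (hη0 : 0 ≤ η) (hη1 : η ≤ 1 / 4) (hη2 : 4 * η ≤ δ)
    (hη3 : 200 * η ≤ δ)
    (hφ : ‖φ‖ = 1) (hψ : ‖ψ‖ = 1) (hd : ‖d‖ ≤ η) (he₁ : ‖e₁‖ ≤ η) (he₂ : ‖e₂‖ ≤ η)
    (hf : f = -(g + k • (ψ + d)))
    (h1 : ⟪f, φ⟫_ℝ = -lam * ⟪u, φ⟫_ℝ + ⟪u, e₁⟫_ℝ)
    (h2 : ⟪f, ψ⟫_ℝ = ⟪u, e₂⟫_ℝ)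
    (h12 : lam * ⟪φ, ψ⟫_ℝ = ⟪e₁, ψ⟫_ℝ - ⟪φ, e₂⟫_ℝ)
    (hz : δ * ‖u - A • φ - B • ψ‖ ^ 2
      ≤ ⟪f + (lam * A) • φ - A • e₁ - B • e₂, u - A • φ - B • ψ⟫_ℝ)
    (hu : ⟪u, ψ + d⟫_ℝ = 0) :
    ‖u‖ ≤ 200 / δ * ‖g‖ ∧ ‖f‖ ≤ 4 * ‖g‖ + 3 * η * ‖u‖ := by
  have cs : ∀ x y : H, |⟪x, y⟫_ℝ| ≤ ‖x‖ * ‖y‖ := fun x y => abs_real_inner_le_norm x y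
  set z := u - A • φ - B • ψ with hzdef
  have hudec : u = z + A • φ + B • ψ := by rw [hzdef]; abel
  have hN : ‖u‖ ≤ ‖z‖ + |A| + |B| := by
    calc ‖u‖ = ‖z + A • φ + B • ψ‖ := by rw [← hudec]
      _ ≤ ‖z‖ + ‖A • φ‖ + ‖B • ψ‖ := norm_add₃_le
      _ = _ := by rw [norm_smul, norm_smul, hφ, hψ]; simp
  have hφφ : ⟪φ, φ⟫_ℝ = 1 := by rw [real_inner_self_eq_norm_sq, hφ]; norm_num
  have hψψ : ⟪ψ, ψ⟫_ℝ = 1 := by rw [real_inner_self_eq_norm_sq, hψ]; norm_num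
  have hov : |lam * ⟪φ, ψ⟫_ℝ| ≤ 2 * η := by
    rw [h12]
    have a1 := cs e₁ ψ
    have a2 := cs φ e₂
    rw [hψ] at a1; rw [hφ] at a2
    calc _ ≤ |⟪e₁, ψ⟫_ℝ| + |⟪φ, e₂⟫_ℝ| := abs_sub _ _
      _ ≤ _ := by linarith
  have hov' : |⟪φ, ψ⟫_ℝ| ≤ 1 / 2 := by
    rw [abs_mul, abs_of_pos (by linarith)] at hov
    have : 0 ≤ |⟪φ, ψ⟫_ℝ| := abs_nonneg _
    nlinarith
  -- the Lagrange multiplier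
  have hk : |k| ≤ 2 * (‖g‖ + η * ‖u‖) := by
    have e : k * (1 + ⟪d, ψ⟫_ℝ) = -⟪g, ψ⟫_ℝ - ⟪u, e₂⟫_ℝ := by
      rw [← h2, hf]
      simp only [inner_neg_left, inner_add_left, real_inner_smul_left, hψψ]
      ring
    have a1 := cs d ψ
    have a2 := cs g ψ
    have a3 := cs u e₂
    rw [hψ] at a1 a2
    have b1 : 1 / 2 ≤ 1 + ⟪d, ψ⟫_ℝ := by
      have := (abs_le.mp a1).1
      linarith
    have b2 : |k| * (1 + ⟪d, ψ⟫_ℝ) ≤ ‖g‖ + η * ‖u‖ := by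
      have : |k * (1 + ⟪d, ψ⟫_ℝ)| = |k| * (1 + ⟪d, ψ⟫_ℝ) := by
        rw [abs_mul, abs_of_nonneg (by linarith : 0 ≤ 1 + ⟪d, ψ⟫_ℝ)]
      rw [← this, e]
      have c1 : ‖u‖ * ‖e₂‖ ≤ ‖u‖ * η := mul_le_mul_of_nonneg_left he₂ (norm_nonneg _)
      calc _ ≤ |-⟪g, ψ⟫_ℝ| + |⟪u, e₂⟫_ℝ| := abs_sub _ _
        _ ≤ _ := by rw [abs_neg]; linarith
    have := abs_nonneg k
    nlinarith
  have hF : ‖f‖ ≤ 4 * ‖g‖ + 3 * η * ‖u‖ := by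
    rw [hf, norm_neg]
    have c1 : ‖ψ + d‖ ≤ 1 + η := (norm_add_le _ _).trans (by linarith)
    calc ‖g + k • (ψ + d)‖ ≤ ‖g‖ + |k| * ‖ψ + d‖ := by
          refine (norm_add_le _ _).trans ?_
          rw [norm_smul, Real.norm_eq_abs]
      _ ≤ ‖g‖ + (2 * (‖g‖ + η * ‖u‖)) * (1 + η) := by gcongr
      _ ≤ _ := by
        have : 0 ≤ ‖g‖ + η * ‖u‖ := by positivity
        nlinarith [norm_nonneg g]
  refine ⟨?_, hF⟩
  have hB : |B| ≤ ‖z‖ + |A| * (1 / 2) + η * ‖u‖ := by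
    have e : B = -⟪z, ψ⟫_ℝ - A * ⟪φ, ψ⟫_ℝ - ⟪u, d⟫_ℝ := by
      rw [inner_add_right] at hu
      have : ⟪u, ψ⟫_ℝ = ⟪z, ψ⟫_ℝ + A * ⟪φ, ψ⟫_ℝ + B := by
        conv_lhs => rw [hudec]
        simp only [inner_add_left, real_inner_smul_left, hψψ]
        ring
      linarith
    have a1 := cs z ψ
    have a2 := cs u d
    rw [hψ] at a1
    have c1 : ‖u‖ * ‖d‖ ≤ ‖u‖ * η := mul_le_mul_of_nonneg_left hd (norm_nonneg _)
    have c2 : |A * ⟪φ, ψ⟫_ℝ| ≤ |A| * (1 / 2) := by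
      rw [abs_mul]; exact mul_le_mul_of_nonneg_left hov' (abs_nonneg _)
    calc |B| = |-⟪z, ψ⟫_ℝ - A * ⟪φ, ψ⟫_ℝ - ⟪u, d⟫_ℝ| := by rw [← e]
      _ ≤ |-⟪z, ψ⟫_ℝ - A * ⟪φ, ψ⟫_ℝ| + |⟪u, d⟫_ℝ| := abs_sub _ _
      _ ≤ |-⟪z, ψ⟫_ℝ| + |A * ⟪φ, ψ⟫_ℝ| + |⟪u, d⟫_ℝ| := by gcongr; exact abs_sub _ _
      _ ≤ _ := by rw [abs_neg]; linarith
  set Z := ‖z‖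
  set N := ‖u‖
  have hZ0 : 0 ≤ Z := norm_nonneg _
  have hA0 : 0 ≤ |A| := abs_nonneg _
  have hN0 : 0 ≤ N := norm_nonneg _
  have hNX : N ≤ 4 * (Z + |A|) := by
    have : η * N ≤ 1 / 4 * N := by gcongr
    linarith
  have hBX : |B| ≤ 2 * (Z + |A|) := by
    have : η * N ≤ 1 / 4 * N := by gcongr
    linarith
  have hmain : δ * Z ^ 2 + δ * A ^ 2
      ≤ ‖f‖ * (Z + |A|) + η * (|A| * N + 2 * |A| * |B| + |A| * Z + |B| * Z) := by
    have e : ⟪f + (lam * A) • φ - A • e₁ - B • e₂, z⟫_ℝ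
        = ⟪f, z⟫_ℝ + A * (⟪u, e₁⟫_ℝ - ⟪f, φ⟫_ℝ) - lam * A ^ 2 - A * B * (lam * ⟪φ, ψ⟫_ℝ)
          - A * ⟪e₁, z⟫_ℝ - B * ⟪e₂, z⟫_ℝ := by
      have : ⟪φ, z⟫_ℝ = ⟪u, φ⟫_ℝ - A - B * ⟪φ, ψ⟫_ℝ := by
        rw [hzdef]
        simp only [inner_sub_right, real_inner_smul_right, hφφ, real_inner_comm u φ]
        ring
      simp only [inner_sub_left, inner_add_left, real_inner_smul_left, this]
      rw [h1]; ring
    rw [e] at hz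
    have a1 := (abs_le.mp (cs f z)).2
    have a2 : A * ⟪u, e₁⟫_ℝ ≤ |A| * (N * η) := by
      refine (le_abs_self _).trans ?_
      rw [abs_mul]
      gcongr
      exact (cs _ _).trans (by gcongr)
    have a3 : -(A * ⟪f, φ⟫_ℝ) ≤ |A| * ‖f‖ := by
      refine (neg_le_abs _).trans ?_
      rw [abs_mul]
      gcongr
      have := cs f φ
      rwa [hφ, mul_one] at this
    have a4 : -(A * B * (lam * ⟪φ, ψ⟫_ℝ)) ≤ |A| * |B| * (2 * η) := by
      refine (neg_le_abs _).trans ?_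
      rw [abs_mul, abs_mul A B]
      gcongr
    have a5 : -(A * ⟪e₁, z⟫_ℝ) ≤ |A| * (η * Z) := by
      refine (neg_le_abs _).trans ?_
      rw [abs_mul]
      gcongr
      exact (cs _ _).trans (by gcongr)
    have a6 : -(B * ⟪e₂, z⟫_ℝ) ≤ |B| * (η * Z) := by
      refine (neg_le_abs _).trans ?_
      rw [abs_mul]
      gcongr
      exact (cs _ _).trans (by gcongr)
    have a7 : δ * A ^ 2 ≤ lam * A ^ 2 := by gcongr
    linarith
  exact scalar_bound_of_quasimodes hδ hη0 hη3 (norm_nonneg f) (norm_nonneg g) hZ0 hNX hBX hF hmain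

/-- Invertibility of an operator with two approximate eigenvectors, in Hilbert-space form. -/
lemma exists_norm_bound_of_quasimodes (δ n₀ : ℝ) (hδ : 0 < δ) (hn₀ : 0 < n₀) :
    ∃ η > (0 : ℝ), ∃ C > (0 : ℝ), ∀ (u φ ψ d f g e₁ e₂ : H) (A B k lam : ℝ),
      δ ≤ lam → n₀ ≤ ‖φ‖ → n₀ ≤ ‖ψ‖ → ‖d‖ ≤ η → ‖e₁‖ ≤ η → ‖e₂‖ ≤ η →
      f = -(g + k • (ψ + d)) →
      ⟪f, φ⟫_ℝ = -lam * ⟪u, φ⟫_ℝ + ⟪u, e₁⟫_ℝ →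
      ⟪f, ψ⟫_ℝ = ⟪u, e₂⟫_ℝ →
      lam * ⟪φ, ψ⟫_ℝ = ⟪e₁, ψ⟫_ℝ - ⟪φ, e₂⟫_ℝ →
      δ * ‖u - A • φ - B • ψ‖ ^ 2
        ≤ ⟪f + (lam * A) • φ - A • e₁ - B • e₂, u - A • φ - B • ψ⟫_ℝ →
      ⟪u, ψ + d⟫_ℝ = 0 → ‖u‖ ≤ C * ‖g‖ ∧ ‖f‖ ≤ C * ‖g‖ := by
  refine ⟨n₀ * min (1 / 4) (δ / 200), by positivity, 200 / δ + 4 + 200 / δ, by positivity, ?_⟩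
  intro u φ ψ d f g e₁ e₂ A B k lam hlam hφ hψ hd he₁ he₂ hf h1 h2 h12 hz hu
  set η := min (1 / 4 : ℝ) (δ / 200) with hη
  have hη1 : η ≤ 1 / 4 := min_le_left _ _
  have hη2 : η ≤ δ / 200 := min_le_right _ _
  have hη0 : 0 < η := by positivity
  have pφ : 0 < ‖φ‖ := by linarith
  have pψ : 0 < ‖ψ‖ := by linarith
  have scale : ∀ (x y : H), n₀ ≤ ‖y‖ → ‖x‖ ≤ n₀ * η → ‖(‖y‖⁻¹) • x‖ ≤ η := by
    intro x y hy hx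
    have : 0 < ‖y‖ := by linarith
    rw [norm_smul, norm_inv, norm_norm, inv_mul_le_iff₀ this]
    exact hx.trans (by gcongr)
  have key := norm_bound_of_unit_quasimodes u (‖φ‖⁻¹ • φ) (‖ψ‖⁻¹ • ψ) (‖ψ‖⁻¹ • d) f g
    (‖φ‖⁻¹ • e₁) (‖ψ‖⁻¹ • e₂) (A * ‖φ‖) (B * ‖ψ‖) (k * ‖ψ‖) lam η δ hδ hlam hη0.le hη1
    (by linarith) (by linarith) (by rw [norm_smul, norm_inv, norm_norm, inv_mul_cancel₀ pφ.ne'])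
    (by rw [norm_smul, norm_inv, norm_norm, inv_mul_cancel₀ pψ.ne'])
    (scale d ψ hψ hd) (scale e₁ φ hφ he₁) (scale e₂ ψ hψ he₂)
    (by rw [hf, ← smul_add, smul_smul, mul_assoc, mul_inv_cancel₀ pψ.ne', mul_one])
    (by simp only [real_inner_smul_right]; rw [h1]; ring)
    (by simp only [real_inner_smul_right]; rw [h2])
    (by
      simp only [real_inner_smul_right, real_inner_smul_left]
      linear_combination (‖φ‖⁻¹ * ‖ψ‖⁻¹) * h12)
    (by
      have e1 : (A * ‖φ‖) • ‖φ‖⁻¹ • φ = A • φ := by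
        rw [smul_smul, mul_assoc, mul_inv_cancel₀ pφ.ne', mul_one]
      have e2 : (B * ‖ψ‖) • ‖ψ‖⁻¹ • ψ = B • ψ := by
        rw [smul_smul, mul_assoc, mul_inv_cancel₀ pψ.ne', mul_one]
      have e3 : (A * ‖φ‖) • ‖φ‖⁻¹ • e₁ = A • e₁ := by
        rw [smul_smul, mul_assoc, mul_inv_cancel₀ pφ.ne', mul_one]
      have e4 : (B * ‖ψ‖) • ‖ψ‖⁻¹ • e₂ = B • e₂ := by
        rw [smul_smul, mul_assoc, mul_inv_cancel₀ pψ.ne', mul_one]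
      have e5 : (lam * (A * ‖φ‖)) • ‖φ‖⁻¹ • φ = (lam * A) • φ := by
        rw [smul_smul]; congr 1; field_simp
      rw [e1, e2, e3, e4, e5]; exact hz)
    (by rw [← smul_add, real_inner_smul_right, hu, mul_zero])
  obtain ⟨k1, k2⟩ := key
  have hg := norm_nonneg g
  have hpos : 0 ≤ 200 / δ * ‖g‖ := by positivity
  constructor
  · nlinarith
  · have : 3 * η * ‖u‖ ≤ 1 * ‖u‖ := by gcongr; linarith
    nlinarith

end HilbertCore

section EndPoints
open Set Topology

lemma not_integrableOn_of_const_le {F : ℝ → ℝ} {r₀ k : ℝ} (hr₀ : 0 < r₀) (hk : 0 < k)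
    (hF : ∀ r ∈ Ioo 0 r₀, k ≤ F r) : ¬ IntegrableOn (fun r => F r / r ^ 4) (Ioi 0) := by
  intro h
  set a := min r₀ 1 with ha
  have ha0 : 0 < a := by positivity
  have h1 : IntegrableOn (fun r => F r / r ^ 4) (Ioc 0 (a / 2)) := h.mono_set Ioc_subset_Ioi_self
  have h2 : IntegrableOn (fun r : ℝ => r⁻¹) (Ioc 0 (a / 2)) := by
    have h3 := h1.const_mul k⁻¹
    refine Integrable.mono' h3 measurable_inv.aestronglyMeasurable ?_
    refine (ae_restrict_iff' measurableSet_Ioc).2 (Eventually.of_forall fun r hr => ?_)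
    have r1 : r < r₀ := by have := min_le_left r₀ 1; linarith [hr.2]
    have r2 : r ≤ 1 := by have := min_le_right r₀ 1; linarith [hr.2]
    have hr0 : 0 < r := hr.1
    rw [Real.norm_eq_abs, abs_of_pos (inv_pos.2 hr0)]
    have hFr := hF r ⟨hr0, r1⟩
    rw [inv_eq_one_div, inv_mul_eq_div, div_div, div_le_div_iff₀ hr0 (by positivity)]
    have : r ^ 4 ≤ r := by nlinarith [pow_le_one₀ hr0.le r2 (n := 3), pow_pos hr0 3]
    nlinarith [pow_pos hr0 4]
  have h4 : IntervalIntegrable (fun x : ℝ => x⁻¹) volume 0 (a / 2) := by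
    rwa [intervalIntegrable_iff_integrableOn_Ioc_of_le (by positivity)]
  rw [intervalIntegrable_inv_iff] at h4
  rcases h4 with h4 | h4
  · linarith
  · exact h4 left_mem_uIcc

/-- A nonnegative function with `F / r ^ 4` integrable cannot decrease too fast near `0`. -/
lemma frequently_le_deriv_near_zero {F F' : ℝ → ℝ} (M : ℝ) (hF0 : ∀ r > 0, 0 ≤ F r)
    (hF : ∀ r > 0, HasDerivAt F (F' r) r)
    (hint : IntegrableOn (fun r => F r / r ^ 4) (Ioi 0)) :
    ∃ᶠ r in 𝓝[>] (0 : ℝ), -M * F r ≤ F' r := by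
  intro hev
  have hev' : ∀ᶠ r in 𝓝[>] (0 : ℝ), F' r < -M * F r := by
    filter_upwards [hev] with r hr using not_le.1 hr
  obtain ⟨r₀, hr₀, hlt⟩ := mem_nhdsGT_iff_exists_Ioo_subset.1 hev'
  have hr₀ : 0 < r₀ := hr₀
  set G : ℝ → ℝ := fun r => exp (M * r) * F r with hG
  have hGd : ∀ r > 0, HasDerivAt G (exp (M * r) * (M * F r + F' r)) r := by
    intro r hr
    have h1 : HasDerivAt (fun r => exp (M * r)) (exp (M * r) * (M * 1)) r :=
      ((hasDerivAt_id r).const_mul M).exp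
    exact (h1.mul (hF r hr)).congr_deriv (by ring)
  have hanti : StrictAntiOn G (Ioo 0 r₀) := by
    apply strictAntiOn_of_deriv_neg (convex_Ioo 0 r₀)
    · exact fun r hr => (hGd r hr.1).continuousAt.continuousWithinAt
    · intro r hr
      rw [interior_Ioo] at hr
      rw [(hGd r hr.1).deriv]
      have : F' r < -M * F r := hlt hr
      have := exp_pos (M * r)
      nlinarith
  set k := G (r₀ / 2) with hk
  have hkpos : 0 < k := by
    have h1 : G (3 * r₀ / 4) < G (r₀ / 2) := hanti ⟨by linarith, by linarith⟩
      ⟨by linarith, by linarith⟩ (by linarith)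
    have h2 : 0 ≤ G (3 * r₀ / 4) := mul_nonneg (exp_pos _).le (hF0 _ (by linarith))
    linarith
  refine not_integrableOn_of_const_le (F := F) (r₀ := r₀ / 2) (k := k * exp (-(|M| * r₀)))
    (by linarith) (by positivity) ?_ hint
  intro r hr
  have h1 : k < G r := hanti ⟨hr.1, by linarith [hr.2]⟩ ⟨by linarith, by linarith⟩ hr.2
  have h2 : exp (M * r) ≤ exp (|M| * r₀) := by
    apply exp_le_exp.2
    calc M * r ≤ |M| * r := mul_le_mul_of_nonneg_right (le_abs_self _) hr.1.le
      _ ≤ |M| * r₀ := mul_le_mul_of_nonneg_left (by linarith [hr.2]) (abs_nonneg _)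
  rw [exp_neg, ← div_eq_mul_inv, div_le_iff₀ (exp_pos _)]
  calc k ≤ exp (M * r) * F r := h1.le
    _ ≤ exp (|M| * r₀) * F r := mul_le_mul_of_nonneg_right h2 (hF0 _ hr.1)
    _ = _ := mul_comm _ _

/-- An integrable nonnegative function cannot satisfy `F' + M F ≥ η > 0` near infinity. -/
lemma frequently_deriv_add_le_atTop {F F' : ℝ → ℝ} (M η : ℝ) (hη : 0 < η)
    (hF0 : ∀ r > 0, 0 ≤ F r)
    (hF : ∀ r > 0, HasDerivAt F (F' r) r) (hint : IntegrableOn F (Ioi 0)) :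
    ∃ᶠ r in atTop, F' r + M * F r ≤ η := by
  intro hev
  obtain ⟨R₁, hR₁⟩ := eventually_atTop.1 hev
  set R := max R₁ 1 with hR
  have hR0 : 0 < R := by positivity
  have hlt : ∀ r ≥ R, η < F' r + M * F r :=
    fun r hr => not_le.1 (hR₁ r ((le_max_left _ _).trans hr))
  set J := ∫ r in Ioi (0 : ℝ), F r with hJ
  have hJ0 : 0 ≤ J := setIntegral_nonneg measurableSet_Ioi fun r hr => hF0 r hr
  have hint' : ∀ T ≥ R, IntegrableOn F (Icc R T) := fun T _ =>
    hint.mono_set fun x hx => lt_of_lt_of_le hR0 hx.1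
  have hle : ∀ T ≥ R, ∫ r in R..T, F r ≤ J := by
    intro T hT
    rw [intervalIntegral.integral_of_le hT]
    exact setIntegral_mono_set hint
      ((ae_restrict_iff' measurableSet_Ioi).2 (Eventually.of_forall fun r hr => hF0 r hr))
      (Eventually.of_forall fun x hx => hR0.trans hx.1)
  have hgrow : ∀ T ≥ R, η * (T - R) - |M| * J ≤ F T - F R := by
    intro T hT
    have h1 := intervalIntegral.sub_le_integral_of_hasDeriv_right_of_le (g := fun r => -F r)
      (g' := fun r => -F' r) (φ := fun r => |M| * F r - η) hT
      (fun r hr => ((hF r (lt_of_lt_of_le hR0 hr.1)).neg).continuousAt.continuousWithinAt)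
      (fun r hr => ((hF r (hR0.trans hr.1)).neg).hasDerivWithinAt)
      (((hint' T hT).const_mul _).sub (integrableOn_const (by simp)))
      (fun r hr => by
        have h1 := hlt r hr.1.le
        have h2 : M * F r ≤ |M| * F r :=
          mul_le_mul_of_nonneg_right (le_abs_self _) (hF0 r (hR0.trans hr.1))
        linarith)
    have hii : IntervalIntegrable F volume R T := by
      rw [intervalIntegrable_iff_integrableOn_Icc_of_le hT]; exact hint' T hT
    rw [intervalIntegral.integral_sub (hii.const_mul _) intervalIntegrable_const,
      intervalIntegral.integral_const_mul, intervalIntegral.integral_const, smul_eq_mul] at h1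
    have h2 := mul_le_mul_of_nonneg_left (hle T hT) (abs_nonneg M)
    linarith
  set T₀ := R + (|M| * J + 1) / η with hT₀
  have hT₀R : R ≤ T₀ := by
    have : 0 ≤ (|M| * J + 1) / η := by positivity
    linarith
  have hone : ∀ r ∈ Ioi T₀, (1 : ℝ) ≤ F r := by
    intro r hr
    have hr : T₀ < r := hr
    have h1 := hgrow r (hT₀R.trans hr.le)
    have h2 : |M| * J + 1 ≤ η * (r - R) := by
      have : (|M| * J + 1) / η ≤ r - R := by linarith
      rw [div_le_iff₀ hη] at this
      linarith
    linarith [hF0 R hR0]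
  have hc : IntegrableOn (fun _ : ℝ => (1 : ℝ)) (Ioi T₀) := by
    refine Integrable.mono' (hint.mono_set fun x hx => hR0.trans_le (hT₀R.trans (le_of_lt hx)))
      aestronglyMeasurable_const ?_
    refine (ae_restrict_iff' measurableSet_Ioi).2 (Eventually.of_forall fun r hr => ?_)
    simpa using hone r hr
  rw [integrableOn_const_iff] at hc
  simp at hc

lemma le_setIntegral_of_frequently_nonpos {b b' G : ℝ → ℝ} {r₁ : ℝ} (hr₁ : 0 < r₁)
    (hb : ∀ r ∈ Ioc 0 r₁, HasDerivAt b (b' r) r) (hG : IntegrableOn G (Ioi 0))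
    (hle : ∀ r ∈ Ioc 0 r₁, b' r ≤ G r) (hfreq : ∃ᶠ r in 𝓝[>] (0 : ℝ), b r ≤ 0) :
    b r₁ ≤ ∫ r in Ioc 0 r₁, G r := by
  have hGi : IntervalIntegrable G volume 0 r₁ := by
    rw [intervalIntegrable_iff_integrableOn_Ioc_of_le hr₁.le]
    exact hG.mono_set Ioc_subset_Ioi_self
  have hGc : IntegrableOn G (Icc 0 r₁) := by
    rw [integrableOn_Icc_iff_integrableOn_Ioc]
    exact hG.mono_set Ioc_subset_Ioi_self
  have hcont : Tendsto (fun r => ∫ x in r..r₁, G x) (𝓝[>] 0) (𝓝 (∫ x in (0 : ℝ)..r₁, G x)) := by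
    have h1 := intervalIntegral.continuousOn_primitive_interval_left (μ := volume) (f := G)
      (a := 0) (b := r₁) (by rw [uIcc_of_le hr₁.le]; exact hGc)
    have h2 := h1 0 (by simp)
    rw [uIcc_of_le hr₁.le] at h2
    have h3 : Tendsto (fun r => ∫ x in r..r₁, G x) (𝓝[Icc 0 r₁] 0)
      (𝓝 (∫ x in (0 : ℝ)..r₁, G x)) := h2
    refine h3.mono_left (nhdsWithin_le_of_mem ?_)
    filter_upwards [Ioo_mem_nhdsGT hr₁] with x hx using ⟨hx.1.le, hx.2.le⟩
  rw [← intervalIntegral.integral_of_le hr₁.le]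
  refine ge_of_tendsto_of_frequently hcont ?_
  refine (hfreq.and_eventually (Ioo_mem_nhdsGT hr₁)).mono ?_
  rintro r ⟨h1, h2⟩
  have h3 := intervalIntegral.sub_le_integral_of_hasDeriv_right_of_le (g := b) (g' := b') (φ := G)
    h2.2.le
    (fun x hx => (hb x ⟨h2.1.trans_le hx.1, hx.2⟩).continuousAt.continuousWithinAt)
    (fun x hx => (hb x ⟨h2.1.trans hx.1, hx.2.le⟩).hasDerivWithinAt)
    (hGc.mono_set (Icc_subset_Icc_left h2.1.le))
    (fun x hx => hle x ⟨h2.1.trans hx.1, hx.2.le⟩)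
  linarith

lemma neg_le_setIntegral_of_frequently {b b' G : ℝ → ℝ} {r₂ : ℝ} (hr₂ : 0 < r₂)
    (hb : ∀ r ∈ Ici r₂, HasDerivAt b (b' r) r) (hG : IntegrableOn G (Ioi 0))
    (hle : ∀ r ∈ Ici r₂, b' r ≤ G r) (hfreq : ∀ η > 0, ∃ᶠ r in atTop, -η ≤ b r) :
    -b r₂ ≤ ∫ r in Ioi r₂, G r := by
  have hG' : IntegrableOn G (Ioi r₂) := hG.mono_set (Ioi_subset_Ioi hr₂.le)
  have hlim := intervalIntegral_tendsto_integral_Ioi r₂ hG' tendsto_id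
  refine le_of_forall_pos_le_add fun η hη => ?_
  have : -b r₂ - η ≤ ∫ r in Ioi r₂, G r := by
    refine ge_of_tendsto_of_frequently hlim ?_
    refine ((hfreq η hη).and_eventually (eventually_ge_atTop r₂)).mono ?_
    rintro R ⟨h1, h2⟩
    have h3 := intervalIntegral.sub_le_integral_of_hasDeriv_right_of_le (g := b) (g' := b')
      (φ := G) h2
      (fun x hx => (hb x hx.1).continuousAt.continuousWithinAt)
      (fun x hx => (hb x hx.1.le).hasDerivWithinAt)
      (hG.mono_set fun x hx => hr₂.trans_le hx.1)
      (fun x hx => hle x hx.1.le)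
    simp only [id]
    linarith
  linarith

end EndPoints

section Coercivity
open Set Topology

/-- Lower bound for a Schrödinger form on functions with two prescribed zeros, from
subsolutions of the Riccati equation on the three resulting intervals. -/
lemma integral_form_nonneg_of_riccati {z z₁ z₂ U : ℝ → ℝ} {δ r₁ r₂ S : ℝ}
    {sL sL' sM sM' sR sR' : ℝ → ℝ}
    (hr₁ : 0 < r₁) (hr₁₂ : r₁ < r₂)
    (hz : ∀ r > 0, HasDerivAt z (z₁ r) r) (hz₁ : ∀ r > 0, HasDerivAt z₁ (z₂ r) r)
    (hzr₁ : z r₁ = 0) (hzr₂ : z r₂ = 0)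
    (hint : IntegrableOn (fun r => z r ^ 2) (Ioi 0))
    (hint4 : IntegrableOn (fun r => z r ^ 2 / r ^ 4) (Ioi 0))
    (hG : IntegrableOn (fun r => (-z₂ r + U r * z r) * z r) (Ioi 0))
    (hsL : ∀ r ∈ Ioc 0 r₁, HasDerivAt sL (sL' r) r)
    (hsM : ∀ r ∈ Icc r₁ r₂, HasDerivAt sM (sM' r) r)
    (hsR : ∀ r ∈ Ici r₂, HasDerivAt sR (sR' r) r)
    (hbL : ∀ r ∈ Ioc 0 r₁, |sL r| ≤ S) (hbR : ∀ r ∈ Ici r₂, |sR r| ≤ S)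
    (hL : ∀ r ∈ Ioc 0 r₁, δ ≤ U r + sL' r - sL r ^ 2)
    (hM : ∀ r ∈ Icc r₁ r₂, δ ≤ U r + sM' r - sM r ^ 2)
    (hR : ∀ r ∈ Ici r₂, δ ≤ U r + sR' r - sR r ^ 2) :
    δ * ∫ r in Ioi (0 : ℝ), z r ^ 2 ≤ ∫ r in Ioi (0 : ℝ), (-z₂ r + U r * z r) * z r := by
  set G : ℝ → ℝ := fun r => (-z₂ r + U r * z r) * z r - δ * z r ^ 2 with hGdef
  have hGint : IntegrableOn G (Ioi 0) := hG.sub (hint.const_mul δ)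
  have hbd : ∀ (s s' : ℝ → ℝ) (r : ℝ), 0 < r → HasDerivAt s (s' r) r →
      HasDerivAt (fun r => -(z₁ r * z r) - s r * z r ^ 2)
        (-(z₂ r * z r + z₁ r * z₁ r) - (s' r * z r ^ 2 + s r * (2 * z r * z₁ r))) r := by
    intro s s' r hr hs
    have h1 := ((hz₁ r hr).mul (hz r hr)).neg.sub (hs.mul ((hz r hr).pow 2))
    refine h1.congr_deriv ?_
    norm_num
  have hbG : ∀ (s s' : ℝ → ℝ) (r : ℝ), δ ≤ U r + s' r - s r ^ 2 →
      -(z₂ r * z r + z₁ r * z₁ r) - (s' r * z r ^ 2 + s r * (2 * z r * z₁ r)) ≤ G r := by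
    intro s s' r h
    have : 0 ≤ (U r + s' r - s r ^ 2 - δ) * z r ^ 2 := mul_nonneg (by linarith) (sq_nonneg _)
    simp only [hGdef]
    nlinarith [sq_nonneg (z₁ r + s r * z r)]
  have hF : ∀ r > 0, HasDerivAt (fun r => z r ^ 2) (2 * z r * z₁ r) r := by
    intro r hr
    refine ((hz r hr).pow 2).congr_deriv (by norm_num)
  have hS : 0 ≤ S := (abs_nonneg _).trans (hbR r₂ self_mem_Ici)
  have h0 := le_setIntegral_of_frequently_nonpos hr₁
    (fun r hr => hbd sL sL' r hr.1 (hsL r hr)) hGint (fun r hr => hbG sL sL' r (hL r hr)) (by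
      have h := frequently_le_deriv_near_zero (-(2 * S)) (fun r _ => sq_nonneg (z r)) hF hint4
      refine (h.and_eventually (Ioo_mem_nhdsGT hr₁)).mono ?_
      rintro r ⟨h1, h2⟩
      have h3 := (abs_le.1 (hbL r ⟨h2.1, h2.2.le⟩)).1
      nlinarith [mul_le_mul_of_nonneg_right h3 (sq_nonneg (z r))])
  have h2 := neg_le_setIntegral_of_frequently (hr₁.trans hr₁₂)
    (fun r hr => hbd sR sR' r ((hr₁.trans hr₁₂).trans_le hr) (hsR r hr)) hGint
    (fun r hr => hbG sR sR' r (hR r hr)) (by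
      intro η hη
      have h := frequently_deriv_add_le_atTop (2 * S) η hη (fun r _ => sq_nonneg (z r)) hF hint
      refine (h.and_eventually (eventually_ge_atTop r₂)).mono ?_
      rintro r ⟨h1, h2⟩
      have h3 := (abs_le.1 (hbR r h2)).2
      nlinarith [mul_le_mul_of_nonneg_right h3 (sq_nonneg (z r))])
  have h1 := intervalIntegral.sub_le_integral_of_hasDeriv_right_of_le (φ := G) hr₁₂.le
    (fun r hr => (hbd sM sM' r (hr₁.trans_le hr.1) (hsM r hr)).continuousAt.continuousWithinAt)
    (fun r hr => (hbd sM sM' r (hr₁.trans hr.1) (hsM r ⟨hr.1.le, hr.2.le⟩)).hasDerivWithinAt)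
    (hGint.mono_set fun r hr => hr₁.trans_le hr.1)
    (fun r hr => hbG sM sM' r (hM r ⟨hr.1.le, hr.2.le⟩))
  simp only [hzr₁, hzr₂] at h0 h1 h2
  norm_num at h0 h1 h2
  have e1 : ∫ r in Ioi (0 : ℝ), G r
      = (∫ r in Ioc 0 r₁, G r) + ((∫ r in r₁..r₂, G r) + ∫ r in Ioi r₂, G r) := by
    rw [intervalIntegral.integral_of_le hr₁₂.le, ← setIntegral_union, Ioc_union_Ioi_eq_Ioi hr₁₂.le,
      ← setIntegral_union, Ioc_union_Ioi_eq_Ioi hr₁.le]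
    · exact Ioc_disjoint_Ioi le_rfl
    · exact measurableSet_Ioi
    · exact hGint.mono_set Ioc_subset_Ioi_self
    · exact hGint.mono_set (Ioi_subset_Ioi hr₁.le)
    · exact Ioc_disjoint_Ioi le_rfl
    · exact measurableSet_Ioi
    · exact hGint.mono_set (Ioc_subset_Ioi_self.trans (Ioi_subset_Ioi hr₁.le))
    · exact hGint.mono_set (Ioi_subset_Ioi (hr₁.trans hr₁₂).le)
  have e2 : ∫ r in Ioi (0 : ℝ), G r = (∫ r in Ioi (0 : ℝ), (-z₂ r + U r * z r) * z r)
      - δ * ∫ r in Ioi (0 : ℝ), z r ^ 2 := by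
    rw [← integral_const_mul, ← integral_sub hG (hint.const_mul δ)]
  linarith

/-- Weighted estimate for a Schrödinger operator with inverse-square potential `a + κ / r ^ 2`. -/
lemma integral_div_pow_four_le {u u₁ u₂ f : ℝ → ℝ} {a κ : ℝ} (ha : 0 ≤ a)
    (hu : ∀ r > 0, HasDerivAt u (u₁ r) r) (hu₁ : ∀ r > 0, HasDerivAt u₁ (u₂ r) r)
    (hf : ∀ r > 0, f r = -u₂ r + (a + κ / r ^ 2) * u r)
    (hint : IntegrableOn (fun r => u r ^ 2) (Ioi 0))
    (hint4 : IntegrableOn (fun r => u r ^ 2 / r ^ 4) (Ioi 0))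
    (hG : IntegrableOn (fun r => f r * (u r / r ^ 2)) (Ioi 0)) :
    (κ - 3) * ∫ r in Ioi (0 : ℝ), u r ^ 2 / r ^ 4 ≤ ∫ r in Ioi (0 : ℝ), f r * (u r / r ^ 2) := by
  set G : ℝ → ℝ := fun r => f r * (u r / r ^ 2) - (κ - 3) * (u r ^ 2 / r ^ 4) with hGdef
  have hGint : IntegrableOn G (Ioi 0) := hG.sub (hint4.const_mul _)
  set b : ℝ → ℝ := fun r => -(u₁ r * u r / r ^ 2) - u r ^ 2 / r ^ 3 with hb
  set b' : ℝ → ℝ := fun r => -(u₂ r * u r / r ^ 2) - u₁ r ^ 2 / r ^ 2 + 3 * u r ^ 2 / r ^ 4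
    with hb'
  have hbd : ∀ r > 0, HasDerivAt b (b' r) r := by
    intro r hr
    have h1 := (((hu₁ r hr).mul (hu r hr)).div ((hasDerivAt_id r).pow 2) (by simp [hr.ne'])).neg.sub
      (((hu r hr).pow 2).div ((hasDerivAt_id r).pow 3) (by simp [hr.ne']))
    refine h1.congr_deriv ?_
    simp only [hb', id, Pi.mul_apply, Pi.pow_apply]
    field_simp
    ring
  have hle : ∀ r > 0, b' r ≤ G r := by
    intro r hr
    have : G r - b' r = a * (u r / r) ^ 2 + (u₁ r / r) ^ 2 := by
      simp only [hGdef, hb', hf r hr]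
      field_simp
      ring
    have : 0 ≤ G r - b' r := by rw [this]; positivity
    linarith
  have hF : ∀ r > 0, HasDerivAt (fun r => u r ^ 2) (2 * u r * u₁ r) r := by
    intro r hr
    refine ((hu r hr).pow 2).congr_deriv (by norm_num)
  have h0 := le_setIntegral_of_frequently_nonpos one_pos (fun r hr => hbd r hr.1) hGint
    (fun r hr => hle r hr.1) (by
      have h := frequently_le_deriv_near_zero 0 (fun r _ => sq_nonneg (u r)) hF hint4
      refine (h.and_eventually (Ioo_mem_nhdsGT one_pos)).mono ?_
      rintro r ⟨h1, h2⟩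
      have hr : 0 < r := h2.1
      have h3 : 0 ≤ u₁ r * u r / r ^ 2 := div_nonneg (by linarith) (by positivity)
      have h4 : 0 ≤ u r ^ 2 / r ^ 3 := by positivity
      simp only [hb]
      linarith)
  have h1 := neg_le_setIntegral_of_frequently one_pos
    (fun r hr => hbd r (one_pos.trans_le hr)) hGint
    (fun r hr => hle r (one_pos.trans_le hr)) (by
      intro η hη
      have h := frequently_deriv_add_le_atTop 2 η hη (fun r _ => sq_nonneg (u r)) hF hint
      refine (h.and_eventually (eventually_ge_atTop 1)).mono ?_
      rintro r ⟨h1, h2⟩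
      have hr : 0 < r := by linarith
      have h3 : b r = -((u₁ r * u r + u r ^ 2 / r) / r ^ 2) := by
        simp only [hb]; field_simp; ring
      have h4 : u r ^ 2 / r ≤ u r ^ 2 := div_le_self (sq_nonneg _) h2
      rw [h3, neg_le_neg_iff, div_le_iff₀ (by positivity)]
      have : η ≤ η * r ^ 2 := le_mul_of_one_le_right hη.le (one_le_pow₀ h2)
      linarith)
  have e1 : ∫ r in Ioi (0 : ℝ), G r = (∫ r in Ioc 0 1, G r) + ∫ r in Ioi 1, G r := by
    rw [← setIntegral_union, Ioc_union_Ioi_eq_Ioi zero_le_one]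
    · exact Ioc_disjoint_Ioi le_rfl
    · exact measurableSet_Ioi
    · exact hGint.mono_set Ioc_subset_Ioi_self
    · exact hGint.mono_set (Ioi_subset_Ioi zero_le_one)
  have e2 : ∫ r in Ioi (0 : ℝ), G r = (∫ r in Ioi (0 : ℝ), f r * (u r / r ^ 2))
      - (κ - 3) * ∫ r in Ioi (0 : ℝ), u r ^ 2 / r ^ 4 := by
    rw [← integral_const_mul, ← integral_sub hG (hint4.const_mul _)]
  linarith

/-- Symmetry of a Schrödinger operator against a compactly supported function. -/
lemma integral_schrodinger_symm {u u₁ u₂ h h₁ h₂ U : ℝ → ℝ} {a b : ℝ} (ha : 0 < a)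
    (hu : ∀ r > 0, HasDerivAt u (u₁ r) r) (hu₁ : ∀ r > 0, HasDerivAt u₁ (u₂ r) r)
    (hh : ∀ r > 0, HasDerivAt h (h₁ r) r) (hh₁ : ∀ r > 0, HasDerivAt h₁ (h₂ r) r)
    (h0 : ∀ r, r < a ∨ b < r → h r = 0 ∧ h₁ r = 0)
    (hi1 : IntegrableOn (fun r => (-u₂ r + U r * u r) * h r) (Ioi 0))
    (hi2 : IntegrableOn (fun r => u r * (-h₂ r + U r * h r)) (Ioi 0)) :
    ∫ r in Ioi (0 : ℝ), (-u₂ r + U r * u r) * h r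
      = ∫ r in Ioi (0 : ℝ), u r * (-h₂ r + U r * h r) := by
  rw [← sub_eq_zero, ← integral_sub hi1 hi2]
  have hz : ∀ r, r < a ∨ b < r → -(u₁ r * h r) + u r * h₁ r = 0 := by
    intro r hr
    rw [(h0 r hr).1, (h0 r hr).2]; ring
  have := integral_Ioi_of_hasDerivAt_of_tendsto (a := 0) (m := 0)
    (f := fun r => -(u₁ r * h r) + u r * h₁ r)
    (f' := fun r => (-u₂ r + U r * u r) * h r - u r * (-h₂ r + U r * h r)) ?_ ?_
    (hi1.sub hi2) ?_
  · rw [this, hz 0 (Or.inl ha)]; ring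
  · refine ContinuousAt.continuousWithinAt ?_
    refine (continuousAt_const (y := (0 : ℝ))).congr ?_
    filter_upwards [Iio_mem_nhds ha] with r hr
    exact (hz r (Or.inl hr)).symm
  · intro r hr
    have h1 := ((hu₁ r hr).mul (hh r hr)).neg.add ((hu r hr).mul (hh₁ r hr))
    refine h1.congr_deriv ?_
    ring
  · refine (tendsto_const_nhds (x := (0 : ℝ))).congr' ?_
    filter_upwards [eventually_gt_atTop b] with r hr
    exact (hz r (Or.inr hr)).symm

end Coercivity

section Hyperbolic

lemma one_sub_tanh_sq (y : ℝ) : 1 - tanh y ^ 2 = (1 / cosh y) ^ 2 := by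
  have h := cosh_pos y
  rw [tanh_eq_sinh_div_cosh, div_pow, div_pow, one_pow, eq_div_iff (by positivity), sub_mul,
    div_mul_cancel₀ _ (by positivity), cosh_sq y]
  ring

lemma one_sub_tanh_sq_nonneg (y : ℝ) : 0 ≤ 1 - tanh y ^ 2 := by
  rw [one_sub_tanh_sq]; positivity

lemma abs_tanh_le_one (y : ℝ) : |tanh y| ≤ 1 :=
  abs_le_one_iff_mul_self_le_one.2 (by nlinarith [one_sub_tanh_sq_nonneg y])

lemma one_sub_tanh_sq_le (y : ℝ) : 1 - tanh y ^ 2 ≤ 1 / (1 + y ^ 2) := by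
  rw [one_sub_tanh_sq, div_pow, one_pow, cosh_sq y]
  apply one_div_le_one_div_of_le (by positivity)
  have : y ^ 2 ≤ sinh y ^ 2 := by
    rw [← sq_abs y, ← sq_abs (sinh y), abs_sinh]
    exact pow_le_pow_left₀ (abs_nonneg _) (self_le_sinh_iff.2 (abs_nonneg _)) 2
  linarith

lemma hasDerivAt_tanh_mul (β x : ℝ) :
    HasDerivAt (fun x => tanh (β * x)) (β * (1 - tanh (β * x) ^ 2)) x := by
  have hc := cosh_pos (β * x)
  have hl : HasDerivAt (fun x => β * x) β x := by simpa using (hasDerivAt_id x).const_mul β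
  have h := hl.sinh.div hl.cosh hc.ne'
  have e : (fun x => tanh (β * x)) = (fun x => sinh (β * x)) / fun x => cosh (β * x) := by
    funext x; exact tanh_eq_sinh_div_cosh _
  rw [e]
  refine h.congr_deriv ?_
  rw [tanh_eq_sinh_div_cosh]
  field_simp

lemma hasDerivAt_sech_rpow_mul (k β x : ℝ) :
    HasDerivAt (fun x => (1 / cosh (β * x)) ^ k)
      (-(k * β * tanh (β * x) * (1 / cosh (β * x)) ^ k)) x := by
  have hc := cosh_pos (β * x)
  have hl : HasDerivAt (fun x => β * x) β x := by simpa using (hasDerivAt_id x).const_mul β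
  have h := ((hasDerivAt_const x (1 : ℝ)).div hl.cosh hc.ne').rpow_const (p := k)
    (Or.inl (by simp only [Pi.div_apply]; positivity))
  refine h.congr_deriv ?_
  have e : (1 / cosh (β * x)) ^ (k - 1) = (1 / cosh (β * x)) ^ k * cosh (β * x) := by
    rw [rpow_sub_one (by positivity)]; field_simp
  simp only [Pi.div_apply]
  rw [e, tanh_eq_sinh_div_cosh]
  field_simp
  ring

lemma sech_rpow_pos (k y : ℝ) : 0 < (1 / cosh y) ^ k :=
  rpow_pos_of_pos (by have := cosh_pos y; positivity) k

lemma sech_rpow_le_one {k : ℝ} (hk : 0 ≤ k) (y : ℝ) : (1 / cosh y) ^ k ≤ 1 := by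
  have := cosh_pos y
  exact rpow_le_one (by positivity) (by rw [div_le_one this]; exact one_le_cosh y) hk

lemma tanh_le_tanh_of_le {x y : ℝ} (h : x ≤ y) : tanh x ≤ tanh y := by
  have := monotone_of_hasDerivAt_nonneg (f := fun x => tanh (1 * x))
    (f' := fun x => 1 * (1 - tanh (1 * x) ^ 2))
    (fun x => hasDerivAt_tanh_mul 1 x) (fun x => by
      have := one_sub_tanh_sq_nonneg (1 * x); simpa using this)
  simpa using this h

lemma tanh_pos_of_pos {x : ℝ} (h : 0 < x) : 0 < tanh x := by
  rw [tanh_eq_sinh_div_cosh]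
  exact div_pos (sinh_pos_iff.2 h) (cosh_pos x)

/-- Solution of the Riccati inequality for the operator with potential
`m² β² - (m + 1) (m + 2) β² sech² (β x)`. -/
noncomputable def riccatiProfile (m β τ x : ℝ) : ℝ :=
  β * ((m + 1) * tanh (β * x) - 1 / tanh (β * x) - τ / tanh (β * x) ^ 2)

noncomputable def riccatiProfileDeriv (m β τ x : ℝ) : ℝ :=
  β ^ 2 * ((1 - tanh (β * x) ^ 2) *
    ((m + 1) + 1 / tanh (β * x) ^ 2 + 2 * τ / tanh (β * x) ^ 3))

lemma hasDerivAt_riccatiProfile {m β τ x : ℝ} (hx : tanh (β * x) ≠ 0) :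
    HasDerivAt (riccatiProfile m β τ) (riccatiProfileDeriv m β τ x) x := by
  have h := hasDerivAt_tanh_mul β x
  have h1 := (((h.const_mul (m + 1)).sub ((hasDerivAt_const x (1 : ℝ)).div h hx)).sub
    ((hasDerivAt_const x τ).div (h.pow 2) (pow_ne_zero 2 hx))).const_mul β
  refine h1.congr_deriv ?_
  unfold riccatiProfileDeriv
  simp only [Pi.pow_apply]
  generalize tanh (β * x) = σ at *
  field_simp
  ring

lemma riccatiProfile_identity {m β τ x : ℝ} (hx : tanh (β * x) ≠ 0) :
    m ^ 2 * β ^ 2 - (m + 1) * (m + 2) * β ^ 2 * (1 - tanh (β * x) ^ 2)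
      + riccatiProfileDeriv m β τ x - riccatiProfile m β τ x ^ 2
      = β ^ 2 * (2 * m * τ / tanh (β * x) - τ ^ 2 / tanh (β * x) ^ 4) := by
  unfold riccatiProfileDeriv riccatiProfile
  generalize tanh (β * x) = σ at *
  field_simp
  ring

lemma abs_riccatiProfile_le {m β τ x t b : ℝ} (hm : 0 < m) (hβ : 0 < β) (hb : β ≤ b) (ht : 0 < t)
    (hx : t ≤ |tanh (β * x)|) (hτ : |τ| ≤ m * t ^ 3) :
    |riccatiProfile m β τ x| ≤ b * (m + 1 + 1 / t + m * t) := by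
  unfold riccatiProfile
  have h1 := abs_tanh_le_one (β * x)
  generalize tanh (β * x) = σ at *
  rw [abs_mul, abs_of_pos hβ]
  have e1 : |(m + 1) * σ| ≤ m + 1 := by
    rw [abs_mul, abs_of_pos (by linarith : 0 < m + 1)]
    exact mul_le_of_le_one_right (by linarith) h1
  have e2 : |1 / σ| ≤ 1 / t := by
    rw [abs_div, abs_one]; exact one_div_le_one_div_of_le ht hx
  have e3 : |τ / σ ^ 2| ≤ m * t := by
    rw [abs_div, abs_pow, div_le_iff₀ (by have := ht.trans_le hx; positivity)]
    have : m * t * t ^ 2 ≤ m * t * |σ| ^ 2 := by gcongr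
    calc _ ≤ _ := hτ
      _ = m * t * t ^ 2 := by ring
      _ ≤ _ := this
  have e4 : |(m + 1) * σ - 1 / σ - τ / σ ^ 2| ≤ m + 1 + 1 / t + m * t :=
    (abs_sub _ _).trans (add_le_add ((abs_sub _ _).trans (add_le_add e1 e2)) e3)
  exact mul_le_mul hb e4 (abs_nonneg _) (hβ.le.trans hb)

/-- The Riccati defect is bounded below away from the origin. -/
lemma riccatiProfile_defect {m β b₀ τ x t : ℝ} (hm : 0 < m) (hb₀ : 0 < b₀) (hβ : b₀ ≤ β)
    (ht : 0 < t) (hx : t ≤ |tanh (β * x)|) (hτ : |τ| = m * t ^ 3)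
    (hsgn : 0 ≤ τ * tanh (β * x)) :
    b₀ ^ 2 * (m ^ 2 * t ^ 3) ≤
      m ^ 2 * β ^ 2 - (m + 1) * (m + 2) * β ^ 2 * (1 - tanh (β * x) ^ 2)
      + riccatiProfileDeriv m β τ x - riccatiProfile m β τ x ^ 2 := by
  have hne : tanh (β * x) ≠ 0 := abs_pos.1 (ht.trans_le hx)
  rw [riccatiProfile_identity hne]
  have h1 := abs_tanh_le_one (β * x)
  generalize tanh (β * x) = σ at *
  have hσ : 0 < |σ| := ht.trans_le hx
  have e1 : 2 * m * τ / σ = 2 * m * (|τ| / |σ|) := by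
    have : τ / σ = |τ| / |σ| := by
      rw [div_eq_div_iff hne hσ.ne']
      rcases lt_or_gt_of_ne hne with h | h
      · have hτ0 : τ ≤ 0 := by nlinarith
        rw [abs_of_neg h, abs_of_nonpos hτ0]; ring
      · have hτ0 : 0 ≤ τ := by nlinarith
        rw [abs_of_pos h, abs_of_nonneg hτ0]
    rw [mul_div_assoc, this]
  have e2 : τ ^ 2 / σ ^ 4 = |τ| ^ 2 / |σ| ^ 4 := by
    rw [sq_abs, ← abs_pow σ 4, abs_of_nonneg (by positivity : 0 ≤ σ ^ 4)]
  rw [e1, e2]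
  generalize |σ| = s at *
  rw [hτ]
  have e3 : (m * t ^ 3) ^ 2 / s ^ 4 ≤ m * (m * t ^ 3 / s) := by
    rw [← mul_div_assoc, div_le_div_iff₀ (by positivity) hσ]
    have : t ^ 3 ≤ s ^ 3 := by gcongr
    have : (m ^ 2 * t ^ 3 * s) * t ^ 3 ≤ (m ^ 2 * t ^ 3 * s) * s ^ 3 := by gcongr
    linarith
  have e4 : m * t ^ 3 ≤ m * t ^ 3 / s := by
    rw [le_div_iff₀ hσ]
    exact mul_le_of_le_one_right (by positivity) h1
  have e5 : m ^ 2 * t ^ 3 ≤ 2 * m * (m * t ^ 3 / s) - (m * t ^ 3) ^ 2 / s ^ 4 := by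
    have : m * (m * t ^ 3) ≤ m * (m * t ^ 3 / s) := by gcongr
    nlinarith
  calc b₀ ^ 2 * (m ^ 2 * t ^ 3) ≤ β ^ 2 * (m ^ 2 * t ^ 3) := by gcongr
    _ ≤ _ := by gcongr

end Hyperbolic

section Coercivity
open Set

/-- Interpolated Riccati function on the outer side of the well. -/
lemma interpolated_riccati_bound {θ l x D W ω K S R R' μ U : ℝ} (hl : 0 < l) (hx : 0 ≤ x)
    (hθ : θ = l / (l + x)) (hK : 0 ≤ K) (hR : |R| ≤ S)
    (hpot : x * D ≤ W)
    (hU₁ : μ - K / l - K * x / l ^ 2 - D ≤ U) (hU₂ : ω - K / l - D ≤ U) (hD : 0 ≤ D)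
    {δ₁ : ℝ} (hdef : δ₁ ≤ μ - D + R' - R ^ 2) :
    min δ₁ ω - (2 * K + S + W) / l ≤ U + (θ * R' - θ ^ 2 / l * R) - (θ * R) ^ 2 := by
  have hlx : 0 < l + x := by linarith
  have hθ0 : 0 < θ := by rw [hθ]; positivity
  have hθ1 : θ ≤ 1 := by rw [hθ, div_le_one hlx]; linarith
  have hS : 0 ≤ S := (abs_nonneg _).trans hR
  have h1 : θ * x = (1 - θ) * l := by rw [hθ]; field_simp; ring
  have h2 : (1 - θ) * l ≤ x := by rw [← h1]; exact mul_le_of_le_one_left hx hθ1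
  have hU : θ * (μ - K / l - K * x / l ^ 2 - D) + (1 - θ) * (ω - K / l - D) ≤ U := by
    have a1 := mul_le_mul_of_nonneg_left hU₁ hθ0.le
    have a2 := mul_le_mul_of_nonneg_left hU₂ (by linarith : 0 ≤ 1 - θ)
    linarith
  have e1 : θ * (K * x / l ^ 2) ≤ K / l := by
    have : θ * (K * x / l ^ 2) = (1 - θ) * (K / l) := by
      calc θ * (K * x / l ^ 2) = (θ * x) * (K / l ^ 2) := by ring
        _ = _ := by rw [h1]; field_simp
    rw [this]
    exact mul_le_of_le_one_left (by positivity) (by linarith)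
  have e2 : (1 - θ) * D ≤ W / l := by
    rw [le_div_iff₀ hl]
    have := mul_le_mul_of_nonneg_right h2 hD
    linarith
  have e3 : θ ^ 2 / l * R ≤ S / l := by
    rw [div_mul_eq_mul_div]
    gcongr
    have : θ ^ 2 ≤ 1 := pow_le_one₀ hθ0.le hθ1
    calc θ ^ 2 * R ≤ θ ^ 2 * S := by gcongr; exact (le_abs_self R).trans hR
      _ ≤ S := mul_le_of_le_one_left hS this
  have e4 : (θ * R) ^ 2 ≤ θ * R ^ 2 := by
    have : θ * (θ * R ^ 2) ≤ 1 * (θ * R ^ 2) := by gcongr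
    linarith
  have e5 : min δ₁ ω ≤ θ * (μ - D + R' - R ^ 2) + (1 - θ) * ω := by
    have a1 := mul_le_mul_of_nonneg_left ((min_le_left δ₁ ω).trans hdef) hθ0.le
    have a2 := mul_le_mul_of_nonneg_left (min_le_right δ₁ ω) (by linarith : 0 ≤ 1 - θ)
    linarith
  have e6 : (2 * K + S + W) / l = K / l + K / l + S / l + W / l := by ring
  rw [e6]
  linarith

lemma mul_one_sub_tanh_sq_le {β x : ℝ} (hβ : 0 < β) :
    x * (β ^ 2 * (1 - tanh (β * x) ^ 2)) ≤ β / 2 := by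
  rcases le_or_gt x 0 with h | h
  · have : 0 ≤ β ^ 2 * (1 - tanh (β * x) ^ 2) := by
      have := one_sub_tanh_sq_nonneg (β * x); positivity
    have := mul_nonpos_of_nonpos_of_nonneg h this
    linarith
  · calc x * (β ^ 2 * (1 - tanh (β * x) ^ 2)) ≤ x * (β ^ 2 * (1 / (1 + (β * x) ^ 2))) := by
          gcongr; exact one_sub_tanh_sq_le _
      _ = (β * (β * x)) / (1 + (β * x) ^ 2) := by ring
      _ ≤ β / 2 := by
          rw [div_le_div_iff₀ (by positivity) (by norm_num)]
          have := mul_nonneg hβ.le (sq_nonneg (β * x - 1))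
          linarith

/-- Coercivity of `-∂² + U` for a single-well potential, on functions vanishing at two points
close to the bottom of the well. -/
lemma exists_coercivity {m b₀ b₁ ω K : ℝ} (hm : 0 < m) (hb₀ : 0 < b₀) (hb₁ : b₀ ≤ b₁)
    (hω : 0 < ω) (hK : 0 ≤ K) :
    ∃ δ > 0, ∃ a > 0, ∃ L₀ > 0, δ ≤ b₀ ^ 2 ∧
    ∀ l ≥ L₀, ∀ β ∈ Icc b₀ b₁, ∀ ρ > a, ∀ U : ℝ → ℝ,
    (∀ r ∈ Ioc 0 ρ, m ^ 2 * β ^ 2 - K / l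
      - (m + 1) * (m + 2) * β ^ 2 * (1 - tanh (β * (r - ρ)) ^ 2) ≤ U r) →
    (∀ r ≥ ρ, m ^ 2 * β ^ 2 - K / l - K * (r - ρ) / l ^ 2
      - (m + 1) * (m + 2) * β ^ 2 * (1 - tanh (β * (r - ρ)) ^ 2) ≤ U r) →
    (∀ r ≥ ρ, ω - K / l
      - (m + 1) * (m + 2) * β ^ 2 * (1 - tanh (β * (r - ρ)) ^ 2) ≤ U r) →
    ∀ z z₁ z₂ : ℝ → ℝ,
    (∀ r > 0, HasDerivAt z (z₁ r) r) → (∀ r > 0, HasDerivAt z₁ (z₂ r) r) →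
    z (ρ - a) = 0 → z (ρ + a) = 0 →
    IntegrableOn (fun r => z r ^ 2) (Ioi 0) →
    IntegrableOn (fun r => z r ^ 2 / r ^ 4) (Ioi 0) →
    IntegrableOn (fun r => (-z₂ r + U r * z r) * z r) (Ioi 0) →
    δ * ∫ r in Ioi (0 : ℝ), z r ^ 2 ≤ ∫ r in Ioi (0 : ℝ), (-z₂ r + U r * z r) * z r := by
  have hb₁0 : 0 < b₁ := hb₀.trans_le hb₁
  set C₁ : ℝ := (m + 1) * (m + 2) * b₁ ^ 2 with hC₁
  have hC₁0 : 0 < C₁ := by positivity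
  set M : ℝ := 2 * (C₁ + 1) with hM
  have hM0 : 0 < M := by positivity
  set a : ℝ := √(1 / (2 * M)) with ha
  have ha0 : 0 < a := sqrt_pos.2 (by positivity)
  have ha2 : a ^ 2 = 1 / (2 * M) := sq_sqrt (by positivity)
  set t : ℝ := tanh (b₀ * a) with ht
  have ht0 : 0 < t := tanh_pos_of_pos (by positivity)
  set δ₁ : ℝ := b₀ ^ 2 * (m ^ 2 * t ^ 3) with hδ₁
  have hδ₁0 : 0 < δ₁ := by positivity
  set S : ℝ := b₁ * (m + 1 + 1 / t + m * t) with hS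
  have hS0 : 0 < S := by positivity
  set W : ℝ := (m + 1) * (m + 2) * b₁ / 2 with hW
  have hW0 : 0 < W := by positivity
  set d : ℝ := min (min δ₁ ω) (min 1 (b₀ ^ 2)) with hd
  have hd0 : 0 < d := by positivity
  have hd1 : d ≤ min δ₁ ω := min_le_left _ _
  have hd2 : d ≤ δ₁ := hd1.trans (min_le_left _ _)
  have hd3 : d ≤ 1 := (min_le_right _ _).trans (min_le_left _ _)
  have hd4 : d ≤ b₀ ^ 2 := (min_le_right _ _).trans (min_le_right _ _)
  refine ⟨d / 2, by positivity, a, ha0, 2 * (2 * K + S + W) / d, by positivity, by linarith, ?_⟩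
  intro l hl β hβ ρ hρ U hU₁ hU₂ hU₃ z z₁ z₂ hz hz₁ hz0 hz0' hint hint4 hG
  have hβ0 : 0 < β := hb₀.trans_le hβ.1
  have hl0 : 0 < l := lt_of_lt_of_le (by positivity) hl
  have hsum : (2 * K + S + W) / l ≤ d / 2 := by
    rw [ge_iff_le, div_le_iff₀ hd0] at hl
    rw [div_le_iff₀ hl0]; linarith
  have hKl : K / l ≤ d / 2 := by
    refine le_trans ?_ hsum
    gcongr; linarith
  have hKl0 : 0 ≤ K / l := by positivity
  have hpot : ∀ r, (m + 1) * (m + 2) * β ^ 2 * (1 - tanh (β * (r - ρ)) ^ 2) ≤ C₁ := fun r => by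
    have h1 : 1 - tanh (β * (r - ρ)) ^ 2 ≤ 1 := by linarith [sq_nonneg (tanh (β * (r - ρ)))]
    have h2 : β ^ 2 ≤ b₁ ^ 2 := by have := hβ.2; gcongr
    calc (m + 1) * (m + 2) * β ^ 2 * (1 - tanh (β * (r - ρ)) ^ 2)
        ≤ (m + 1) * (m + 2) * β ^ 2 * 1 := by gcongr
      _ ≤ C₁ := by rw [mul_one, hC₁]; gcongr
  have htR : ∀ x ≥ a, t ≤ tanh (β * x) := fun x hx =>
    tanh_le_tanh_of_le (mul_le_mul hβ.1 hx ha0.le hβ0.le)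
  have htL : ∀ x ≤ -a, tanh (β * x) ≤ -t := fun x hx => by
    have := htR (-x) (by linarith)
    rw [mul_neg, tanh_neg] at this; linarith
  have shift : ∀ r : ℝ, HasDerivAt (fun r => r - ρ) 1 r := fun r => (hasDerivAt_id r).sub_const ρ
  refine integral_form_nonneg_of_riccati (r₁ := ρ - a) (r₂ := ρ + a) (S := S)
    (sL := fun r => riccatiProfile m β (-(m * t ^ 3)) (r - ρ))
    (sL' := fun r => riccatiProfileDeriv m β (-(m * t ^ 3)) (r - ρ))
    (sM := fun r => M * (r - ρ)) (sM' := fun _ => M)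
    (sR := fun r => l / (l + (r - ρ)) * riccatiProfile m β (m * t ^ 3) (r - ρ))
    (sR' := fun r => l / (l + (r - ρ)) * riccatiProfileDeriv m β (m * t ^ 3) (r - ρ)
      - (l / (l + (r - ρ))) ^ 2 / l * riccatiProfile m β (m * t ^ 3) (r - ρ))
    (by linarith) (by linarith) hz hz₁ hz0 hz0' hint hint4 hG ?_ ?_ ?_ ?_ ?_ ?_ ?_ ?_
  · intro r hr
    have hσ := htL (r - ρ) (by linarith [hr.2])
    have := (hasDerivAt_riccatiProfile (m := m) (β := β) (τ := -(m * t ^ 3))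
      (by linarith : tanh (β * (r - ρ)) < 0).ne).comp r (shift r)
    exact this.congr_deriv (mul_one _)
  · intro r _
    exact ((shift r).const_mul M).congr_deriv (mul_one _)
  · intro r hr
    have hr' : ρ + a ≤ r := hr
    have hσ := htR (r - ρ) (by linarith)
    have h1 := (hasDerivAt_riccatiProfile (m := m) (β := β) (τ := m * t ^ 3)
      (by linarith : 0 < tanh (β * (r - ρ))).ne').comp r (shift r)
    have hne : l + (r - ρ) ≠ 0 := by linarith
    have h2 := (hasDerivAt_const r l).div ((shift r).const_add l) hne
    refine (h2.mul h1).congr_deriv ?_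
    simp only [Function.comp, Pi.div_apply]
    field_simp
    ring
  · intro r hr
    have hσ := htL (r - ρ) (by linarith [hr.2])
    refine abs_riccatiProfile_le hm hβ0 hβ.2 ht0 ?_ ?_
    · rw [abs_of_neg (by linarith)]; linarith
    · rw [abs_neg, abs_of_pos (by positivity)]
  · intro r hr
    have hr' : ρ + a ≤ r := hr
    have hσ := htR (r - ρ) (by linarith)
    have h1 := abs_riccatiProfile_le (m := m) (τ := m * t ^ 3) (x := r - ρ) hm hβ0 hβ.2 ht0
      (by rw [abs_of_pos (by linarith)]; exact hσ) (by rw [abs_of_pos (by positivity)])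
    simp only [abs_mul]
    have hp : 0 < l + (r - ρ) := by linarith
    have h2 : |l / (l + (r - ρ))| ≤ 1 := by
      rw [abs_of_pos (by positivity), div_le_one hp]; linarith
    exact (mul_le_of_le_one_left (abs_nonneg _) h2).trans h1
  · intro r hr
    have hσ := htL (r - ρ) (by linarith [hr.2])
    have h1 := hU₁ r ⟨hr.1, by linarith [hr.2]⟩
    have h2 := riccatiProfile_defect (m := m) (τ := -(m * t ^ 3)) (x := r - ρ) hm hb₀ hβ.1 ht0
      (by rw [abs_of_neg (by linarith)]; linarith)
      (by rw [abs_neg, abs_of_pos (by positivity)])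
      (by
        have : 0 ≤ (m * t ^ 3) * (-tanh (β * (r - ρ))) := by
          apply mul_nonneg (by positivity); linarith
        linarith)
    linarith
  · intro r hr
    have h1 : -(C₁ + 1 / 2) ≤ U r := by
      have := hpot r
      rcases le_or_gt r ρ with h | h
      · have h1 := hU₁ r ⟨by linarith [hr.1], h⟩
        have : 0 ≤ m ^ 2 * β ^ 2 := by positivity
        linarith
      · have h1 := hU₃ r h.le
        linarith
    have h2 : (r - ρ) ^ 2 ≤ a ^ 2 := sq_le_sq' (by linarith [hr.1]) (by linarith [hr.2])
    have h3 : (M * (r - ρ)) ^ 2 ≤ M / 2 := by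
      calc (M * (r - ρ)) ^ 2 = M ^ 2 * (r - ρ) ^ 2 := by ring
        _ ≤ M ^ 2 * a ^ 2 := by gcongr
        _ = M / 2 := by rw [ha2]; field_simp
    have h4 : M / 2 = C₁ + 1 := by rw [hM]; ring
    linarith
  · intro r hr
    have hr' : ρ + a ≤ r := hr
    have hσ := htR (r - ρ) (by linarith)
    have h2 := riccatiProfile_defect (m := m) (τ := m * t ^ 3) (x := r - ρ) hm hb₀ hβ.1 ht0
      (by rw [abs_of_pos (by linarith)]; exact hσ)
      (by rw [abs_of_pos (by positivity)])
      (by apply mul_nonneg (by positivity); linarith)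
    have hR := abs_riccatiProfile_le (m := m) (τ := m * t ^ 3) (x := r - ρ) hm hβ0 hβ.2 ht0
      (by rw [abs_of_pos (by linarith)]; exact hσ) (by rw [abs_of_pos (by positivity)])
    have hW' : (r - ρ) * ((m + 1) * (m + 2) * β ^ 2 * (1 - tanh (β * (r - ρ)) ^ 2)) ≤ W := by
      have h := mul_one_sub_tanh_sq_le (β := β) (x := r - ρ) hβ0
      have h' := mul_le_mul_of_nonneg_left (h.trans (by have := hβ.2; gcongr : β / 2 ≤ b₁ / 2))
        (by positivity : 0 ≤ (m + 1) * (m + 2))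
      rw [hW]; linarith
    have hD : 0 ≤ (m + 1) * (m + 2) * β ^ 2 * (1 - tanh (β * (r - ρ)) ^ 2) := by
      have := one_sub_tanh_sq_nonneg (β * (r - ρ)); positivity
    have := interpolated_riccati_bound (U := U r) hl0 (by linarith : 0 ≤ r - ρ) rfl hK hR hW'
      (hU₂ r (by linarith)) (hU₃ r (by linarith)) hD h2
    linarith

end Coercivity

section Regime
open Set

/-- A `C²` cutoff function supported in `[-3, 3]`, equal to `1` on `[-2, 2]`. -/
structure IsCutoff (χ χ₁ χ₂ : ℝ → ℝ) (X : ℝ) : Prop where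
  hasDerivAt : ∀ s, HasDerivAt χ (χ₁ s) s
  hasDerivAt₁ : ∀ s, HasDerivAt χ₁ (χ₂ s) s
  continuous₂ : Continuous χ₂
  nonneg : ∀ s, 0 ≤ χ s
  le_one : ∀ s, χ s ≤ 1
  eq_one : ∀ s, |s| ≤ 2 → χ s = 1
  eq_zero : ∀ s, 3 < |s| → χ s = 0 ∧ χ₁ s = 0 ∧ χ₂ s = 0
  bound₁ : ∀ s, |χ₁ s| ≤ X
  bound₂ : ∀ s, |χ₂ s| ≤ X

lemma IsCutoff.of_contDiff {χ : ℝ → ℝ} (hχsmooth : ContDiff ℝ (⊤ : ℕ∞) χ)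
    (hχrange : ∀ s, χ s ∈ Icc (0 : ℝ) 1) (hχone : ∀ s ∈ Icc (-2 : ℝ) 2, χ s = 1)
    (hχzero : ∀ s ∉ Ioo (-3 : ℝ) 3, χ s = 0) :
    ∃ X ≥ 0, IsCutoff χ (deriv χ) (deriv (deriv χ)) X := by
  have h1 : ContDiff ℝ 1 (deriv χ) := by
    have : ContDiff ℝ (1 + 1) χ := hχsmooth.of_le (by norm_cast)
    exact (contDiff_succ_iff_deriv.1 this).2.2
  have d0 : Differentiable ℝ χ := hχsmooth.differentiable (by simp)
  have d1 : Differentiable ℝ (deriv χ) := h1.differentiable (by simp)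
  have c2 : Continuous (deriv (deriv χ)) := h1.continuous_deriv (le_refl 1)
  have k0 : HasCompactSupport χ := HasCompactSupport.intro (isCompact_Icc (a := (-3 : ℝ)) (b := 3))
    fun s hs => hχzero s fun h => hs ⟨h.1.le, h.2.le⟩
  obtain ⟨X₁, hX₁⟩ := k0.deriv.exists_bound_of_continuous h1.continuous
  obtain ⟨X₂, hX₂⟩ := k0.deriv.deriv.exists_bound_of_continuous c2
  have z0 : ∀ s : ℝ, 3 < |s| → χ s = 0 := fun s hs => hχzero s fun h => by
    have := abs_lt.2 h; linarith
  have ev : ∀ s : ℝ, 3 < |s| → ∀ᶠ t in nhds s, 3 < |t| := fun s hs =>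
    continuous_abs.continuousAt.eventually (lt_mem_nhds hs)
  have z1 : ∀ s : ℝ, 3 < |s| → deriv χ s = 0 := fun s hs => by
    have : χ =ᶠ[nhds s] fun _ => 0 := (ev s hs).mono z0
    rw [this.deriv_eq]; simp
  have z2 : ∀ s : ℝ, 3 < |s| → deriv (deriv χ) s = 0 := fun s hs => by
    have : deriv χ =ᶠ[nhds s] fun _ => 0 := (ev s hs).mono z1
    rw [this.deriv_eq]; simp
  refine ⟨max X₁ X₂, ((norm_nonneg _).trans (hX₁ 0)).trans (le_max_left _ _), ?_⟩
  exact ⟨fun s => (d0 s).hasDerivAt, fun s => (d1 s).hasDerivAt, c2, fun s => (hχrange s).1,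
    fun s => (hχrange s).2, fun s hs => hχone s (abs_le.1 hs),
    fun s hs => ⟨z0 s hs, z1 s hs, z2 s hs⟩, fun s => (hX₁ s).trans (le_max_left _ _),
    fun s => (hX₂ s).trans (le_max_right _ _)⟩

/-- The range of parameters in which the radius `ρ` is large compared with the cutoff scale `l`,
which is itself large. -/
structure IsRegime (m b₀ b₁ ω q₁ ε ρ β l : ℝ) : Prop where
  m_pos : 0 < m
  b₀_pos : 0 < b₀
  b₀_le : b₀ ≤ β
  le_b₁ : β ≤ b₁
  ω_pos : 0 < ω
  ε_pos : 0 < ε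
  ρ_pos : 0 < ρ
  one_le : 1 ≤ l
  q_le : (ε * ρ)⁻¹ ≤ q₁
  six_mul_le : 6 * q₁ ≤ l
  ε_mul_le : ε * l ^ 2 ≤ 1
  sq_eq : m ^ 2 * β ^ 2 = ω + ((ε * ρ) ^ 2)⁻¹

variable {m b₀ b₁ ω q₁ ε ρ β l : ℝ}

namespace IsRegime

lemma l_pos (h : IsRegime m b₀ b₁ ω q₁ ε ρ β l) : 0 < l := by linarith [h.one_le]

lemma β_pos (h : IsRegime m b₀ b₁ ω q₁ ε ρ β l) : 0 < β := h.b₀_pos.trans_le h.b₀_le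

lemma q_pos (h : IsRegime m b₀ b₁ ω q₁ ε ρ β l) : 0 < (ε * ρ)⁻¹ := by
  have := h.ε_pos; have := h.ρ_pos; positivity

lemma q₁_pos (h : IsRegime m b₀ b₁ ω q₁ ε ρ β l) : 0 < q₁ := h.q_pos.trans_le h.q_le

lemma ε_le_one (h : IsRegime m b₀ b₁ ω q₁ ε ρ β l) : ε ≤ 1 := by
  have h1 : (1 : ℝ) ≤ l ^ 2 := one_le_pow₀ h.one_le
  have := mul_le_mul_of_nonneg_left h1 h.ε_pos.le
  linarith [h.ε_mul_le]

lemma one_div_le (h : IsRegime m b₀ b₁ ω q₁ ε ρ β l) : 1 / ρ ≤ q₁ / l ^ 2 := by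
  have hε := h.ε_pos; have hρ := h.ρ_pos; have hl := h.l_pos
  have hq := h.q_le
  have e : 1 / ρ = ε * (ε * ρ)⁻¹ := by field_simp
  rw [e, le_div_iff₀ (by positivity)]
  calc ε * (ε * ρ)⁻¹ * l ^ 2 = (ε * l ^ 2) * (ε * ρ)⁻¹ := by ring
    _ ≤ 1 * (ε * ρ)⁻¹ := by gcongr; exact h.ε_mul_le
    _ ≤ q₁ := by linarith

lemma six_l_le (h : IsRegime m b₀ b₁ ω q₁ ε ρ β l) : 6 * l ≤ ρ := by
  have h1 := h.one_div_le
  have hρ := h.ρ_pos; have hl := h.l_pos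
  rw [div_le_div_iff₀ hρ (by positivity)] at h1
  have h2 : 6 * q₁ * ρ ≤ l * ρ := by gcongr; exact h.six_mul_le
  have : l * (6 * l) ≤ l * ρ := by linarith
  exact le_of_mul_le_mul_left this hl

lemma quarter_le (h : IsRegime m b₀ b₁ ω q₁ ε ρ β l) {r : ℝ} (hr : 3 * l ≤ r) :
    1 / 4 / r ^ 2 ≤ 1 / l := by
  have hl := h.one_le
  have h1 : l * 1 ≤ l * l := by gcongr
  have hr0 : 0 < r := by linarith
  have h2 : l ^ 2 ≤ r ^ 2 := by
    have := h.l_pos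
    gcongr; linarith
  rw [div_le_div_iff₀ (by positivity) h.l_pos]
  linarith

lemma potential_eq (h : IsRegime m b₀ b₁ ω q₁ ε ρ β l) {r : ℝ} (hr : 0 < r) :
    ω + (1 / ε ^ 2 - 1 / 4) / r ^ 2
      = m ^ 2 * β ^ 2 + ((ε * ρ)⁻¹) ^ 2 * (ρ ^ 2 / r ^ 2 - 1) - 1 / 4 / r ^ 2 := by
  have hε := h.ε_pos; have hρ := h.ρ_pos
  rw [h.sq_eq]
  field_simp
  ring

lemma le_potential_left (h : IsRegime m b₀ b₁ ω q₁ ε ρ β l) {r : ℝ} (hr : r ∈ Ioc 0 ρ) :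
    m ^ 2 * β ^ 2 - (18 * q₁ ^ 3 + 1) / l ≤ ω + (1 / ε ^ 2 - 1 / 4) / r ^ 2 := by
  have hε := h.ε_pos; have hρ := h.ρ_pos; have hl := h.l_pos; have hq := h.q₁_pos
  have h0 := h.potential_eq hρ
  have h1 := h.quarter_le (r := ρ) (by linarith [h.six_l_le])
  have h2 : (1 / ε ^ 2 - 1 / 4) / ρ ^ 2 ≤ (1 / ε ^ 2 - 1 / 4) / r ^ 2 := by
    have h3 : 0 ≤ 1 / ε ^ 2 - 1 / 4 := by
      have : (1 : ℝ) ≤ 1 / ε ^ 2 := by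
        rw [le_div_iff₀ (by positivity), one_mul]; exact pow_le_one₀ hε.le h.ε_le_one
      linarith
    have := hr.1
    have := hr.2
    gcongr
  rw [div_self (by positivity)] at h0
  have h4 : (1 : ℝ) / l ≤ (18 * q₁ ^ 3 + 1) / l := by
    gcongr
    have : 0 ≤ q₁ ^ 3 := by positivity
    linarith
  linarith

lemma le_potential_right (h : IsRegime m b₀ b₁ ω q₁ ε ρ β l) {r : ℝ} (hr : ρ ≤ r) :
    m ^ 2 * β ^ 2 - (18 * q₁ ^ 3 + 1) / l - (18 * q₁ ^ 3 + 1) * (r - ρ) / l ^ 2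
      ≤ ω + (1 / ε ^ 2 - 1 / 4) / r ^ 2 := by
  have hε := h.ε_pos; have hρ := h.ρ_pos; have hl := h.l_pos; have hq := h.q₁_pos
  have hr0 : 0 < r := by linarith
  rw [h.potential_eq hr0]
  have h1 := h.quarter_le (r := r) (by linarith [h.six_l_le])
  have h2 : -(2 * (r - ρ) * (1 / ρ)) ≤ ρ ^ 2 / r ^ 2 - 1 := by
    have : ρ ^ 2 / r ^ 2 - 1 + 2 * (r - ρ) * (1 / ρ)
        = (r - ρ) ^ 2 * (2 * r + ρ) / (ρ * r ^ 2) := by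
      field_simp; ring
    have h3 : 0 ≤ (r - ρ) ^ 2 * (2 * r + ρ) / (ρ * r ^ 2) := by positivity
    linarith
  have hx : 0 ≤ r - ρ := by linarith
  have h3 : ((ε * ρ)⁻¹) ^ 2 * (2 * (r - ρ) * (1 / ρ)) ≤ (18 * q₁ ^ 3 + 1) * (r - ρ) / l ^ 2 := by
    have hq0 := h.q_pos
    calc ((ε * ρ)⁻¹) ^ 2 * (2 * (r - ρ) * (1 / ρ))
        ≤ q₁ ^ 2 * (2 * (r - ρ) * (q₁ / l ^ 2)) := by
          have := h.q_le; have := h.one_div_le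
          gcongr
      _ = 2 * q₁ ^ 3 * (r - ρ) / l ^ 2 := by ring
      _ ≤ _ := by
          gcongr
          have : 0 ≤ q₁ ^ 3 := by positivity
          linarith
  have h4 : (1 : ℝ) / l ≤ (18 * q₁ ^ 3 + 1) / l := by
    gcongr
    have : 0 ≤ q₁ ^ 3 := by positivity
    linarith
  have h5 := mul_le_mul_of_nonneg_left h2 (sq_nonneg ((ε * ρ)⁻¹))
  linarith

lemma omega_le_potential (h : IsRegime m b₀ b₁ ω q₁ ε ρ β l) {r : ℝ} (hr : 0 < r) :
    ω - (18 * q₁ ^ 3 + 1) / l ≤ ω + (1 / ε ^ 2 - 1 / 4) / r ^ 2 := by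
  have hε := h.ε_pos; have hl := h.l_pos; have hq := h.q₁_pos
  have h3 : 0 ≤ 1 / ε ^ 2 - 1 / 4 := by
    have : (1 : ℝ) ≤ 1 / ε ^ 2 := by
      rw [le_div_iff₀ (by positivity), one_mul]; exact pow_le_one₀ hε.le h.ε_le_one
    linarith
  have h4 : 0 ≤ (1 / ε ^ 2 - 1 / 4) / r ^ 2 := by positivity
  have h5 : 0 ≤ (18 * q₁ ^ 3 + 1) / l := by positivity
  linarith

lemma abs_potential_sub_le (h : IsRegime m b₀ b₁ ω q₁ ε ρ β l) {r : ℝ} (hr : |r - ρ| ≤ 3 * l) :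
    |ω + (1 / ε ^ 2 - 1 / 4) / r ^ 2 - m ^ 2 * β ^ 2| ≤ (18 * q₁ ^ 3 + 1) / l := by
  have hε := h.ε_pos; have hρ := h.ρ_pos; have hl := h.l_pos; have hq := h.q₁_pos
  have h6 := h.six_l_le
  have hr' := abs_le.1 hr
  have hr2 : ρ ≤ 2 * r := by linarith
  have hr0 : 0 < r := by linarith
  rw [h.potential_eq hr0]
  have h1 := h.quarter_le (r := r) (by linarith)
  have h2 : |ρ ^ 2 / r ^ 2 - 1| ≤ 18 * l * (1 / ρ) := by
    have e : ρ ^ 2 / r ^ 2 - 1 = -((r - ρ) * (ρ + r) / r ^ 2) := by field_simp; ring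
    rw [e, abs_neg, abs_div, abs_mul, abs_of_pos (by linarith : 0 < ρ + r),
      abs_of_pos (by positivity : 0 < r ^ 2), div_le_iff₀ (by positivity)]
    have e1 : |r - ρ| * (ρ + r) ≤ (3 * l) * (3 * r) := by
      gcongr; linarith
    have e2 : 9 * l * r * ρ ≤ 9 * l * r * (2 * r) := by gcongr
    refine e1.trans ?_
    rw [mul_one_div, div_mul_eq_mul_div, le_div_iff₀ hρ]
    linarith
  have h3 : |((ε * ρ)⁻¹) ^ 2 * (ρ ^ 2 / r ^ 2 - 1)| ≤ 18 * q₁ ^ 3 / l := by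
    have hq0 := h.q_pos
    rw [abs_mul, abs_of_pos (by positivity)]
    calc ((ε * ρ)⁻¹) ^ 2 * |ρ ^ 2 / r ^ 2 - 1|
        ≤ q₁ ^ 2 * (18 * l * (q₁ / l ^ 2)) := by
          have := h.q_le
          have h5 : 18 * l * (1 / ρ) ≤ 18 * l * (q₁ / l ^ 2) := by
            have := h.one_div_le
            gcongr
          have := h2.trans h5
          gcongr
      _ = 18 * q₁ ^ 3 / l := by field_simp
  have h4 : 0 ≤ 1 / 4 / r ^ 2 := by positivity
  have h5 : (18 * q₁ ^ 3 + 1) / l = 18 * q₁ ^ 3 / l + 1 / l := by ring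
  have h7 := abs_le.1 h3
  rw [abs_le, h5]
  constructor <;> linarith

end IsRegime

end Regime

section Modes
open Set

lemma memLp_two_of_bump {h : ℝ → ℝ} {C l ρ : ℝ} (hm : Measurable h) (hl : 0 < l)
    (h0 : ∀ r, 3 * l < |r - ρ| → h r = 0) (h1 : ∀ r, |r - ρ| ≤ 3 * l → |h r| ≤ C / l) :
    MemLp h 2 (volume.restrict (Ioi 0)) ∧ ∫ r in Ioi (0 : ℝ), h r ^ 2 ≤ 6 * C ^ 2 / l := by
  set I : Set ℝ := Icc (ρ - 3 * l) (ρ + 3 * l) with hI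
  have hle : ∀ r, h r ^ 2 ≤ I.indicator (fun _ => (C / l) ^ 2) r := fun r => by
    by_cases hr : |r - ρ| ≤ 3 * l
    · have hr' := abs_le.1 hr
      rw [indicator_of_mem (show r ∈ I from ⟨by linarith, by linarith⟩), ← sq_abs (h r)]
      have := h1 r hr
      gcongr
    · rw [h0 r (lt_of_not_ge hr)]
      exact (by norm_num : (0 : ℝ) ^ 2 = 0).le.trans (indicator_nonneg (fun _ _ => by positivity) _)
  have hIi : Integrable (I.indicator fun _ => (C / l) ^ 2) :=
    (integrable_indicator_iff measurableSet_Icc).2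
      (integrableOn_const (by rw [Real.volume_Icc]; exact ENNReal.ofReal_ne_top) (by simp))
  have hi : Integrable fun r => h r ^ 2 := by
    refine hIi.mono' (hm.pow_const 2).aestronglyMeasurable (ae_of_all _ fun r => ?_)
    rw [Real.norm_of_nonneg (sq_nonneg _)]; exact hle r
  refine ⟨(memLp_two_iff_integrable_sq hm.aestronglyMeasurable).2 hi.integrableOn, ?_⟩
  calc ∫ r in Ioi (0 : ℝ), h r ^ 2 ≤ ∫ r, h r ^ 2 :=
        setIntegral_le_integral hi (ae_of_all _ fun r => sq_nonneg _)
    _ ≤ ∫ r, I.indicator (fun _ => (C / l) ^ 2) r := integral_mono hi hIi hle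
    _ = 6 * C ^ 2 / l := by
        rw [integral_indicator measurableSet_Icc, setIntegral_const, Real.volume_real_Icc,
          max_eq_left (by linarith), smul_eq_mul]
        field_simp; ring

variable {m b₀ b₁ ω q₁ ε ρ β l X B μ : ℝ} {χ χ₁ χ₂ h h₁ h₂ ζ : ℝ → ℝ}

lemma hasDerivAt_cutoff_mul (hχ : IsCutoff χ χ₁ χ₂ X) (hh : ∀ x, HasDerivAt h (h₁ x) x) (r : ℝ) :
    HasDerivAt (fun r => χ ((r - ρ) / l) * h (r - ρ))
      (χ₁ ((r - ρ) / l) / l * h (r - ρ) + χ ((r - ρ) / l) * h₁ (r - ρ)) r := by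
  have s1 : HasDerivAt (fun r => r - ρ) 1 r := (hasDerivAt_id r).sub_const ρ
  have s2 : HasDerivAt (fun r => (r - ρ) / l) (1 / l) r := s1.div_const l
  have a1 := (hχ.hasDerivAt ((r - ρ) / l)).comp r s2
  have a2 := (hh (r - ρ)).comp r s1
  refine (a1.mul a2).congr_deriv ?_
  simp only [Function.comp]
  ring

lemma hasDerivAt_cutoff_mul₁ (hχ : IsCutoff χ χ₁ χ₂ X) (hh : ∀ x, HasDerivAt h (h₁ x) x)
    (hh₁ : ∀ x, HasDerivAt h₁ (h₂ x) x) (r : ℝ) :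
    HasDerivAt (fun r => χ₁ ((r - ρ) / l) / l * h (r - ρ) + χ ((r - ρ) / l) * h₁ (r - ρ))
      (χ₂ ((r - ρ) / l) / l ^ 2 * h (r - ρ) + 2 * (χ₁ ((r - ρ) / l) / l * h₁ (r - ρ))
        + χ ((r - ρ) / l) * h₂ (r - ρ)) r := by
  have s1 : HasDerivAt (fun r => r - ρ) 1 r := (hasDerivAt_id r).sub_const ρ
  have s2 : HasDerivAt (fun r => (r - ρ) / l) (1 / l) r := s1.div_const l
  have a1 := (hχ.hasDerivAt ((r - ρ) / l)).comp r s2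
  have a2 := (hh (r - ρ)).comp r s1
  have b1 := ((hχ.hasDerivAt₁ ((r - ρ) / l)).comp r s2).div_const l
  have b2 := (hh₁ (r - ρ)).comp r s1
  refine ((b1.mul a2).add (a1.mul b2)).congr_deriv ?_
  simp only [Function.comp]
  ring

lemma three_lt_abs_div (hl : 0 < l) {x : ℝ} (hx : 3 * l < |x|) : 3 < |x / l| := by
  rw [abs_div, abs_of_pos hl, lt_div_iff₀ hl]; exact hx

lemma abs_div_le_two (hl : 0 < l) {x : ℝ} (hx : |x| ≤ 2 * l) : |x / l| ≤ 2 := by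
  rw [abs_div, abs_of_pos hl, div_le_iff₀ hl]; exact hx

/-- The truncated potential of the linearised operator. -/
noncomputable def truncPotential (m ω ε ρ β : ℝ) (ζ : ℝ → ℝ) (r : ℝ) : ℝ :=
  ω + (1 / ε ^ 2 - 1 / 4) / r ^ 2
    - (m + 1) * (m + 2) * β ^ 2 * (ζ (r - ρ) * (1 - tanh (β * (r - ρ)) ^ 2))

/-- A truncated eigenfunction of the limiting operator is a quasimode. -/
lemma quasimode_error_le (hR : IsRegime m b₀ b₁ ω q₁ ε ρ β l) (hχ : IsCutoff χ χ₁ χ₂ X)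
    (hX : 0 ≤ X) (hζ0 : ∀ x, 0 ≤ ζ x) (hζ1 : ∀ x, ζ x ≤ 1) (hζ : ∀ x, |x| ≤ 2 * l → ζ x = 1)
    (hB : ∀ x, |h x| ≤ B) (hB₁ : ∀ x, |h₁ x| ≤ B)
    (heq : ∀ x, -h₂ x + (m ^ 2 * β ^ 2 - (m + 1) * (m + 2) * β ^ 2 * (1 - tanh (β * x) ^ 2)) * h x
      = μ * h x) {r : ℝ} (hr : |r - ρ| ≤ 3 * l) :
    |-(χ₂ ((r - ρ) / l) / l ^ 2 * h (r - ρ) + 2 * (χ₁ ((r - ρ) / l) / l * h₁ (r - ρ))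
        + χ ((r - ρ) / l) * h₂ (r - ρ))
      + truncPotential m ω ε ρ β ζ r * (χ ((r - ρ) / l) * h (r - ρ))
      - μ * (χ ((r - ρ) / l) * h (r - ρ))|
      ≤ (3 * X + (18 * q₁ ^ 3 + 1) + (m + 1) * (m + 2)) * B / l := by
  have hl := hR.l_pos
  have hl1 := hR.one_le
  have hV := hR.abs_potential_sub_le hr
  have hβ := hR.β_pos
  have hm := hR.m_pos
  have hq := hR.q₁_pos
  have hB0 : 0 ≤ B := (abs_nonneg _).trans (hB 0)
  unfold truncPotential
  have hx := heq (r - ρ)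
  have hσ := one_sub_tanh_sq_nonneg (β * (r - ρ))
  have hσ' := one_sub_tanh_sq_le (β * (r - ρ))
  have hz0 := hζ0 (r - ρ)
  have hz1 := hζ1 (r - ρ)
  have hz2 := hζ (r - ρ)
  have hb := hB (r - ρ)
  have hb₁ := hB₁ (r - ρ)
  have c0 := hχ.nonneg ((r - ρ) / l)
  have c1 := hχ.le_one ((r - ρ) / l)
  have c2 := hχ.bound₁ ((r - ρ) / l)
  have c3 := hχ.bound₂ ((r - ρ) / l)
  generalize χ ((r - ρ) / l) = k at *
  generalize χ₁ ((r - ρ) / l) = k₁ at *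
  generalize χ₂ ((r - ρ) / l) = k₂ at *
  generalize ω + (1 / ε ^ 2 - 1 / 4) / r ^ 2 = V at *
  have hpot : |(m + 1) * (m + 2) * β ^ 2 * ((1 - ζ (r - ρ)) * (1 - tanh (β * (r - ρ)) ^ 2))|
      ≤ (m + 1) * (m + 2) / l := by
    rw [abs_of_nonneg (mul_nonneg (by positivity) (mul_nonneg (by linarith) hσ))]
    rcases le_or_gt |r - ρ| (2 * l) with h | h
    · rw [hz2 h, sub_self, zero_mul, mul_zero]; positivity
    · have e1 : (1 - ζ (r - ρ)) * (1 - tanh (β * (r - ρ)) ^ 2) ≤ 1 / (β ^ 2 * l) := by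
        calc _ ≤ 1 * (1 / (1 + (β * (r - ρ)) ^ 2)) := by
              apply mul_le_mul (by linarith) hσ' hσ (by norm_num)
          _ ≤ 1 / (β ^ 2 * l) := by
              rw [one_mul]
              apply one_div_le_one_div_of_le (by positivity)
              have : l ≤ (r - ρ) ^ 2 := by
                have e2 : (2 * l) ^ 2 ≤ |r - ρ| ^ 2 := by gcongr
                rw [sq_abs] at e2
                have : l * 1 ≤ l * l := by gcongr
                linarith [sq_nonneg l]
              have := mul_le_mul_of_nonneg_left this (sq_nonneg β)
              linarith
      calc _ ≤ (m + 1) * (m + 2) * β ^ 2 * (1 / (β ^ 2 * l)) := by gcongr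
        _ = _ := by field_simp
  have e : -(k₂ / l ^ 2 * h (r - ρ) + 2 * (k₁ / l * h₁ (r - ρ)) + k * h₂ (r - ρ))
      + (V - (m + 1) * (m + 2) * β ^ 2 * (ζ (r - ρ) * (1 - tanh (β * (r - ρ)) ^ 2)))
        * (k * h (r - ρ)) - μ * (k * h (r - ρ))
      = -(k₂ / l ^ 2 * h (r - ρ)) - 2 * (k₁ / l * h₁ (r - ρ))
        + (V - m ^ 2 * β ^ 2) * (k * h (r - ρ))
        + (m + 1) * (m + 2) * β ^ 2 * ((1 - ζ (r - ρ)) * (1 - tanh (β * (r - ρ)) ^ 2))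
          * (k * h (r - ρ)) := by
    linear_combination k * hx
  rw [e]
  have kh : |k * h (r - ρ)| ≤ B := by
    rw [abs_mul, abs_of_nonneg c0]
    exact (mul_le_of_le_one_left (abs_nonneg _) c1).trans hb
  have t1 : |k₂ / l ^ 2 * h (r - ρ)| ≤ X / l * B := by
    rw [abs_mul, abs_div, abs_of_pos (by positivity : 0 < l ^ 2)]
    have : X / l ^ 2 ≤ X / l := by
      have : l * 1 ≤ l * l := by gcongr
      apply div_le_div_of_nonneg_left hX hl; linarith
    have : |k₂| / l ^ 2 ≤ X / l := le_trans (by gcongr) this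
    gcongr
  have t2 : |2 * (k₁ / l * h₁ (r - ρ))| ≤ 2 * (X / l * B) := by
    rw [abs_mul, abs_mul, abs_div, abs_of_pos hl, abs_two]
    gcongr
  have t3 : |(V - m ^ 2 * β ^ 2) * (k * h (r - ρ))| ≤ (18 * q₁ ^ 3 + 1) / l * B := by
    rw [abs_mul]; gcongr
  have t4 : |(m + 1) * (m + 2) * β ^ 2 * ((1 - ζ (r - ρ)) * (1 - tanh (β * (r - ρ)) ^ 2))
          * (k * h (r - ρ))| ≤ (m + 1) * (m + 2) / l * B := by
    rw [abs_mul]; gcongr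
  have e5 : (3 * X + (18 * q₁ ^ 3 + 1) + (m + 1) * (m + 2)) * B / l
      = X / l * B + 2 * (X / l * B) + (18 * q₁ ^ 3 + 1) / l * B + (m + 1) * (m + 2) / l * B := by
    ring
  rw [e5]
  have := abs_le.1 t1
  have := abs_le.1 t2
  have := abs_le.1 t3
  have := abs_le.1 t4
  rw [abs_le]
  constructor <;> linarith

end Modes

section Eigenfunctions
open Set

variable {m b₀ b₁ β : ℝ}

lemma hasDerivAt_groundMode (m β x : ℝ) :
    HasDerivAt (fun x => (1 / cosh (β * x)) ^ (m + 1))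
      (-((m + 1) * β * tanh (β * x) * (1 / cosh (β * x)) ^ (m + 1))) x :=
  hasDerivAt_sech_rpow_mul (m + 1) β x

lemma hasDerivAt_groundMode₁ (m β x : ℝ) :
    HasDerivAt (fun x => -((m + 1) * β * tanh (β * x) * (1 / cosh (β * x)) ^ (m + 1)))
      (β ^ 2 * ((m + 1) ^ 2 * tanh (β * x) ^ 2 - (m + 1) * (1 - tanh (β * x) ^ 2))
        * (1 / cosh (β * x)) ^ (m + 1)) x := by
  have := (((hasDerivAt_tanh_mul β x).const_mul ((m + 1) * β)).mul
    (hasDerivAt_sech_rpow_mul (m + 1) β x)).neg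
  refine this.congr_deriv ?_
  ring

lemma hasDerivAt_kernelMode (m β x : ℝ) :
    HasDerivAt (fun x => (1 / cosh (β * x)) ^ m * tanh (β * x))
      (β * (1 - (m + 1) * tanh (β * x) ^ 2) * (1 / cosh (β * x)) ^ m) x := by
  have := (hasDerivAt_sech_rpow_mul m β x).mul (hasDerivAt_tanh_mul β x)
  refine this.congr_deriv ?_
  ring

lemma hasDerivAt_kernelMode₁ (m β x : ℝ) :
    HasDerivAt (fun x => β * (1 - (m + 1) * tanh (β * x) ^ 2) * (1 / cosh (β * x)) ^ m)
      (β ^ 2 * (-(2 * (m + 1) * tanh (β * x) * (1 - tanh (β * x) ^ 2))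
        - m * tanh (β * x) * (1 - (m + 1) * tanh (β * x) ^ 2)) * (1 / cosh (β * x)) ^ m) x := by
  have := ((((((hasDerivAt_tanh_mul β x).pow 2).const_mul (m + 1)).const_sub 1).const_mul β).mul
    (hasDerivAt_sech_rpow_mul m β x))
  refine this.congr_deriv ?_
  simp only [Pi.pow_apply]
  push_cast
  ring

lemma abs_groundMode_le (hm : 0 < m) (x : ℝ) : |(1 / cosh (β * x)) ^ (m + 1)| ≤ 1 := by
  rw [abs_of_pos (sech_rpow_pos _ _)]; exact sech_rpow_le_one (by linarith) _

lemma abs_groundMode₁_le (hm : 0 < m) (hβ : 0 < β) (hβ₁ : β ≤ b₁) (x : ℝ) :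
    |-((m + 1) * β * tanh (β * x) * (1 / cosh (β * x)) ^ (m + 1))| ≤ (m + 2) * b₁ := by
  rw [abs_neg, abs_mul, abs_mul, abs_of_pos (by positivity : 0 < (m + 1) * β)]
  have h1 := abs_groundMode_le (β := β) hm x
  have h2 := abs_tanh_le_one (β * x)
  calc (m + 1) * β * |tanh (β * x)| * |(1 / cosh (β * x)) ^ (m + 1)|
      ≤ (m + 1) * β * 1 * 1 := by gcongr
    _ = (m + 1) * β := by ring
    _ ≤ (m + 2) * b₁ := by gcongr; linarith

lemma abs_kernelMode_le (hm : 0 < m) (x : ℝ) : |(1 / cosh (β * x)) ^ m * tanh (β * x)| ≤ 1 := by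
  rw [abs_mul, abs_of_pos (sech_rpow_pos _ _)]
  exact mul_le_one₀ (sech_rpow_le_one hm.le _) (abs_nonneg _) (abs_tanh_le_one _)

lemma abs_kernelMode₁_le (hm : 0 < m) (hβ : 0 < β) (hβ₁ : β ≤ b₁) (x : ℝ) :
    |β * (1 - (m + 1) * tanh (β * x) ^ 2) * (1 / cosh (β * x)) ^ m| ≤ (m + 2) * b₁ := by
  rw [abs_mul, abs_mul, abs_of_pos hβ, abs_of_pos (sech_rpow_pos _ _)]
  have h1 := sech_rpow_le_one hm.le (β * x)
  have h2 : |1 - (m + 1) * tanh (β * x) ^ 2| ≤ m + 2 := by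
    have := one_sub_tanh_sq_nonneg (β * x)
    have h3 : (m + 1) * tanh (β * x) ^ 2 ≤ (m + 1) * 1 := by gcongr; linarith
    have h4 : 0 ≤ (m + 1) * tanh (β * x) ^ 2 := by positivity
    rw [abs_le]; constructor <;> linarith
  have h0 := (sech_rpow_pos m (β * x)).le
  calc β * |1 - (m + 1) * tanh (β * x) ^ 2| * (1 / cosh (β * x)) ^ m
      ≤ b₁ * (m + 2) * 1 := by have := hβ.trans_le hβ₁; gcongr
    _ = _ := by ring

lemma groundMode_eq (m β x : ℝ) :
    -(β ^ 2 * ((m + 1) ^ 2 * tanh (β * x) ^ 2 - (m + 1) * (1 - tanh (β * x) ^ 2))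
        * (1 / cosh (β * x)) ^ (m + 1))
      + (m ^ 2 * β ^ 2 - (m + 1) * (m + 2) * β ^ 2 * (1 - tanh (β * x) ^ 2))
        * (1 / cosh (β * x)) ^ (m + 1)
      = -((2 * m + 1) * β ^ 2) * (1 / cosh (β * x)) ^ (m + 1) := by
  ring

lemma kernelMode_eq (m β x : ℝ) :
    -(β ^ 2 * (-(2 * (m + 1) * tanh (β * x) * (1 - tanh (β * x) ^ 2))
        - m * tanh (β * x) * (1 - (m + 1) * tanh (β * x) ^ 2)) * (1 / cosh (β * x)) ^ m)
      + (m ^ 2 * β ^ 2 - (m + 1) * (m + 2) * β ^ 2 * (1 - tanh (β * x) ^ 2))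
        * ((1 / cosh (β * x)) ^ m * tanh (β * x))
      = 0 * ((1 / cosh (β * x)) ^ m * tanh (β * x)) := by
  ring

lemma one_div_cosh_anti {x y : ℝ} (hx : 0 ≤ x) (hxy : x ≤ y) : 1 / cosh y ≤ 1 / cosh x :=
  one_div_le_one_div_of_le (cosh_pos x) (cosh_le_cosh.2 (by
    rw [abs_of_nonneg hx, abs_of_nonneg (hx.trans hxy)]; exact hxy))

lemma sech_rpow_anti {k x y : ℝ} (hk : 0 ≤ k) (hx : 0 ≤ x) (hxy : x ≤ y) :
    (1 / cosh y) ^ k ≤ (1 / cosh x) ^ k := by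
  have := cosh_pos y
  exact rpow_le_rpow (by positivity) (one_div_cosh_anti hx hxy) hk

lemma le_groundMode (hm : 0 < m) (hb₀ : 0 < b₀) (hβ : b₀ ≤ β) (hβ₁ : β ≤ b₁) {x : ℝ}
    (hx : x ∈ Icc (1 : ℝ) 2) :
    (1 / cosh (2 * b₁)) ^ (m + 1) * tanh b₀ ≤ (1 / cosh (β * x)) ^ (m + 1) := by
  have hβ0 : 0 < β := by linarith
  have h1 : β * x ≤ 2 * b₁ := by
    have := mul_le_mul hβ₁ hx.2 (by linarith [hx.1]) (by linarith); linarith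
  have h2 := (le_abs_self _).trans (abs_tanh_le_one b₀)
  exact (mul_le_of_le_one_right (sech_rpow_pos _ _).le h2).trans
    (sech_rpow_anti (by linarith) (mul_nonneg hβ0.le (by linarith [hx.1])) h1)

lemma le_kernelMode (hm : 0 < m) (hb₀ : 0 < b₀) (hβ : b₀ ≤ β) (hβ₁ : β ≤ b₁) {x : ℝ}
    (hx : x ∈ Icc (1 : ℝ) 2) :
    (1 / cosh (2 * b₁)) ^ (m + 1) * tanh b₀ ≤ (1 / cosh (β * x)) ^ m * tanh (β * x) := by
  have hβ0 : 0 < β := by linarith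
  have h1 : β * x ≤ 2 * b₁ := by
    have := mul_le_mul hβ₁ hx.2 (by linarith [hx.1]) (by linarith); linarith
  have h2 : b₀ ≤ β * x := by
    have := mul_le_mul hβ hx.1 (by norm_num) hβ0.le; linarith
  have h3 : (1 / cosh (2 * b₁)) ^ (m + 1) ≤ (1 / cosh (2 * b₁)) ^ m := by
    have := cosh_pos (2 * b₁)
    exact rpow_le_rpow_of_exponent_ge (by positivity)
      (by rw [div_le_one this]; exact one_le_cosh _) (by linarith)
  exact mul_le_mul (h3.trans (sech_rpow_anti hm.le (mul_nonneg hβ0.le (by linarith [hx.1])) h1))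
    (tanh_le_tanh_of_le h2) (tanh_pos_of_pos hb₀).le (sech_rpow_pos _ _).le

lemma sq_le_integral_sq {h : ℝ → ℝ} {v ρ : ℝ} (hρ : 0 < ρ) (hv : 0 ≤ v)
    (hh : MemLp h 2 (volume.restrict (Ioi 0)))
    (hle : ∀ r, r - ρ ∈ Icc (1 : ℝ) 2 → v ≤ h r) : v ^ 2 ≤ ∫ r in Ioi (0 : ℝ), h r ^ 2 := by
  have hi : IntegrableOn (fun r => h r ^ 2) (Ioi 0) := hh.integrable_sq
  have hsub : Icc (ρ + 1) (ρ + 2) ⊆ Ioi 0 := fun r hr => by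
    have := hr.1
    exact mem_Ioi.2 (by linarith)
  calc v ^ 2 = ∫ _ in Icc (ρ + 1) (ρ + 2), v ^ 2 := by
        rw [setIntegral_const, Real.volume_real_Icc, max_eq_left (by linarith), smul_eq_mul]; ring
    _ ≤ ∫ r in Icc (ρ + 1) (ρ + 2), h r ^ 2 := by
        refine setIntegral_mono_on (integrableOn_const
          (by rw [Real.volume_Icc]; exact ENNReal.ofReal_ne_top) (by simp))
          (hi.mono_set hsub) measurableSet_Icc fun r hr => ?_
        have := hle r ⟨by linarith [hr.1], by linarith [hr.2]⟩
        gcongr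
    _ ≤ _ := setIntegral_mono_set hi (ae_of_all _ fun r => sq_nonneg _) hsub.eventuallyLE

end Eigenfunctions

section SquareIntegrable
open scoped InnerProductSpace

variable {α : Type*} [MeasurableSpace α] {μ : Measure α}

lemma inner_toLp_eq_integral {f g : α → ℝ} (hf : MemLp f 2 μ) (hg : MemLp g 2 μ) :
    ⟪hf.toLp f, hg.toLp g⟫_ℝ = ∫ a, f a * g a ∂μ := by
  rw [L2.inner_def]
  refine integral_congr_ae ?_
  filter_upwards [hf.coeFn_toLp, hg.coeFn_toLp] with a h1 h2
  rw [h1, h2]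
  simp [mul_comm]

lemma norm_toLp_sq_eq_integral {f : α → ℝ} (hf : MemLp f 2 μ) :
    ‖hf.toLp f‖ ^ 2 = ∫ a, f a ^ 2 ∂μ := by
  rw [← real_inner_self_eq_norm_sq, inner_toLp_eq_integral]
  simp only [sq]

lemma integral_const_mul_add_mul {f g h : α → ℝ} {c : ℝ} (hf : MemLp f 2 μ) (hg : MemLp g 2 μ)
    (hh : MemLp h 2 μ) :
    ∫ a, (c * f a + g a) * h a ∂μ = c * ∫ a, f a * h a ∂μ + ∫ a, g a * h a ∂μ := by
  have i1 : Integrable (fun a => f a * h a) μ := hf.integrable_mul hh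
  have i2 : Integrable (fun a => g a * h a) μ := hg.integrable_mul hh
  rw [← integral_const_mul, ← integral_add (i1.const_mul c) i2]
  congr 1
  funext a
  ring

lemma exists_integral_bound_of_quasimodes (μ : Measure α) {δ n₀ : ℝ} (hδ : 0 < δ) (hn₀ : 0 < n₀) :
    ∃ η > (0 : ℝ), ∃ C > (0 : ℝ), ∀ (u φ ψ d f g e₁ e₂ : α → ℝ) (A B k lam : ℝ),
      MemLp u 2 μ → MemLp φ 2 μ → MemLp ψ 2 μ → MemLp d 2 μ → MemLp f 2 μ → MemLp g 2 μ →
      MemLp e₁ 2 μ → MemLp e₂ 2 μ → δ ≤ lam →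
      n₀ ^ 2 ≤ ∫ a, φ a ^ 2 ∂μ → n₀ ^ 2 ≤ ∫ a, ψ a ^ 2 ∂μ → ∫ a, d a ^ 2 ∂μ ≤ η ^ 2 →
      ∫ a, e₁ a ^ 2 ∂μ ≤ η ^ 2 → ∫ a, e₂ a ^ 2 ∂μ ≤ η ^ 2 →
      (∀ᵐ a ∂μ, f a = -(g a + k * (ψ a + d a))) →
      ∫ a, f a * φ a ∂μ = -lam * ∫ a, u a * φ a ∂μ + ∫ a, u a * e₁ a ∂μ →
      ∫ a, f a * ψ a ∂μ = ∫ a, u a * e₂ a ∂μ →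
      lam * ∫ a, φ a * ψ a ∂μ = ∫ a, e₁ a * ψ a ∂μ - ∫ a, φ a * e₂ a ∂μ →
      δ * ∫ a, (u a - A * φ a - B * ψ a) ^ 2 ∂μ
        ≤ ∫ a, (f a + lam * A * φ a - A * e₁ a - B * e₂ a) * (u a - A * φ a - B * ψ a) ∂μ →
      ∫ a, u a * (ψ a + d a) ∂μ = 0 →
      ∫ a, u a ^ 2 ∂μ ≤ C ^ 2 * ∫ a, g a ^ 2 ∂μ ∧ ∫ a, f a ^ 2 ∂μ ≤ C ^ 2 * ∫ a, g a ^ 2 ∂μ := by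
  obtain ⟨η, hη, C, hC, key⟩ := exists_norm_bound_of_quasimodes (H := Lp ℝ 2 μ) δ n₀ hδ hn₀
  refine ⟨η, hη, C, hC, ?_⟩
  intro u φ ψ d f g e₁ e₂ A B k lam hu hφ hψ hd hf hg he₁ he₂ hlam nφ nψ nd ne₁ ne₂ hfg h1 h2 h12
    hz horth
  have hz' := (hu.sub (hφ.const_smul A)).sub (hψ.const_smul B)
  have hT := ((hf.add (hφ.const_smul (lam * A))).sub (he₁.const_smul A)).sub (he₂.const_smul B)
  have := key (hu.toLp u) (hφ.toLp φ) (hψ.toLp ψ) (hd.toLp d) (hf.toLp f) (hg.toLp g)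
    (he₁.toLp e₁) (he₂.toLp e₂) A B k lam hlam
    (le_of_sq_le_sq (by rw [norm_toLp_sq_eq_integral]; exact nφ) (norm_nonneg _))
    (le_of_sq_le_sq (by rw [norm_toLp_sq_eq_integral]; exact nψ) (norm_nonneg _))
    (le_of_sq_le_sq (by rw [norm_toLp_sq_eq_integral]; exact nd) hη.le)
    (le_of_sq_le_sq (by rw [norm_toLp_sq_eq_integral]; exact ne₁) hη.le)
    (le_of_sq_le_sq (by rw [norm_toLp_sq_eq_integral]; exact ne₂) hη.le)
    (by
      rw [← MemLp.toLp_add hψ hd, ← MemLp.toLp_const_smul k, ← MemLp.toLp_add, ← MemLp.toLp_neg,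
        MemLp.toLp_eq_toLp_iff]
      exact hfg)
    (by simpa only [inner_toLp_eq_integral] using h1)
    (by simpa only [inner_toLp_eq_integral] using h2)
    (by simpa only [inner_toLp_eq_integral] using h12)
    (by
      have e1 : hu.toLp u - A • hφ.toLp φ - B • hψ.toLp ψ = hz'.toLp _ := by
        rw [← MemLp.toLp_const_smul A, ← MemLp.toLp_const_smul B, ← MemLp.toLp_sub,
          ← MemLp.toLp_sub]
      have e2 : hf.toLp f + (lam * A) • hφ.toLp φ - A • he₁.toLp e₁ - B • he₂.toLp e₂
          = hT.toLp _ := by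
        rw [← MemLp.toLp_const_smul A, ← MemLp.toLp_const_smul B, ← MemLp.toLp_const_smul (lam * A),
          ← MemLp.toLp_add, ← MemLp.toLp_sub, ← MemLp.toLp_sub]
      rw [e1, e2, norm_toLp_sq_eq_integral, inner_toLp_eq_integral]
      exact hz)
    (by
      rw [← MemLp.toLp_add hψ hd, inner_toLp_eq_integral]
      exact horth)
  simp only [← norm_toLp_sq_eq_integral hu, ← norm_toLp_sq_eq_integral hf,
    ← norm_toLp_sq_eq_integral hg, ← mul_pow]
  exact ⟨pow_le_pow_left₀ (norm_nonneg _) this.1 2, pow_le_pow_left₀ (norm_nonneg _) this.2 2⟩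

end SquareIntegrable

section Quasimodes
open Set

variable {m b₀ b₁ ω q₁ ε ρ β l X B μ E a b : ℝ} {χ χ₁ χ₂ h h₁ h₂ ζ U φ φ₁ φ₂ e : ℝ → ℝ}

/-- A compactly supported approximate eigenfunction of `-∂² + U` on the half line, with
eigenvalue `μ` and error `e`. -/
structure IsQuasimode (U : ℝ → ℝ) (μ E a b : ℝ) (φ φ₁ φ₂ e : ℝ → ℝ) : Prop where
  hasDerivAt : ∀ r > 0, HasDerivAt φ (φ₁ r) r
  hasDerivAt₁ : ∀ r > 0, HasDerivAt φ₁ (φ₂ r) r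
  eq : ∀ r, -φ₂ r + U r * φ r = μ * φ r + e r
  eq_zero : ∀ r, r < a ∨ b < r → φ r = 0 ∧ φ₁ r = 0
  memLp : MemLp φ 2 (volume.restrict (Ioi 0))
  memLp_div : MemLp (fun r => φ r / r ^ 2) 2 (volume.restrict (Ioi 0))
  memLp_error : MemLp e 2 (volume.restrict (Ioi 0))
  integral_error_le : ∫ r in Ioi (0 : ℝ), e r ^ 2 ≤ E

lemma IsQuasimode.integral_mul (hφ : IsQuasimode U μ E a b φ φ₁ φ₂ e) (ha : 0 < a)
    {u u₁ u₂ f : ℝ → ℝ} (hu : ∀ r > 0, HasDerivAt u (u₁ r) r)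
    (hu₁ : ∀ r > 0, HasDerivAt u₁ (u₂ r) r) (hf : ∀ r > 0, f r = -u₂ r + U r * u r)
    (hu2 : MemLp u 2 (volume.restrict (Ioi 0))) (hf2 : MemLp f 2 (volume.restrict (Ioi 0))) :
    ∫ r in Ioi (0 : ℝ), f r * φ r
      = μ * (∫ r in Ioi (0 : ℝ), u r * φ r) + ∫ r in Ioi (0 : ℝ), u r * e r := by
  have i1 : IntegrableOn (fun r => f r * φ r) (Ioi 0) := hf2.integrable_mul hφ.memLp
  have i2 : IntegrableOn (fun r => u r * φ r) (Ioi 0) := hu2.integrable_mul hφ.memLp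
  have i3 : IntegrableOn (fun r => u r * e r) (Ioi 0) := hu2.integrable_mul hφ.memLp_error
  have e2 : (fun r => u r * (-φ₂ r + U r * φ r)) = fun r => μ * (u r * φ r) + u r * e r := by
    funext r; rw [hφ.eq r]; ring
  have c1 : EqOn (fun r => f r * φ r) (fun r => (-u₂ r + U r * u r) * φ r) (Ioi 0) := fun r hr => by
    simp only [hf r hr]
  have i4 : IntegrableOn (fun r => u r * (-φ₂ r + U r * φ r)) (Ioi 0) := by
    rw [e2]; exact (i2.const_mul μ).add i3
  have key := integral_schrodinger_symm ha hu hu₁ hφ.hasDerivAt hφ.hasDerivAt₁ hφ.eq_zero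
    (i1.congr_fun c1 measurableSet_Ioi) i4
  rw [setIntegral_congr_fun measurableSet_Ioi c1, key, e2, integral_add (i2.const_mul μ) i3,
    integral_const_mul]

lemma isQuasimode_cutoff_mul (hR : IsRegime m b₀ b₁ ω q₁ ε ρ β l) (hχ : IsCutoff χ χ₁ χ₂ X)
    (hX : 0 ≤ X) (hζm : Measurable ζ) (hζ0 : ∀ x, 0 ≤ ζ x) (hζ1 : ∀ x, ζ x ≤ 1)
    (hζ : ∀ x, |x| ≤ 2 * l → ζ x = 1)
    (hB : ∀ x, |h x| ≤ B) (hB₁ : ∀ x, |h₁ x| ≤ B) (hh : ∀ x, HasDerivAt h (h₁ x) x)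
    (hh₁ : ∀ x, HasDerivAt h₁ (h₂ x) x)
    (heq : ∀ x, -h₂ x + (m ^ 2 * β ^ 2 - (m + 1) * (m + 2) * β ^ 2 * (1 - tanh (β * x) ^ 2)) * h x
      = μ * h x) :
    IsQuasimode (truncPotential m ω ε ρ β ζ) μ
      (6 * ((3 * X + (18 * q₁ ^ 3 + 1) + (m + 1) * (m + 2)) * B) ^ 2 / l) (ρ - 3 * l) (ρ + 3 * l)
      (fun r => χ ((r - ρ) / l) * h (r - ρ))
      (fun r => χ₁ ((r - ρ) / l) / l * h (r - ρ) + χ ((r - ρ) / l) * h₁ (r - ρ))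
      (fun r => χ₂ ((r - ρ) / l) / l ^ 2 * h (r - ρ) + 2 * (χ₁ ((r - ρ) / l) / l * h₁ (r - ρ))
        + χ ((r - ρ) / l) * h₂ (r - ρ))
      (fun r => -(χ₂ ((r - ρ) / l) / l ^ 2 * h (r - ρ) + 2 * (χ₁ ((r - ρ) / l) / l * h₁ (r - ρ))
        + χ ((r - ρ) / l) * h₂ (r - ρ))
      + truncPotential m ω ε ρ β ζ r * (χ ((r - ρ) / l) * h (r - ρ))
      - μ * (χ ((r - ρ) / l) * h (r - ρ))) := by
  have hl := hR.l_pos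
  have h6 := hR.six_l_le
  have hB0 : 0 ≤ B := (abs_nonneg _).trans (hB 0)
  have hzero : ∀ r, 3 * l < |r - ρ| → χ ((r - ρ) / l) = 0 ∧ χ₁ ((r - ρ) / l) = 0 ∧
      χ₂ ((r - ρ) / l) = 0 := fun r hr => hχ.eq_zero _ (three_lt_abs_div hl hr)
  have mχ : Measurable χ := (continuous_iff_continuousAt.2 fun s =>
    (hχ.hasDerivAt s).continuousAt).measurable
  have mχ₁ : Measurable χ₁ := (continuous_iff_continuousAt.2 fun s =>
    (hχ.hasDerivAt₁ s).continuousAt).measurable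
  have mχ₂ : Measurable χ₂ := hχ.continuous₂.measurable
  have mh : Measurable h := (continuous_iff_continuousAt.2 fun s =>
    (hh s).continuousAt).measurable
  have mh₁ : Measurable h₁ := (continuous_iff_continuousAt.2 fun s =>
    (hh₁ s).continuousAt).measurable
  have mh₂ : Measurable h₂ := by
    have : h₂ = deriv h₁ := by funext x; exact (hh₁ x).deriv.symm
    rw [this]; exact measurable_deriv _
  have mt : Measurable fun x => tanh (β * x) := (continuous_iff_continuousAt.2 fun s =>
    (hasDerivAt_tanh_mul β s).continuousAt).measurable
  have mU : Measurable (truncPotential m ω ε ρ β ζ) := by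
    have mt' : Measurable fun r => tanh (β * (r - ρ)) := mt.comp (measurable_id.sub_const ρ)
    unfold truncPotential
    fun_prop
  have hφb : ∀ r, |χ ((r - ρ) / l) * h (r - ρ)| ≤ B * l / l := fun r => by
    rw [mul_div_assoc, div_self hl.ne', mul_one, abs_mul, abs_of_nonneg (hχ.nonneg _)]
    exact (mul_le_of_le_one_left (abs_nonneg _) (hχ.le_one _)).trans (hB _)
  have he := memLp_two_of_bump (ρ := ρ) (l := l)
    (C := (3 * X + (18 * q₁ ^ 3 + 1) + (m + 1) * (m + 2)) * B)
    (h := fun r => -(χ₂ ((r - ρ) / l) / l ^ 2 * h (r - ρ) + 2 * (χ₁ ((r - ρ) / l) / l * h₁ (r - ρ))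
        + χ ((r - ρ) / l) * h₂ (r - ρ))
      + truncPotential m ω ε ρ β ζ r * (χ ((r - ρ) / l) * h (r - ρ))
      - μ * (χ ((r - ρ) / l) * h (r - ρ))) (by fun_prop) hl
    (fun r hr => by
      obtain ⟨z0, z1, z2⟩ := hzero r hr
      simp [z0, z1, z2])
    (fun r hr => quasimode_error_le hR hχ hX hζ0 hζ1 hζ hB hB₁ heq hr)
  refine ⟨fun r _ => hasDerivAt_cutoff_mul hχ hh r, fun r _ => hasDerivAt_cutoff_mul₁ hχ hh hh₁ r,
    fun r => by ring, ?_, ?_, ?_, he.1, he.2⟩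
  · intro r hr
    have : 3 * l < |r - ρ| := by
      rcases hr with hr | hr
      · exact lt_abs.2 (Or.inr (by linarith))
      · exact lt_abs.2 (Or.inl (by linarith))
    obtain ⟨z0, z1, z2⟩ := hzero r this
    simp [z0, z1]
  · exact (memLp_two_of_bump (ρ := ρ) (l := l) (C := B * l) (by fun_prop) hl
      (fun r hr => by simp [(hzero r hr).1]) (fun r _ => hφb r)).1
  · refine (memLp_two_of_bump (ρ := ρ) (l := l) (C := B * l) (by fun_prop) hl
      (fun r hr => by simp [(hzero r hr).1]) (fun r hr => ?_)).1
    have h1 : 1 ≤ r := by have := abs_le.1 hr; linarith [hR.one_le]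
    rw [abs_div, abs_of_pos (by positivity : 0 < r ^ 2)]
    exact (div_le_self (abs_nonneg _) (one_le_pow₀ h1)).trans (hφb r)

end Quasimodes

section Reduced
open Set

variable {m b₀ b₁ ω q₁ X : ℝ} {χ χ₁ χ₂ : ℝ → ℝ}

/-- Subtracting quasimodes so as to vanish at two points, a function satisfies a coercive
estimate. -/
lemma IsQuasimode.exists_coercive_remainder {U φ φ₁ φ₂ e₁ ψ ψ₁ ψ₂ e₂ u u₁ u₂ f : ℝ → ℝ}
    {lam E a b δ ra rb s t : ℝ} (hφ : IsQuasimode U (-lam) E a b φ φ₁ φ₂ e₁)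
    (hψ : IsQuasimode U 0 E a b ψ ψ₁ ψ₂ e₂)
    (hs : s ≠ 0) (ht : t ≠ 0) (φa : φ ra = s) (φb : φ rb = s) (ψa : ψ ra = -t) (ψb : ψ rb = t)
    (coer : ∀ z z₁ z₂ : ℝ → ℝ,
      (∀ r > 0, HasDerivAt z (z₁ r) r) → (∀ r > 0, HasDerivAt z₁ (z₂ r) r) →
      z ra = 0 → z rb = 0 →
      IntegrableOn (fun r => z r ^ 2) (Ioi 0) →
      IntegrableOn (fun r => z r ^ 2 / r ^ 4) (Ioi 0) →
      IntegrableOn (fun r => (-z₂ r + U r * z r) * z r) (Ioi 0) →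
      δ * ∫ r in Ioi (0 : ℝ), z r ^ 2 ≤ ∫ r in Ioi (0 : ℝ), (-z₂ r + U r * z r) * z r)
    (hu : ∀ r > 0, HasDerivAt u (u₁ r) r) (hu₁ : ∀ r > 0, HasDerivAt u₁ (u₂ r) r)
    (hf : ∀ r > 0, f r = -u₂ r + U r * u r) (hu2 : MemLp u 2 (volume.restrict (Ioi 0)))
    (hu4 : MemLp (fun r => u r / r ^ 2) 2 (volume.restrict (Ioi 0)))
    (hf2 : MemLp f 2 (volume.restrict (Ioi 0))) :
    ∃ A B : ℝ, δ * ∫ r in Ioi (0 : ℝ), (u r - A * φ r - B * ψ r) ^ 2 ≤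
      ∫ r in Ioi (0 : ℝ), (f r + lam * A * φ r - A * e₁ r - B * e₂ r)
        * (u r - A * φ r - B * ψ r) := by
  set A : ℝ := (u rb + u ra) / (2 * s) with hA
  set B : ℝ := (u rb - u ra) / (2 * t) with hB
  refine ⟨A, B, ?_⟩
  have hz2 : MemLp (fun r => u r - A * φ r - B * ψ r) 2 (volume.restrict (Ioi 0)) :=
    (hu2.sub (hφ.memLp.const_mul A)).sub (hψ.memLp.const_mul B)
  have hz4 : MemLp (fun r => u r / r ^ 2 - A * (φ r / r ^ 2) - B * (ψ r / r ^ 2)) 2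
      (volume.restrict (Ioi 0)) :=
    (hu4.sub (hφ.memLp_div.const_mul A)).sub (hψ.memLp_div.const_mul B)
  have hT2 : MemLp (fun r => f r + lam * A * φ r - A * e₁ r - B * e₂ r) 2
      (volume.restrict (Ioi 0)) :=
    ((hf2.add (hφ.memLp.const_mul (lam * A))).sub (hφ.memLp_error.const_mul A)).sub
      (hψ.memLp_error.const_mul B)
  have c : EqOn (fun r => (f r + lam * A * φ r - A * e₁ r - B * e₂ r)
      * (u r - A * φ r - B * ψ r)) (fun r => (-(u₂ r - A * φ₂ r - B * ψ₂ r)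
      + U r * (u r - A * φ r - B * ψ r)) * (u r - A * φ r - B * ψ r)) (Ioi 0) := fun r hr => by
    have e1 := hφ.eq r
    have e2 := hψ.eq r
    have e3 := hf r hr
    simp only
    congr 1
    linear_combination e3 + A * e1 + B * e2
  have hi : IntegrableOn (fun r => (f r + lam * A * φ r - A * e₁ r - B * e₂ r)
      * (u r - A * φ r - B * ψ r)) (Ioi 0) := hT2.integrable_mul hz2
  rw [setIntegral_congr_fun measurableSet_Ioi c]
  refine coer (fun r => u r - A * φ r - B * ψ r) (fun r => u₁ r - A * φ₁ r - B * ψ₁ r)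
    (fun r => u₂ r - A * φ₂ r - B * ψ₂ r)
    (fun r hr => ((hu r hr).sub ((hφ.hasDerivAt r hr).const_mul A)).sub
      ((hψ.hasDerivAt r hr).const_mul B))
    (fun r hr => ((hu₁ r hr).sub ((hφ.hasDerivAt₁ r hr).const_mul A)).sub
      ((hψ.hasDerivAt₁ r hr).const_mul B)) ?_ ?_ hz2.integrable_sq ?_
    (hi.congr_fun c measurableSet_Ioi)
  · simp only [φa, ψa, hA, hB]; field_simp; ring
  · simp only [φb, ψb, hA, hB]; field_simp; ring
  · refine hz4.integrable_sq.congr (ae_of_all _ fun r => ?_)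
    simp only
    rw [← mul_div_assoc, ← mul_div_assoc, ← sub_div, ← sub_div, div_pow, ← pow_mul]

/-- Uniform a priori bound for the one-dimensional operator on the half line. -/
lemma exists_half_line_bound {K₀ : ℝ} (hm : 0 < m) (hb₀ : 0 < b₀) (hb₁ : b₀ ≤ b₁) (hω : 0 < ω)
    (hq₁ : 0 < q₁) (hX : 0 ≤ X) (hχ : IsCutoff χ χ₁ χ₂ X) :
    ∃ L₀ > 0, ∃ C > 0, ∀ ε ρ β l : ℝ, IsRegime m b₀ b₁ ω q₁ ε ρ β l → L₀ ≤ l →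
    ∀ ζ : ℝ → ℝ, Measurable ζ → (∀ x, 0 ≤ ζ x) → (∀ x, ζ x ≤ 1) →
    (∀ x, |x| ≤ 2 * l → ζ x = 1) →
    ∀ (u u₁ u₂ f d g : ℝ → ℝ) (k : ℝ),
    (∀ r > 0, HasDerivAt u (u₁ r) r) → (∀ r > 0, HasDerivAt u₁ (u₂ r) r) →
    (∀ r > 0, f r = -u₂ r + truncPotential m ω ε ρ β ζ r * u r) →
    MemLp u 2 (volume.restrict (Ioi 0)) →
    MemLp (fun r => u r / r ^ 2) 2 (volume.restrict (Ioi 0)) →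
    MemLp f 2 (volume.restrict (Ioi 0)) → MemLp g 2 (volume.restrict (Ioi 0)) →
    Measurable d → (∀ r, 3 * l < |r - ρ| → d r = 0) →
    (∀ r, |r - ρ| ≤ 3 * l → |d r| ≤ K₀ / l) →
    (∀ r > 0, f r = -(g r + k * (χ ((r - ρ) / l) *
      ((1 / cosh (β * (r - ρ))) ^ m * tanh (β * (r - ρ))) + d r))) →
    ∫ r in Ioi (0 : ℝ), u r * (χ ((r - ρ) / l) *
      ((1 / cosh (β * (r - ρ))) ^ m * tanh (β * (r - ρ))) + d r) = 0 →
    ∫ r in Ioi (0 : ℝ), u r ^ 2 ≤ C ^ 2 * ∫ r in Ioi (0 : ℝ), g r ^ 2 ∧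
      ∫ r in Ioi (0 : ℝ), f r ^ 2 ≤ C ^ 2 * ∫ r in Ioi (0 : ℝ), g r ^ 2 := by
  have hb₁0 : 0 < b₁ := hb₀.trans_le hb₁
  obtain ⟨δ, hδ, a, ha, L₁, hL₁, hδb, coer⟩ := exists_coercivity (K := 18 * q₁ ^ 3 + 1) hm hb₀ hb₁
    hω (by positivity)
  set n₀ : ℝ := (1 / cosh (2 * b₁)) ^ (m + 1) * tanh b₀ with hn₀
  have hn₀0 : 0 < n₀ := mul_pos (sech_rpow_pos _ _) (tanh_pos_of_pos hb₀)
  obtain ⟨η, hη, C, hC, core⟩ := exists_integral_bound_of_quasimodes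
    (volume.restrict (Ioi (0 : ℝ))) hδ hn₀0
  set B : ℝ := 1 + (m + 2) * b₁ with hB
  set E : ℝ := (3 * X + (18 * q₁ ^ 3 + 1) + (m + 1) * (m + 2)) * B with hE
  refine ⟨L₁ + a + 6 * E ^ 2 / η ^ 2 + 6 * K₀ ^ 2 / η ^ 2, by positivity, C, hC, ?_⟩
  intro ε ρ β l hR hl ζ hζm hζ0 hζ1 hζ u u₁ u₂ f d g k hu hu₁ hf hu2 hu4 hf2 hg2 hdm hd0 hd1 hfg
    horth
  have hl0 := hR.l_pos
  have hl1 := hR.one_le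
  have h6 := hR.six_l_le
  have hβ := hR.β_pos
  have p1 : 0 ≤ 6 * E ^ 2 / η ^ 2 := by positivity
  have p2 : 0 ≤ 6 * K₀ ^ 2 / η ^ 2 := by positivity
  have hEl : 6 * E ^ 2 / l ≤ η ^ 2 := by
    have : 6 * E ^ 2 / η ^ 2 ≤ l := by linarith
    rw [div_le_iff₀ (by positivity)] at this
    rw [div_le_iff₀ hl0]; linarith
  have hKl : 6 * K₀ ^ 2 / l ≤ η ^ 2 := by
    have : 6 * K₀ ^ 2 / η ^ 2 ≤ l := by linarith
    rw [div_le_iff₀ (by positivity)] at this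
    rw [div_le_iff₀ hl0]; linarith
  have hmb : 0 < (m + 2) * b₁ := by positivity
  have hφ := isQuasimode_cutoff_mul (B := B) hR hχ hX hζm hζ0 hζ1 hζ
    (fun x => (abs_groundMode_le hm x).trans (by linarith))
    (fun x => (abs_groundMode₁_le hm hβ hR.le_b₁ x).trans (by linarith))
    (hasDerivAt_groundMode m β) (hasDerivAt_groundMode₁ m β) (groundMode_eq m β)
  have hψ := isQuasimode_cutoff_mul (B := B) hR hχ hX hζm hζ0 hζ1 hζ
    (fun x => (abs_kernelMode_le hm x).trans (by linarith))
    (fun x => (abs_kernelMode₁_le hm hβ hR.le_b₁ x).trans (by linarith))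
    (hasDerivAt_kernelMode m β) (hasDerivAt_kernelMode₁ m β) (kernelMode_eq m β)
  rw [← hE] at hφ hψ
  have φa : ∀ r, |r - ρ| ≤ 2 * l → χ ((r - ρ) / l) * (1 / cosh (β * (r - ρ))) ^ (m + 1)
      = (1 / cosh (β * (r - ρ))) ^ (m + 1) := fun r hr => by
    rw [hχ.eq_one _ (abs_div_le_two hl0 hr), one_mul]
  have ψa : ∀ r, |r - ρ| ≤ 2 * l →
      χ ((r - ρ) / l) * ((1 / cosh (β * (r - ρ))) ^ m * tanh (β * (r - ρ)))
      = (1 / cosh (β * (r - ρ))) ^ m * tanh (β * (r - ρ)) := fun r hr => by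
    rw [hχ.eq_one _ (abs_div_le_two hl0 hr), one_mul]
  have near : ∀ r, r - ρ ∈ Icc (1 : ℝ) 2 → |r - ρ| ≤ 2 * l := fun r hr => by
    rw [abs_of_nonneg (by linarith [hr.1])]; linarith [hr.2]
  have nφ := sq_le_integral_sq hR.ρ_pos hn₀0.le hφ.memLp fun r hr => by
    rw [φa r (near r hr)]; exact le_groundMode hm hb₀ hR.b₀_le hR.le_b₁ hr
  have nψ := sq_le_integral_sq hR.ρ_pos hn₀0.le hψ.memLp fun r hr => by
    rw [ψa r (near r hr)]; exact le_kernelMode hm hb₀ hR.b₀_le hR.le_b₁ hr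
  have well : ∀ r, ω + (1 / ε ^ 2 - 1 / 4) / r ^ 2
      - (m + 1) * (m + 2) * β ^ 2 * (1 - tanh (β * (r - ρ)) ^ 2)
      ≤ truncPotential m ω ε ρ β ζ r := fun r => by
    have := mul_le_of_le_one_left (one_sub_tanh_sq_nonneg (β * (r - ρ))) (hζ1 (r - ρ))
    exact sub_le_sub_left (mul_le_mul_of_nonneg_left this (by positivity)) _
  have hd := memLp_two_of_bump hdm hl0 hd0 hd1
  have hal : a ≤ l := by linarith
  have habs : |a| ≤ 2 * l := by rw [abs_of_pos ha]; linarith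
  have habs' : |-a| ≤ 2 * l := by rw [abs_neg]; exact habs
  obtain ⟨A₁, A₂, hz⟩ := hφ.exists_coercive_remainder hψ (lam := (2 * m + 1) * β ^ 2)
    (ra := ρ - a) (rb := ρ + a) (s := (1 / cosh (β * a)) ^ (m + 1))
    (t := (1 / cosh (β * a)) ^ m * tanh (β * a)) (sech_rpow_pos (m + 1) (β * a)).ne'
    (mul_pos (sech_rpow_pos m (β * a)) (tanh_pos_of_pos (by positivity))).ne'
    (by
      simp only [sub_sub_cancel_left, mul_neg, cosh_neg]
      rw [hχ.eq_one _ (abs_div_le_two hl0 habs'), one_mul])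
    (by
      simp only [add_sub_cancel_left]
      rw [hχ.eq_one _ (abs_div_le_two hl0 habs), one_mul])
    (by
      simp only [sub_sub_cancel_left, mul_neg, cosh_neg, tanh_neg]
      rw [hχ.eq_one _ (abs_div_le_two hl0 habs'), one_mul])
    (by
      simp only [add_sub_cancel_left]
      rw [hχ.eq_one _ (abs_div_le_two hl0 habs), one_mul])
    (coer l (by linarith) β ⟨hR.b₀_le, hR.le_b₁⟩ ρ (by linarith)
      (truncPotential m ω ε ρ β ζ)
      (fun r hr => (sub_le_sub_right (hR.le_potential_left hr) _).trans (well r))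
      (fun r hr => (sub_le_sub_right (hR.le_potential_right hr) _).trans (well r))
      (fun r hr => (sub_le_sub_right (hR.omega_le_potential (hR.ρ_pos.trans_le hr)) _).trans
        (well r)))
    hu hu₁ hf hu2 hu4 hf2
  have hpos : 0 < ρ - 3 * l := by linarith
  have i1 := hφ.integral_mul hpos hu hu₁ hf hu2 hf2
  have i2 := hψ.integral_mul hpos hu hu₁ hf hu2 hf2
  have i3 := hψ.integral_mul hpos hφ.hasDerivAt hφ.hasDerivAt₁ (fun r _ => (hφ.eq r).symm) hφ.memLp
    ((hφ.memLp.const_mul _).add hφ.memLp_error)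
  have hlam : δ ≤ (2 * m + 1) * β ^ 2 := by
    have h1 : b₀ ^ 2 ≤ β ^ 2 := by have := hR.b₀_le; gcongr
    have h2 : 0 ≤ 2 * m * β ^ 2 := by positivity
    linarith
  refine core u _ _ d f g _ _ A₁ A₂ k _ hu2 hφ.memLp hψ.memLp hd.1 hf2 hg2 hφ.memLp_error
    hψ.memLp_error hlam nφ nψ (hd.2.trans hKl) (hφ.integral_error_le.trans hEl)
    (hψ.integral_error_le.trans hEl) ((ae_restrict_iff' measurableSet_Ioi).2 (ae_of_all _ hfg))
    i1 (by rw [i2, zero_mul, zero_add]) ?_ hz horth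
  rw [zero_mul, zero_add, integral_const_mul_add_mul hφ.memLp hφ.memLp_error hψ.memLp] at i3
  linarith

end Reduced

section Elliptic
open Set

/-- Control of the full second-order norm by the zeroth-order norm and the operator. -/
lemma integral_sq_add_le {u u₁ u₂ f W : ℝ → ℝ} {ω κ D N₁ N₂ : ℝ} (hω : 0 ≤ ω) (hκ : 7 ≤ κ)
    (hu : ∀ r > 0, HasDerivAt u (u₁ r) r) (hu₁ : ∀ r > 0, HasDerivAt u₁ (u₂ r) r)
    (hf : ∀ r > 0, f r = -u₂ r + (ω + κ / r ^ 2 - W r) * u r)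
    (hW : Measurable W) (hW0 : ∀ r, 0 ≤ W r) (hWD : ∀ r, W r ≤ D)
    (hu2 : MemLp u 2 (volume.restrict (Ioi 0)))
    (hu4 : MemLp (fun r => u r / r ^ 2) 2 (volume.restrict (Ioi 0)))
    (hf2 : MemLp f 2 (volume.restrict (Ioi 0)))
    (hN₁ : ∫ r in Ioi (0 : ℝ), u r ^ 2 ≤ N₁) (hN₂ : ∫ r in Ioi (0 : ℝ), f r ^ 2 ≤ N₂) :
    ∫ r in Ioi (0 : ℝ), ((u r - u₂ r - u r / r ^ 2 / 4) ^ 2 + (u r / r ^ 2) ^ 2)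
      ≤ (3 * (1 - ω) ^ 2 + 32 * D ^ 2) * N₁ + 32 * N₂ := by
  have hWu : MemLp (fun r => W r * u r) 2 (volume.restrict (Ioi 0)) := by
    refine MemLp.of_le_mul (c := D) hu2 (hW.aestronglyMeasurable.mul hu2.1)
      (ae_of_all _ fun r => ?_)
    rw [norm_mul, Real.norm_of_nonneg (hW0 r)]
    exact mul_le_mul_of_nonneg_right (hWD r) (norm_nonneg _)
  have hF : MemLp (fun r => f r + W r * u r) 2 (volume.restrict (Ioi 0)) := hf2.add hWu
  have iu : IntegrableOn (fun r => u r ^ 2) (Ioi 0) := hu2.integrable_sq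
  have iv : IntegrableOn (fun r => (u r / r ^ 2) ^ 2) (Ioi 0) := hu4.integrable_sq
  have jf : IntegrableOn (fun r => f r ^ 2) (Ioi 0) := hf2.integrable_sq
  have iF : IntegrableOn (fun r => (f r + W r * u r) ^ 2) (Ioi 0) := hF.integrable_sq
  have iFv : IntegrableOn (fun r => (f r + W r * u r) * (u r / r ^ 2)) (Ioi 0) :=
    hF.integrable_mul hu4
  have ev : (fun r => u r ^ 2 / r ^ 4) = fun r => (u r / r ^ 2) ^ 2 := by
    funext r; rw [div_pow, ← pow_mul]
  have hardy := integral_div_pow_four_le (f := fun r => f r + W r * u r) (a := ω) (κ := κ) hω hu hu₁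
    (fun r hr => by simp only [hf r hr]; ring) iu (by rw [ev]; exact iv) iFv
  rw [ev] at hardy
  set V := ∫ r in Ioi (0 : ℝ), (u r / r ^ 2) ^ 2 with hV
  set F := ∫ r in Ioi (0 : ℝ), (f r + W r * u r) ^ 2 with hFdef
  set N := ∫ r in Ioi (0 : ℝ), u r ^ 2 with hN
  set M := ∫ r in Ioi (0 : ℝ), f r ^ 2 with hM
  have hV0 : 0 ≤ V := integral_nonneg fun r => sq_nonneg _
  have hF0 : 0 ≤ F := integral_nonneg fun r => sq_nonneg _
  have young : ∫ r in Ioi (0 : ℝ), (f r + W r * u r) * (u r / r ^ 2)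
      ≤ (κ - 3) / 2 * V + 1 / (2 * (κ - 3)) * F := by
    have hk : 0 < κ - 3 := by linarith
    rw [hV, hFdef, ← integral_const_mul, ← integral_const_mul,
      ← integral_add (iv.const_mul _) (iF.const_mul _)]
    refine integral_mono iFv ((iv.const_mul _).add (iF.const_mul _)) fun r => ?_
    simp only
    generalize f r + W r * u r = x
    generalize u r / r ^ 2 = y
    have : 0 ≤ 1 / (2 * (κ - 3)) * (x - (κ - 3) * y) ^ 2 := by positivity
    have e : 1 / (2 * (κ - 3)) * (x - (κ - 3) * y) ^ 2
      = (κ - 3) / 2 * y ^ 2 + 1 / (2 * (κ - 3)) * x ^ 2 - x * y := by field_simp; ring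
    linarith
  have hVF : (κ - 3) ^ 2 * V ≤ F := by
    have hk : 0 < κ - 3 := by linarith
    have h1 : (κ - 3) / 2 * V ≤ 1 / (2 * (κ - 3)) * F := by linarith
    have h2 := mul_le_mul_of_nonneg_left h1 (by positivity : 0 ≤ 2 * (κ - 3))
    have e1 : 2 * (κ - 3) * (1 / (2 * (κ - 3)) * F) = F := by field_simp
    rw [e1] at h2
    linarith
  have hFN : F ≤ 2 * M + 2 * D ^ 2 * N := by
    rw [hFdef, hM, hN, ← integral_const_mul, ← integral_const_mul,
      ← integral_add (jf.const_mul _) (iu.const_mul _)]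
    refine integral_mono iF ((jf.const_mul _).add (iu.const_mul _)) fun r => ?_
    simp only
    have h1 : W r ^ 2 ≤ D ^ 2 := pow_le_pow_left₀ (hW0 r) (hWD r) 2
    have h2 := mul_le_mul_of_nonneg_right h1 (sq_nonneg (u r))
    have := sq_nonneg (f r - W r * u r)
    linarith
  have c : EqOn (fun r => (u r - u₂ r - u r / r ^ 2 / 4) ^ 2 + (u r / r ^ 2) ^ 2)
      (fun r => ((1 - ω) * u r - (κ + 1 / 4) * (u r / r ^ 2) + (f r + W r * u r)) ^ 2
        + (u r / r ^ 2) ^ 2) (Ioi 0) := fun r hr => by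
    simp only
    congr 2
    rw [hf r hr]; ring
  rw [setIntegral_congr_fun measurableSet_Ioi c]
  have hfin : ∫ r in Ioi (0 : ℝ), (((1 - ω) * u r - (κ + 1 / 4) * (u r / r ^ 2)
        + (f r + W r * u r)) ^ 2 + (u r / r ^ 2) ^ 2)
      ≤ 3 * (1 - ω) ^ 2 * N + (3 * (κ + 1 / 4) ^ 2 + 1) * V + 3 * F := by
    have i12 : IntegrableOn (fun r => 3 * (1 - ω) ^ 2 * u r ^ 2
        + (3 * (κ + 1 / 4) ^ 2 + 1) * (u r / r ^ 2) ^ 2) (Ioi 0) :=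
      (iu.const_mul _).add (iv.const_mul _)
    rw [hN, hV, hFdef, ← integral_const_mul, ← integral_const_mul, ← integral_const_mul,
      ← integral_add (iu.const_mul _) (iv.const_mul _), ← integral_add i12 (iF.const_mul _)]
    have hs : MemLp (fun r => (1 - ω) * u r - (κ + 1 / 4) * (u r / r ^ 2) + (f r + W r * u r)) 2
        (volume.restrict (Ioi 0)) := ((hu2.const_mul _).sub (hu4.const_mul _)).add hF
    refine integral_mono (hs.integrable_sq.add iv)
      (i12.add (iF.const_mul _)) fun r => ?_
    simp only
    generalize (f r + W r * u r) = x
    generalize u r / r ^ 2 = y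
    generalize u r = v
    have h1 := sq_nonneg ((1 - ω) * v + (κ + 1 / 4) * y)
    have h2 := sq_nonneg ((1 - ω) * v - x)
    have h3 := sq_nonneg ((κ + 1 / 4) * y + x)
    linarith
  have hκ2 : 3 * (κ + 1 / 4) ^ 2 + 1 ≤ 13 * (κ - 3) ^ 2 := by
    have h := sq_nonneg (κ - 7)
    linarith
  have hV2 : (3 * (κ + 1 / 4) ^ 2 + 1) * V ≤ 13 * F := by
    have := mul_le_mul_of_nonneg_right hκ2 hV0
    linarith
  have hN1 : (3 * (1 - ω) ^ 2 + 32 * D ^ 2) * N ≤ (3 * (1 - ω) ^ 2 + 32 * D ^ 2) * N₁ := by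
    gcongr
  linarith

end Elliptic

section Soliton
open Set

variable {p c m β K : ℝ}

lemma Qc_eq (hm : m = 2 / (p - 1)) (hβ : β = (p - 1) * √c / 2)
    (hK : K = ((p + 1) * c / 2) ^ (1 / (p - 1))) (x : ℝ) :
    Qc p c x = K * (1 / cosh (β * x)) ^ m := by
  rw [Qc, hm, hβ, hK]
  congr 5
  ring

lemma dQc_eq (hp : 1 < p) (hc : 0 < c) (hm : m = 2 / (p - 1)) (hβ : β = (p - 1) * √c / 2)
    (hK : K = ((p + 1) * c / 2) ^ (1 / (p - 1))) (x : ℝ) :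
    dQc p c x = K * (1 / cosh (β * x)) ^ m / (2 * m * β ^ 2)
      * (1 - β * x * tanh (β * x)) := by
  have hp0 : 0 < p - 1 := by linarith
  have hs : 0 < √c := sqrt_pos.2 hc
  have hsc : √c ^ 2 = c := sq_sqrt hc.le
  have h1 : HasDerivAt (fun c' => ((p + 1) * c' / 2) ^ (1 / (p - 1)))
      (1 / (p - 1) * K / c) c := by
    have hl : HasDerivAt (fun c' : ℝ => (p + 1) * c' / 2) ((p + 1) / 2) c := by
      simpa using ((hasDerivAt_id c).const_mul (p + 1)).div_const 2
    have hpos : 0 < (p + 1) * c / 2 := by positivity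
    refine (hl.rpow_const (p := 1 / (p - 1)) (Or.inl hpos.ne')).congr_deriv ?_
    rw [rpow_sub_one hpos.ne', ← hK]
    field_simp
  have h2 : HasDerivAt (fun c' => (1 / cosh ((p - 1) * x / 2 * √c')) ^ m)
      (-(m * ((p - 1) * x / 2) * tanh ((p - 1) * x / 2 * √c)
        * (1 / cosh ((p - 1) * x / 2 * √c)) ^ m) * (1 / (2 * √c))) c :=
    (hasDerivAt_sech_rpow_mul m ((p - 1) * x / 2) (√c)).comp c (hasDerivAt_sqrt hc.ne')
  have e : (fun c' => Qc p c' x) = (fun c' => ((p + 1) * c' / 2) ^ (1 / (p - 1)))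
      * fun c' => (1 / cosh ((p - 1) * x / 2 * √c')) ^ m := by
    funext c'
    rw [Qc_eq hm rfl rfl, Pi.mul_apply]
    congr 4
    ring
  have e2 : (p - 1) * x / 2 * √c = β * x := by rw [hβ]; ring
  rw [dQc, e, (h1.mul h2).deriv]
  rw [e2, ← hK]
  generalize tanh (β * x) = σ
  generalize (1 / cosh (β * x)) ^ m = S
  rw [hm, hβ, ← hsc, sqrt_sq hs.le]
  field_simp
  ring

lemma mul_rpow_Qc (hp : 1 < p) (hc : 0 < c) (hm : m = 2 / (p - 1)) (hβ : β = (p - 1) * √c / 2)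
    {a : ℝ} (ha : 0 ≤ a) (x : ℝ) :
    p * (a * Qc p c x) ^ (p - 1)
      = (m + 1) * (m + 2) * β ^ 2 * (a ^ (p - 1) * (1 - tanh (β * x) ^ 2)) := by
  have hp0 : 0 < p - 1 := by linarith
  have hsc : √c ^ 2 = c := sq_sqrt hc.le
  have hpos : 0 < (p + 1) * c / 2 := by positivity
  have hS := sech_rpow_pos m (β * x)
  have hch : 0 < 1 / cosh (β * x) := by have := cosh_pos (β * x); positivity
  rw [Qc_eq hm hβ rfl, mul_rpow ha (by positivity), mul_rpow (by positivity) hS.le,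
    ← rpow_mul hpos.le, ← rpow_mul hch.le, one_div_mul_cancel hp0.ne', rpow_one, one_sub_tanh_sq,
    show m * (p - 1) = (2 : ℕ) by rw [hm]; push_cast; field_simp, rpow_natCast,
    hm, hβ, ← hsc, sqrt_sq (sqrt_nonneg c)]
  field_simp
  ring

lemma approximateKernel_eq {χ χ₁ χ₂ : ℝ → ℝ} {X ε ρ l : ℝ} {Ψ : ℝ → ℝ}
    (hp : 1 < p) (hc : 0 < c) (hm : m = 2 / (p - 1))
    (hβ : β = (p - 1) * √c / 2) (hK : K = ((p + 1) * c / 2) ^ (1 / (p - 1)))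
    (hχ : IsCutoff χ χ₁ χ₂ X)
    (hΨ : ∀ r : ℝ, Ψ r = -(deriv (fun t => χ ((t - ρ) / l) * Qc p c (t - ρ)) r)
        - 2 * ε * ((ε * ρ) ^ 3)⁻¹ * χ ((r - ρ) / l) * dQc p c (r - ρ)) (r : ℝ) :
    Ψ r = K * m * β * (χ ((r - ρ) / l) * ((1 / cosh (β * (r - ρ))) ^ m * tanh (β * (r - ρ)))
      - χ₁ ((r - ρ) / l) / l * (1 / cosh (β * (r - ρ))) ^ m / (m * β)
      - ε * ((ε * ρ) ^ 3)⁻¹ * χ ((r - ρ) / l) * (1 / cosh (β * (r - ρ))) ^ m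
        * (1 - β * (r - ρ) * tanh (β * (r - ρ))) / (m ^ 2 * β ^ 3)) := by
  have hp0 : 0 < p - 1 := by linarith
  have hs : 0 < √c := sqrt_pos.2 hc
  have hm0 : 0 < m := by rw [hm]; positivity
  have hβ0 : 0 < β := by rw [hβ]; positivity
  have hd : HasDerivAt (fun t => χ ((t - ρ) / l) * Qc p c (t - ρ)) _ r :=
    hasDerivAt_cutoff_mul hχ (h := Qc p c) (h₁ := fun x =>
      K * -(m * β * tanh (β * x) * (1 / cosh (β * x)) ^ m)) (fun x => by
        rw [show Qc p c = fun x => K * (1 / cosh (β * x)) ^ m from funext (Qc_eq hm hβ hK)]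
        exact (hasDerivAt_sech_rpow_mul m β x).const_mul K) r
  rw [hΨ, hd.deriv, dQc_eq hp hc hm hβ hK, Qc_eq hm hβ hK]
  generalize tanh (β * (r - ρ)) = σ
  generalize (1 / cosh (β * (r - ρ))) ^ m = S
  generalize ((ε * ρ) ^ 3)⁻¹ = q
  generalize χ₁ ((r - ρ) / l) / l = y
  field_simp
  ring

end Soliton

section Bump
open Set

lemma abs_sqrt_sub_one_le {t : ℝ} (ht : 0 ≤ t) : |√t - 1| ≤ |t - 1| := by
  have h : t - 1 = (√t - 1) * (√t + 1) := by linear_combination -(sq_sqrt ht)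
  rw [h, abs_mul]
  refine le_mul_of_one_le_right (abs_nonneg _) ?_
  rw [abs_of_nonneg (by positivity)]
  linarith [sqrt_nonneg t]

/-- Difference between the (normalised, weighted) approximate kernel element and the truncated
exact kernel element. -/
lemma abs_weighted_sub_le {m b₀ b₁ ω q₁ ε ρ β l X : ℝ} {χ χ₁ χ₂ : ℝ → ℝ}
    (hR : IsRegime m b₀ b₁ ω q₁ ε ρ β l) (hχ : IsCutoff χ χ₁ χ₂ X) (hX : 0 ≤ X) {r : ℝ}
    (hr : |r - ρ| ≤ 3 * l) :
    |√(r / ρ) * (χ ((r - ρ) / l) * ((1 / cosh (β * (r - ρ))) ^ m * tanh (β * (r - ρ)))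
      - χ₁ ((r - ρ) / l) / l * (1 / cosh (β * (r - ρ))) ^ m / (m * β)
      - ε * ((ε * ρ) ^ 3)⁻¹ * χ ((r - ρ) / l) * (1 / cosh (β * (r - ρ))) ^ m
        * (1 - β * (r - ρ) * tanh (β * (r - ρ))) / (m ^ 2 * β ^ 3))
      - χ ((r - ρ) / l) * ((1 / cosh (β * (r - ρ))) ^ m * tanh (β * (r - ρ)))|
    ≤ (3 * q₁ + 2 * (X / (m * b₀)) + 2 * (q₁ ^ 3 * (1 + 3 * b₁) / (m ^ 2 * b₀ ^ 3))) / l := by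
  have hl := hR.l_pos
  have hρ := hR.ρ_pos
  have hm := hR.m_pos
  have hb₀ := hR.b₀_pos
  have hβ := hR.β_pos
  have hq := hR.q_pos
  have hb₁ : 0 < b₁ := hβ.trans_le hR.le_b₁
  have hq₁ := hR.q₁_pos
  have hr0 : 0 ≤ r := by linarith [hR.six_l_le, (abs_le.1 hr).1]
  have ht0 : 0 ≤ r / ρ := by positivity
  have hS0 := sech_rpow_pos m (β * (r - ρ))
  have hS1 := sech_rpow_le_one hm.le (β * (r - ρ))
  have hσ := abs_tanh_le_one (β * (r - ρ))
  have hχ0 := hχ.nonneg ((r - ρ) / l)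
  have hχ1 := hχ.le_one ((r - ρ) / l)
  have hχ₁ := hχ.bound₁ ((r - ρ) / l)
  generalize tanh (β * (r - ρ)) = σ at *
  generalize (1 / cosh (β * (r - ρ))) ^ m = S at *
  generalize χ ((r - ρ) / l) = a at *
  generalize χ₁ ((r - ρ) / l) = a₁ at *
  have hsq1 : |√(r / ρ) - 1| ≤ 3 * q₁ / l := by
    refine (abs_sqrt_sub_one_le ht0).trans ?_
    rw [show r / ρ - 1 = (r - ρ) * (1 / ρ) by field_simp, abs_mul,
      abs_of_pos (by positivity : 0 < 1 / ρ)]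
    calc |r - ρ| * (1 / ρ) ≤ 3 * l * (q₁ / l ^ 2) := by
          have := hR.one_div_le
          gcongr
      _ = 3 * q₁ / l := by field_simp
  have hsq2 : √(r / ρ) ≤ 2 := by
    rw [sqrt_le_left (by norm_num), div_le_iff₀ hρ]
    linarith [hR.six_l_le, (abs_le.1 hr).2]
  have hsq0 := sqrt_nonneg (r / ρ)
  generalize √(r / ρ) = s at *
  have hA : |a * (S * σ)| ≤ 1 := by
    rw [abs_mul, abs_mul, abs_of_nonneg hχ0, abs_of_pos hS0]
    exact mul_le_one₀ hχ1 (by positivity) (mul_le_one₀ hS1 (abs_nonneg _) hσ)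
  have hE₁ : |a₁ / l * S / (m * β)| ≤ X / (m * b₀) / l := by
    rw [abs_div, abs_mul, abs_div, abs_of_pos hl, abs_of_pos hS0,
      abs_of_pos (by positivity : 0 < m * β)]
    calc |a₁| / l * S / (m * β) ≤ X / l * 1 / (m * b₀) := by
          gcongr
          exact hR.b₀_le
      _ = X / (m * b₀) / l := by ring
  have hq3 : ((ε * ρ) ^ 3)⁻¹ ≤ q₁ ^ 3 := by
    rw [← inv_pow]; exact pow_le_pow_left₀ hq.le hR.q_le 3
  have hε := hR.ε_pos
  have hεl : ε * l ≤ 1 / l := by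
    rw [le_div_iff₀ hl]; linarith [hR.ε_mul_le]
  have hE₂' : |1 - β * (r - ρ) * σ| ≤ (1 + 3 * b₁) * l := by
    refine (abs_sub _ _).trans ?_
    rw [abs_one, abs_mul, abs_mul, abs_of_pos hβ]
    calc 1 + β * |r - ρ| * |σ| ≤ l + b₁ * (3 * l) * 1 := by
          have := hR.le_b₁
          have := hR.one_le
          gcongr
      _ = (1 + 3 * b₁) * l := by ring
  have hE₂ : |ε * ((ε * ρ) ^ 3)⁻¹ * a * S * (1 - β * (r - ρ) * σ) / (m ^ 2 * β ^ 3)|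
      ≤ q₁ ^ 3 * (1 + 3 * b₁) / (m ^ 2 * b₀ ^ 3) / l := by
    rw [abs_div, abs_mul, abs_of_pos (by positivity : 0 < m ^ 2 * β ^ 3),
      abs_of_nonneg (by positivity : 0 ≤ ε * ((ε * ρ) ^ 3)⁻¹ * a * S)]
    calc ε * ((ε * ρ) ^ 3)⁻¹ * a * S * |1 - β * (r - ρ) * σ| / (m ^ 2 * β ^ 3)
        ≤ ε * q₁ ^ 3 * 1 * 1 * ((1 + 3 * b₁) * l) / (m ^ 2 * b₀ ^ 3) := by
          gcongr
          exact hR.b₀_le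
      _ = (ε * l) * (q₁ ^ 3 * (1 + 3 * b₁) / (m ^ 2 * b₀ ^ 3)) := by ring
      _ ≤ 1 / l * (q₁ ^ 3 * (1 + 3 * b₁) / (m ^ 2 * b₀ ^ 3)) := by gcongr
      _ = _ := by ring
  generalize ε * ((ε * ρ) ^ 3)⁻¹ * a * S * (1 - β * (r - ρ) * σ) / (m ^ 2 * β ^ 3) = E₂ at *
  generalize a₁ / l * S / (m * β) = E₁ at *
  generalize a * (S * σ) = A at *
  calc |s * (A - E₁ - E₂) - A| = |(s - 1) * A - s * E₁ - s * E₂| := by congr 1; ring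
    _ ≤ |(s - 1) * A| + |s * E₁| + |s * E₂| :=
        (abs_sub _ _).trans (add_le_add_left (abs_sub _ _) _)
    _ = |s - 1| * |A| + s * |E₁| + s * |E₂| := by simp only [abs_mul, abs_of_nonneg hsq0]
    _ ≤ 3 * q₁ / l * 1 + 2 * (X / (m * b₀) / l)
        + 2 * (q₁ ^ 3 * (1 + 3 * b₁) / (m ^ 2 * b₀ ^ 3) / l) := by gcongr
    _ = _ := by ring

/-- Smallness of `ε` ensures that the logarithmic length is in the admissible range. -/
lemma exists_eps_log (L₀ : ℝ) {k₁ k₂ : ℝ} (hk₁ : 0 < k₁) :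
    ∃ δ > (0 : ℝ), ∀ ε ∈ Ioo (0 : ℝ) δ,
      L₀ ≤ k₁ * -log ε ∧ ε * (k₂ * log ε) ^ 2 ≤ 1 ∧ ε ≤ 1 / 4 := by
  have h1 : ∀ᶠ ε in nhdsWithin (0 : ℝ) (Ioi 0), log ε ≤ -(L₀ / k₁) :=
    tendsto_log_nhdsGT_zero.eventually_le_atBot _
  have h2 : Tendsto (fun ε : ℝ => (k₂ * (log ε * ε ^ (1 / 2 : ℝ))) ^ 2)
      (nhdsWithin (0 : ℝ) (Ioi 0)) (nhds ((k₂ * 0) ^ 2)) :=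
    ((tendsto_log_mul_rpow_nhdsGT_zero (by norm_num)).const_mul k₂).pow 2
  have h3 := h2.eventually_le_const (show (k₂ * 0) ^ 2 < (1 : ℝ) by simp)
  have h4 : ∀ᶠ ε in nhdsWithin (0 : ℝ) (Ioi 0), ε ∈ Ioo (0 : ℝ) (1 / 4) :=
    Ioo_mem_nhdsGT (by norm_num)
  obtain ⟨δ, hδ, H⟩ := mem_nhdsGT_iff_exists_Ioo_subset.1 (h1.and (h3.and h4))
  refine ⟨δ, hδ, fun ε hε => ?_⟩
  obtain ⟨a1, a2, a3⟩ := H hε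
  refine ⟨?_, ?_, a3.2.le⟩
  · have := mul_le_mul_of_nonneg_left (neg_le_neg a1) hk₁.le
    rwa [neg_neg, mul_div_cancel₀ _ hk₁.ne'] at this
  · refine le_trans (le_of_eq ?_) a2
    rw [← sqrt_eq_rpow, mul_pow, mul_pow, mul_pow, sq_sqrt hε.1.le]
    ring

end Bump

section Parameters
open Set

lemma isRegime_of_small {p ω α₀ ε ρ c l : ℝ} (hp : 1 < p) (hω : 0 < ω)
    (hα : α₀ = 2 / √((p - 1) * ω)) (hε : 0 < ε) (hε4 : ε ≤ 1 / 4) (hρ : α₀ / (2 * ε) < ρ)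
    (hc : c = ω + ((ε * ρ) ^ 2)⁻¹)
    (hl : l = -(2 / √c) * max 1 (1 / (p - 1)) * log ε)
    (hL : max 1 (6 * √((p - 1) * ω)) ≤ 2 / √(p * ω) * -log ε)
    (hs : ε * (2 / √ω * max 1 (1 / (p - 1)) * log ε) ^ 2 ≤ 1) :
    IsRegime (2 / (p - 1)) (√ω / (2 / (p - 1))) (√(p * ω) / (2 / (p - 1))) ω (√((p - 1) * ω))
      ε ρ ((p - 1) * √c / 2) l ∧ 2 / √(p * ω) * -log ε ≤ l ∧ 0 < c := by
  have hp0 : 0 < p - 1 := by linarith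
  have hq₁ : 0 < √((p - 1) * ω) := sqrt_pos.2 (by positivity)
  have hα0 : 0 < α₀ := by rw [hα]; positivity
  have hρ0 : 0 < ρ := lt_trans (by positivity) hρ
  have hq : (ε * ρ)⁻¹ ≤ √((p - 1) * ω) := by
    rw [inv_le_comm₀ (by positivity) hq₁]
    rw [div_lt_iff₀ (by positivity), hα] at hρ
    rw [← one_div]
    have e : 2 / √((p - 1) * ω) = 2 * (1 / √((p - 1) * ω)) := by ring
    linarith
  have hq2 : ((ε * ρ) ^ 2)⁻¹ ≤ (p - 1) * ω := by
    rw [← inv_pow, ← sq_sqrt (show 0 ≤ (p - 1) * ω by positivity)]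
    exact pow_le_pow_left₀ (by positivity) hq 2
  have hqp : 0 < ((ε * ρ) ^ 2)⁻¹ := by positivity
  have hc0 : 0 < c := by linarith
  have hsω : 0 < √ω := sqrt_pos.2 hω
  have hsc : 0 < √c := sqrt_pos.2 hc0
  have h1 : √ω ≤ √c := sqrt_le_sqrt (by linarith)
  have h2 : √c ≤ √(p * ω) := sqrt_le_sqrt (by linarith)
  have hlog : 0 ≤ -log ε := by
    linarith [log_nonpos hε.le (by linarith : ε ≤ 1)]
  have hM : 1 ≤ max 1 (1 / (p - 1)) := le_max_left _ _
  have hl' : l = 2 / √c * max 1 (1 / (p - 1)) * -log ε := by rw [hl]; ring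
  have hlow : 2 / √(p * ω) * -log ε ≤ l := by
    rw [hl']
    calc 2 / √(p * ω) * -log ε ≤ 2 / √c * -log ε := by gcongr
      _ = 2 / √c * 1 * -log ε := by ring
      _ ≤ _ := by gcongr
  have hup : l ≤ 2 / √ω * max 1 (1 / (p - 1)) * -log ε := by
    rw [hl']; gcongr
  have hone : 1 ≤ l := (le_max_left _ _).trans (hL.trans hlow)
  refine ⟨⟨by positivity, by positivity, ?_, ?_, hω, hε, hρ0, hone, hq,
    (le_max_right _ _).trans (hL.trans hlow), ?_, ?_⟩, hlow, hc0⟩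
  · rw [show √ω / (2 / (p - 1)) = (p - 1) * √ω / 2 by field_simp]
    gcongr
  · rw [show √(p * ω) / (2 / (p - 1)) = (p - 1) * √(p * ω) / 2 by field_simp]
    gcongr
  · refine le_trans ?_ hs
    have : l ^ 2 ≤ (2 / √ω * max 1 (1 / (p - 1)) * -log ε) ^ 2 :=
      pow_le_pow_left₀ (by linarith) hup 2
    calc ε * l ^ 2 ≤ ε * (2 / √ω * max 1 (1 / (p - 1)) * -log ε) ^ 2 := by gcongr
      _ = _ := by ring
  · rw [← hc, show (2 / (p - 1)) ^ 2 * ((p - 1) * √c / 2) ^ 2 = √c ^ 2 by field_simp,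
      sq_sqrt hc0.le]

end Parameters

section Transform
open Set

variable {w : ℝ → ℝ}

lemma ContDiffOn.hasDerivAt_pair (hw : ContDiffOn ℝ 4 w (Ioi 0)) :
    (∀ r > 0, HasDerivAt w (deriv w r) r) ∧
    (∀ r > 0, HasDerivAt (deriv w) (deriv (deriv w) r) r) ∧
    ContinuousOn (radLap w) (Ioi 0) := by
  have h1 : ContDiffOn ℝ 3 (deriv w) (Ioi 0) := hw.deriv_of_isOpen isOpen_Ioi (by norm_num)
  have h2 : ContDiffOn ℝ 2 (deriv (deriv w)) (Ioi 0) :=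
    h1.deriv_of_isOpen isOpen_Ioi (by norm_num)
  refine ⟨fun r hr => ?_, fun r hr => ?_, ?_⟩
  · exact ((hw.differentiableOn (by norm_num)).differentiableAt (Ioi_mem_nhds hr)).hasDerivAt
  · exact ((h1.differentiableOn (by norm_num)).differentiableAt (Ioi_mem_nhds hr)).hasDerivAt
  · exact h2.continuousOn.add (h1.continuousOn.div continuousOn_id fun r hr => ne_of_gt hr)

lemma hasDerivAt_sqrt_mul {r w' : ℝ} (hr : 0 < r) (h : HasDerivAt w w' r) :
    HasDerivAt (fun r => √r * w r) (√r * w' + w r / (2 * √r)) r := by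
  have hs := sqrt_pos.2 hr
  refine ((hasDerivAt_sqrt hr.ne').mul h).congr_deriv ?_
  ring

lemma hasDerivAt_sqrt_mul_deriv {v : ℝ → ℝ} {r w'' : ℝ} (hr : 0 < r) (h : HasDerivAt w (v r) r)
    (h' : HasDerivAt v w'' r) :
    HasDerivAt (fun r => √r * v r + w r / (2 * √r))
      (√r * (w'' + v r / r - w r / (4 * r ^ 2))) r := by
  have hs := sqrt_pos.2 hr
  have hss : √r ^ 2 = r := sq_sqrt hr.le
  refine (((hasDerivAt_sqrt hr.ne').mul h').add
    (h.div ((hasDerivAt_sqrt hr.ne').const_mul 2) (by positivity))).congr_deriv ?_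
  generalize √r = s at *
  subst hss
  field_simp
  ring

lemma memLp_sqrt_mul {v : ℝ → ℝ} {F : ℝ → ℝ} (hv : ContinuousOn v (Ioi 0))
    (hF : IntegrableOn F (Ioi 0)) (hle : ∀ r > 0, v r ^ 2 * r ≤ F r) :
    MemLp (fun r => √r * v r) 2 (volume.restrict (Ioi 0)) := by
  have hm : AEStronglyMeasurable (fun r => √r * v r) (volume.restrict (Ioi 0)) :=
    (continuous_sqrt.continuousOn.mul hv).aestronglyMeasurable measurableSet_Ioi
  refine (memLp_two_iff_integrable_sq hm).2 (hF.mono' (hm.pow 2) ?_)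
  filter_upwards [ae_restrict_mem measurableSet_Ioi] with r hr
  have hr0 : 0 < r := hr
  rw [norm_of_nonneg (sq_nonneg _), mul_pow, sq_sqrt hr0.le, mul_comm]
  exact hle r hr

end Transform

theorem stmt14 (p ω : ℝ) (hp : 1 < p) (hω : 0 < ω)
    (α₀ : ℝ) (hα : α₀ = 2 / Real.sqrt ((p - 1) * ω))
    (χ : ℝ → ℝ) (hχsmooth : ContDiff ℝ (⊤ : ℕ∞) χ) (hχrange : ∀ s, χ s ∈ Set.Icc (0:ℝ) 1)
    (hχone : ∀ s ∈ Set.Icc (-2:ℝ) 2, χ s = 1)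
    (hχzero : ∀ s ∉ Set.Ioo (-3:ℝ) 3, χ s = 0) :
    ∃ εstar > (0:ℝ), ∃ ν > (0:ℝ),
      ∀ ε ∈ Set.Ioo (0:ℝ) εstar, ∀ ρ ∈ Set.Ioo (α₀ / (2 * ε)) (2 * α₀ / ε),
      ∀ c l : ℝ, c = ω + ((ε * ρ) ^ 2)⁻¹ →
      l = -(2 / Real.sqrt c) * max 1 (1 / (p - 1)) * Real.log ε →
      ∀ Φ Ψ : ℝ → ℝ,
      (∀ r : ℝ, Φ r = χ ((r - ρ) / l) * Qc p c (r - ρ)) →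
      (∀ r : ℝ, Ψ r = -(deriv (fun t => χ ((t - ρ) / l) * Qc p c (t - ρ)) r)
        - 2 * ε * ((ε * ρ) ^ 3)⁻¹ * χ ((r - ρ) / l) * dQc p c (r - ρ)) →
      ∀ w : ℝ → ℝ, ContDiffOn ℝ 4 w (Set.Ioi 0) →
      IntegrableOn
        (fun r => (w r ^ 2 + radLap w r ^ 2 + radLap (radLap w) r ^ 2
          + (r ^ 4)⁻¹ * w r ^ 2) * r) (Set.Ioi 0) →
      (∫ r in Set.Ioi (0:ℝ), w r * Ψ r * r) = 0 →
      ∀ Lw g : ℝ → ℝ,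
      (∀ r : ℝ, Lw r = radLap w r - (ω + ((ε * r) ^ 2)⁻¹) * w r
        + p * Φ r ^ (p - 1) * w r) →
      (∀ r : ℝ, g r = Lw r
        - ((∫ s in Set.Ioi (0:ℝ), Lw s * Ψ s * s) /
            (∫ s in Set.Ioi (0:ℝ), Ψ s ^ 2 * s)) * Ψ r) →
      Real.sqrt (∫ r in Set.Ioi (0:ℝ),
          ((w r - radLap w r) ^ 2 + (r ^ 4)⁻¹ * w r ^ 2) * r)
        ≤ ν * Real.sqrt (∫ r in Set.Ioi (0:ℝ), g r ^ 2 * r) := by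
  obtain ⟨X, hX, hχ⟩ := IsCutoff.of_contDiff hχsmooth hχrange hχone hχzero
  have hp0 : 0 < p - 1 := by linarith
  obtain ⟨m, hm⟩ : ∃ m, m = 2 / (p - 1) := ⟨_, rfl⟩
  obtain ⟨b₀, hb₀⟩ : ∃ b₀, b₀ = √ω / m := ⟨_, rfl⟩
  obtain ⟨b₁, hb₁⟩ : ∃ b₁, b₁ = √(p * ω) / m := ⟨_, rfl⟩
  obtain ⟨q₁, hq₁⟩ : ∃ q₁, q₁ = √((p - 1) * ω) := ⟨_, rfl⟩
  have hm0 : 0 < m := by rw [hm]; positivity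
  have hb₀0 : 0 < b₀ := by rw [hb₀]; positivity
  have hb₁0 : 0 < b₁ := by rw [hb₁]; positivity
  have hq₁0 : 0 < q₁ := by rw [hq₁]; positivity
  have hb : b₀ ≤ b₁ := by
    rw [hb₀, hb₁]; gcongr; exact le_mul_of_one_le_left hω.le hp.le
  obtain ⟨L₀, -, C, hC, H⟩ := exists_half_line_bound
    (K₀ := 3 * q₁ + 2 * (X / (m * b₀)) + 2 * (q₁ ^ 3 * (1 + 3 * b₁) / (m ^ 2 * b₀ ^ 3)))
    hm0 hb₀0 hb hω hq₁0 hX hχ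
  obtain ⟨δ, hδ, hsmall⟩ := exists_eps_log (max L₀ (max 1 (6 * √((p - 1) * ω))))
    (k₁ := 2 / √(p * ω)) (k₂ := 2 / √ω * max 1 (1 / (p - 1))) (by positivity)
  obtain ⟨D, hD⟩ : ∃ D, D = (m + 1) * (m + 2) * b₁ ^ 2 := ⟨_, rfl⟩
  obtain ⟨A, hA⟩ : ∃ A, A = (3 * (1 - ω) ^ 2 + 32 * D ^ 2) * C ^ 2 + 32 * C ^ 2 := ⟨_, rfl⟩
  have hA0 : 0 < A := by rw [hA]; positivity
  refine ⟨δ, hδ, √A, sqrt_pos.2 hA0, ?_⟩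
  intro ε hε ρ hρ c l hc hl Φ Ψ hΦ hΨ w hw hint horth Lw g hLw hg
  obtain ⟨hs1, hs2, hs3⟩ := hsmall ε hε
  obtain ⟨hR, hlow, hc0⟩ := isRegime_of_small hp hω hα hε.1 hs3 hρ.1 hc hl
    ((le_max_right _ _).trans hs1) hs2
  rw [← hm, ← hb₀, ← hb₁, ← hq₁] at hR
  obtain ⟨β, hβ⟩ : ∃ β, β = (p - 1) * √c / 2 := ⟨_, rfl⟩
  rw [← hβ] at hR
  obtain ⟨K, hK⟩ : ∃ K, K = ((p + 1) * c / 2) ^ (1 / (p - 1)) := ⟨_, rfl⟩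
  have hK0 : 0 < K := by rw [hK]; positivity
  have hβ0 := hR.β_pos
  have hl0 := hR.l_pos
  have hρ0 := hR.ρ_pos
  have hε0 := hR.ε_pos
  have hsρ : 0 < √ρ := sqrt_pos.2 hρ0
  set γ := K * m * β with hγ
  have hγ0 : 0 < γ := by positivity
  set ψ : ℝ → ℝ := fun r =>
    χ ((r - ρ) / l) * ((1 / cosh (β * (r - ρ))) ^ m * tanh (β * (r - ρ))) with hψ
  set B : ℝ → ℝ := fun r => ψ r
      - deriv χ ((r - ρ) / l) / l * (1 / cosh (β * (r - ρ))) ^ m / (m * β)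
      - ε * ((ε * ρ) ^ 3)⁻¹ * χ ((r - ρ) / l) * (1 / cosh (β * (r - ρ))) ^ m
        * (1 - β * (r - ρ) * tanh (β * (r - ρ))) / (m ^ 2 * β ^ 3) with hB
  have hΨB : ∀ r, Ψ r = γ * B r := approximateKernel_eq hp hc0 hm hβ hK hχ hΨ
  have mχ : Measurable χ := hχsmooth.continuous.measurable
  have mσ : Measurable fun x => tanh (β * x) :=
    (continuous_iff_continuousAt.2 fun x => (hasDerivAt_tanh_mul β x).continuousAt).measurable
  have mS : Measurable fun x => (1 / cosh (β * x)) ^ m :=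
    (continuous_iff_continuousAt.2 fun x =>
      (hasDerivAt_sech_rpow_mul m β x).continuousAt).measurable
  have ms : Measurable fun r : ℝ => r - ρ := measurable_id.sub_const ρ
  have mχs : Measurable fun r => χ ((r - ρ) / l) := mχ.comp (ms.div_const l)
  have mχ₁s : Measurable fun r => deriv χ ((r - ρ) / l) :=
    (measurable_deriv χ).comp (ms.div_const l)
  have mσs : Measurable fun r => tanh (β * (r - ρ)) := mσ.comp ms
  have mSs : Measurable fun r => (1 / cosh (β * (r - ρ))) ^ m := mS.comp ms
  have mψ : Measurable ψ := mχs.mul (mSs.mul mσs)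
  have mB : Measurable B := by
    refine (mψ.sub ?_).sub ?_
    · exact ((mχ₁s.div_const l).mul mSs).div_const _
    · exact (((mχs.const_mul _).mul mSs).mul
        (measurable_const.sub ((ms.const_mul β).mul mσs))).div_const _
  set d : ℝ → ℝ := fun r => √(r / ρ) * B r - ψ r with hd
  have md : Measurable d := ((measurable_id.div_const ρ).sqrt.mul mB).sub mψ
  have hψ0 : ∀ r, 3 * l < |r - ρ| → ψ r = 0 := fun r hr => by
    simp only [hψ, (hχ.eq_zero _ (three_lt_abs_div hl0 hr)).1, zero_mul]
  have hd0 : ∀ r, 3 * l < |r - ρ| → d r = 0 := fun r hr => by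
    obtain ⟨e1, e2, -⟩ := hχ.eq_zero _ (three_lt_abs_div hl0 hr)
    simp only [hd, hB, hψ0 r hr, e1, e2]
    ring
  have hd1 : ∀ r, |r - ρ| ≤ 3 * l → |d r| ≤ _ := fun r hr => abs_weighted_sub_le hR hχ hX hr
  have hψ1 : ∀ r, |r - ρ| ≤ 3 * l → |ψ r| ≤ l / l := fun r _ => by
    rw [div_self hl0.ne', hψ, abs_mul, abs_mul, abs_of_nonneg (hχ.nonneg _),
      abs_of_pos (sech_rpow_pos _ _)]
    exact mul_le_one₀ (hχ.le_one _) (mul_nonneg (sech_rpow_pos _ _).le (abs_nonneg _))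
      (mul_le_one₀ (sech_rpow_le_one hm0.le _) (abs_nonneg _) (abs_tanh_le_one _))
  have Lψ := (memLp_two_of_bump mψ hl0 hψ0 hψ1).1
  have Ld := (memLp_two_of_bump md hl0 hd0 hd1).1
  set ζ : ℝ → ℝ := fun x => χ (x / l) ^ (p - 1) with hζ
  have mζ : Measurable ζ := (mχ.comp (measurable_id.div_const l)).pow_const _
  have hζ0 : ∀ x, 0 ≤ ζ x := fun x => rpow_nonneg (hχ.nonneg _) _
  have hζ1 : ∀ x, ζ x ≤ 1 := fun x => rpow_le_one (hχ.nonneg _) (hχ.le_one _) hp0.le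
  have hζ2 : ∀ x, |x| ≤ 2 * l → ζ x = 1 := fun x hx => by
    simp only [hζ, hχ.eq_one _ (abs_div_le_two hl0 hx), one_rpow]
  obtain ⟨hw1, hw2, cΔ⟩ := hw.hasDerivAt_pair
  set u : ℝ → ℝ := fun r => √r * w r with hu
  set u₁ : ℝ → ℝ := fun r => √r * deriv w r + w r / (2 * √r) with hu₁
  set u₂ : ℝ → ℝ := fun r => √r * (deriv (deriv w) r + deriv w r / r - w r / (4 * r ^ 2)) with hu₂
  have du : ∀ r > 0, HasDerivAt u (u₁ r) r := fun r hr => hasDerivAt_sqrt_mul hr (hw1 r hr)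
  have du₁ : ∀ r > 0, HasDerivAt u₁ (u₂ r) r := fun r hr =>
    hasDerivAt_sqrt_mul_deriv hr (hw1 r hr) (hw2 r hr)
  have hu₂' : ∀ r, u₂ r = √r * (radLap w r - w r / (4 * r ^ 2)) := fun r => rfl
  have cw : ContinuousOn w (Set.Ioi 0) := hw.continuousOn
  have Lu : MemLp u 2 (volume.restrict (Set.Ioi 0)) := memLp_sqrt_mul cw hint fun r hr => by
    gcongr
    have := sq_nonneg (radLap w r)
    have := sq_nonneg (radLap (radLap w) r)
    have : 0 ≤ (r ^ 4)⁻¹ * w r ^ 2 := by positivity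
    linarith
  have LΔ : MemLp (fun r => √r * radLap w r) 2 (volume.restrict (Set.Ioi 0)) :=
    memLp_sqrt_mul cΔ hint fun r hr => by
      gcongr
      have := sq_nonneg (w r)
      have := sq_nonneg (radLap (radLap w) r)
      have : 0 ≤ (r ^ 4)⁻¹ * w r ^ 2 := by positivity
      linarith
  have Lu4 : MemLp (fun r => u r / r ^ 2) 2 (volume.restrict (Set.Ioi 0)) := by
    have : MemLp (fun r => √r * (w r / r ^ 2)) 2 (volume.restrict (Set.Ioi 0)) :=
      memLp_sqrt_mul (cw.div (continuous_pow 2).continuousOn fun r hr => (pow_pos hr 2).ne') hint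
        fun r hr => by
          gcongr
          have := sq_nonneg (w r)
          have := sq_nonneg (radLap w r)
          have := sq_nonneg (radLap (radLap w) r)
          have e : (w r / r ^ 2) ^ 2 = (r ^ 4)⁻¹ * w r ^ 2 := by rw [div_pow, ← pow_mul]; ring
          linarith
    simpa only [hu, mul_div_assoc] using this
  set W : ℝ → ℝ := fun r =>
    (m + 1) * (m + 2) * β ^ 2 * (ζ (r - ρ) * (1 - tanh (β * (r - ρ)) ^ 2)) with hW
  have mW : Measurable W :=
    ((mζ.comp ms).mul (measurable_const.sub (mσs.pow_const 2))).const_mul _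
  have hW0 : ∀ r, 0 ≤ W r := fun r => by
    have := hζ0 (r - ρ)
    have := one_sub_tanh_sq_nonneg (β * (r - ρ))
    positivity
  have hWD : ∀ r, W r ≤ D := fun r => by
    have h1 := hζ0 (r - ρ)
    have h2 := one_sub_tanh_sq_nonneg (β * (r - ρ))
    have h3 : ζ (r - ρ) * (1 - tanh (β * (r - ρ)) ^ 2) ≤ 1 :=
      mul_le_one₀ (hζ1 _) h2 (by linarith [sq_nonneg (tanh (β * (r - ρ)))])
    have h4 := hR.le_b₁
    calc W r ≤ (m + 1) * (m + 2) * b₁ ^ 2 * 1 := by simp only [hW]; gcongr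
      _ = D := by rw [hD, mul_one]
  set f : ℝ → ℝ := fun r => -u₂ r + truncPotential m ω ε ρ β ζ r * u r with hf
  have hfW : ∀ r, f r = -u₂ r + (ω + (1 / ε ^ 2 - 1 / 4) / r ^ 2 - W r) * u r := fun r => rfl
  have hpot : ∀ r, p * Φ r ^ (p - 1) = W r := fun r => by
    rw [hΦ]; exact mul_rpow_Qc hp hc0 hm hβ (hχ.nonneg _) _
  have hfL : ∀ r > 0, f r = -(√r * Lw r) := fun r hr => by
    rw [hfW, hLw, hpot, hu₂']
    simp only [hu]
    field_simp
    ring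
  have Lf : MemLp f 2 (volume.restrict (Set.Ioi 0)) := by
    have LW : MemLp (fun r => W r * u r) 2 (volume.restrict (Set.Ioi 0)) := by
      refine MemLp.of_le_mul (c := D) Lu (mW.aestronglyMeasurable.mul Lu.1)
        (ae_of_all _ fun r => ?_)
      rw [norm_mul, Real.norm_of_nonneg (hW0 r)]
      exact mul_le_mul_of_nonneg_right (hWD r) (norm_nonneg _)
    refine ((((Lu.const_mul ω).add (Lu4.const_mul (1 / ε ^ 2))).sub LW).sub LΔ).ae_eq ?_
    filter_upwards [ae_restrict_mem measurableSet_Ioi] with r hr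
    have hr0 : 0 < r := hr
    simp only [Pi.add_apply, Pi.sub_apply, hfW, hu₂', hu]
    field_simp
    ring
  obtain ⟨k, hk⟩ : ∃ k, k = (∫ s in Set.Ioi (0:ℝ), Lw s * Ψ s * s) /
    (∫ s in Set.Ioi (0:ℝ), Ψ s ^ 2 * s) := ⟨_, rfl⟩
  have hsr : ∀ r, √r = √ρ * √(r / ρ) := fun r => by
    rw [← sqrt_mul hρ0.le, mul_div_cancel₀ _ hρ0.ne']
  have hfg : ∀ r > 0, f r = -(√r * g r + k * √ρ * γ * (ψ r + d r)) := fun r hr => by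
    rw [hfL r hr, hg r, ← hk, hΨB]
    simp only [hd]
    linear_combination -(k * γ * B r) * hsr r
  have Lg : MemLp (fun r => √r * g r) 2 (volume.restrict (Set.Ioi 0)) := by
    refine (Lf.neg.sub ((Lψ.add Ld).const_mul (k * √ρ * γ))).ae_eq ?_
    filter_upwards [ae_restrict_mem measurableSet_Ioi] with r hr
    simp only [Pi.add_apply, Pi.sub_apply, Pi.neg_apply, hfg r hr]
    ring
  have horth' : ∫ r in Set.Ioi (0 : ℝ), u r * (ψ r + d r) = 0 := by
    have e : ∀ r ∈ Set.Ioi (0 : ℝ), u r * (ψ r + d r) = 1 / (√ρ * γ) * (w r * Ψ r * r) := by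
      intro r hr
      have hr0 : 0 < r := hr
      rw [hΨB]
      simp only [hu, hd, add_sub_cancel]
      field_simp
      have h1 := sq_sqrt hr0.le
      linear_combination (w r * B r) * h1 - (√r * w r * B r) * hsr r
    rw [setIntegral_congr_fun measurableSet_Ioi e, integral_const_mul, horth, mul_zero]
  obtain ⟨E₁, E₂⟩ := H ε ρ β l hR ((le_max_left _ _).trans (hs1.trans hlow)) ζ mζ hζ0 hζ1 hζ2
    u u₁ u₂ f d (fun r => √r * g r) (k * √ρ * γ) du du₁ (fun r _ => rfl) Lu Lu4 Lf Lg md hd0 hd1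
    hfg horth'
  have hκ : 7 ≤ 1 / ε ^ 2 - 1 / 4 := by
    have : 16 ≤ 1 / ε ^ 2 := by
      rw [le_div_iff₀ (by positivity)]
      have := pow_le_pow_left₀ hε0.le hs3 2
      linarith
    linarith
  have hfin := integral_sq_add_le hω.le hκ du du₁ (fun r _ => hfW r) mW hW0 hWD Lu Lu4 Lf E₁ E₂
  have eL : ∫ r in Set.Ioi (0 : ℝ), ((w r - radLap w r) ^ 2 + (r ^ 4)⁻¹ * w r ^ 2) * r
      = ∫ r in Set.Ioi (0 : ℝ), ((u r - u₂ r - u r / r ^ 2 / 4) ^ 2 + (u r / r ^ 2) ^ 2) := by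
    refine setIntegral_congr_fun measurableSet_Ioi fun r hr => ?_
    have hr0 : 0 < r := hr
    have h1 : u r - u₂ r - u r / r ^ 2 / 4 = √r * (w r - radLap w r) := by
      rw [hu₂']; simp only [hu]; field_simp; ring
    have h2 : (u r / r ^ 2) ^ 2 = r * ((r ^ 4)⁻¹ * w r ^ 2) := by
      simp only [hu]; rw [div_pow, mul_pow, sq_sqrt hr0.le, ← pow_mul]; ring
    rw [h1, h2, mul_pow, sq_sqrt hr0.le]
    ring
  have eR : ∫ r in Set.Ioi (0 : ℝ), g r ^ 2 * r = ∫ r in Set.Ioi (0 : ℝ), (√r * g r) ^ 2 := by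
    refine setIntegral_congr_fun measurableSet_Ioi fun r hr => ?_
    have hr0 : 0 < r := hr
    rw [mul_pow, sq_sqrt hr0.le, mul_comm]
  rw [eL, eR, ← sqrt_mul hA0.le]
  refine sqrt_le_sqrt (hfin.trans (le_of_eq ?_))
  rw [hA]
  ring
end

section
/- Let p>1, ω>0 and m ∈ ℕ. Suppose φ ∈ C²((0,∞), ℝ) satisfies φ''(r) + φ'(r)/r − (ω + m²/r²)·φ(r) + |φ(r)|^{p−1}φ(r) = 0 on (0,∞), lim_{r→0} φ(r) = 0, lim_{r→∞} φ(r) = 0, and φ(r₀) < 0 for some r₀ > 0. Then inf_{r>0} φ(r) < −ω^{1/(p−1)}. -/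
open MeasureTheory Real Filter

/-- A function on `(0, ∞)` vanishing at both ends and negative somewhere attains a negative
minimum. -/
lemma exists_neg_isMinOn_Ioi {f : ℝ → ℝ} (hf : ContinuousOn f (Set.Ioi 0))
    (h0 : Tendsto f (nhdsWithin 0 (Set.Ioi 0)) (nhds 0)) (hinf : Tendsto f atTop (nhds 0))
    (hneg : ∃ r₀ > (0:ℝ), f r₀ < 0) :
    ∃ r > 0, f r < 0 ∧ IsMinOn f (Set.Ioi 0) r := by
  obtain ⟨r₀, hr₀, hlt⟩ := hneg
  obtain ⟨a, ha, hfa⟩ := mem_nhdsGT_iff_exists_Ioo_subset.1 (h0.eventually_const_lt hlt)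
  obtain ⟨b, hfb⟩ := eventually_atTop.1 (hinf.eventually_const_lt hlt)
  have ha' : a ≤ r₀ := by
    by_contra! h
    exact lt_irrefl (f r₀) (hfa ⟨hr₀, h⟩)
  have hb' : r₀ ≤ b := by
    by_contra! h
    exact lt_irrefl (f r₀) (hfb r₀ h.le)
  have ha0 : (0:ℝ) < a := ha
  obtain ⟨x, hx, hmin⟩ := isCompact_Icc.exists_isMinOn (s := Set.Icc a b) ⟨r₀, ha', hb'⟩
    (hf.mono fun y hy => ha0.trans_le hy.1)
  have hx₀ : f x ≤ f r₀ := hmin ⟨ha', hb'⟩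
  refine ⟨x, ha0.trans_le hx.1, hx₀.trans_lt hlt, fun y hy => ?_⟩
  rcases lt_or_ge y a with h | h
  · exact hx₀.trans (hfa ⟨hy, h⟩).le
  · rcases le_total b y with h' | h'
    · exact hx₀.trans (hfb y h').le
    · exact hmin ⟨h, h'⟩

lemma IsLocalMin.deriv_deriv_nonneg {f : ℝ → ℝ} {x : ℝ} (h : IsLocalMin f x)
    (hf : ContinuousAt f x) : 0 ≤ deriv (deriv f) x := by
  by_contra! hlt
  have hmax : IsLocalMax f x := isLocalMax_of_deriv_deriv_neg hlt h.deriv_eq_zero hf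
  have hconst : f =ᶠ[nhds x] fun _ => f x := by
    filter_upwards [h, hmax] with y h₁ h₂ using le_antisymm h₂ h₁
  have hzero : deriv (deriv f) x = 0 := by
    rw [hconst.deriv.deriv_eq]
    simp
  exact hlt.ne hzero

/-- For the equation without angular momentum the energy is non-increasing and dominates the
potential, which tends to `0`; so the potential is nonnegative at critical points. -/
lemma potential_nonneg_of_deriv_eq_zero {p ω : ℝ} (hp : 1 < p) {φ : ℝ → ℝ}
    (hφ : ∀ r > 0, DifferentiableAt ℝ φ r) (hφ' : ∀ r > 0, DifferentiableAt ℝ (deriv φ) r)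
    (hode : ∀ r > 0, deriv (deriv φ) r + deriv φ r / r - ω * φ r + |φ r| ^ (p - 1) * φ r = 0)
    (hinf : Tendsto φ atTop (nhds 0)) {r₁ : ℝ} (hr₁ : 0 < r₁) (hcrit : deriv φ r₁ = 0) :
    0 ≤ |φ r₁| ^ (p + 1) / (p + 1) - ω * φ r₁ ^ 2 / 2 := by
  set V : ℝ → ℝ := fun x => |x| ^ (p + 1) / (p + 1) - ω * x ^ 2 / 2 with hV
  have hVd : ∀ x, HasDerivAt V (|x| ^ (p - 1) * x - ω * x) x := by
    intro x
    have h := ((hasDerivAt_abs_rpow x (p := p + 1) (by linarith)).div_const (p + 1)).sub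
      ((((hasDerivAt_id x).pow 2).const_mul ω).div_const 2)
    refine h.congr_deriv ?_
    have hp1 : p + 1 ≠ 0 := by linarith
    rw [show p + 1 - 2 = p - 1 by ring]
    simp only [id]
    field_simp
    ring
  have hVlim : Tendsto (fun r => V (φ r)) atTop (nhds 0) := by
    have h := (hVd 0).continuousAt.tendsto.comp hinf
    have hV0 : V 0 = 0 := by
      simp [hV, Real.zero_rpow (show p + 1 ≠ 0 by linarith)]
    rwa [hV0] at h
  have hEd : ∀ r > 0, HasDerivAt (fun r => deriv φ r ^ 2 / 2 + V (φ r))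
      (-(deriv φ r ^ 2 / r)) r := by
    intro r hr
    have h := (((hφ' r hr).hasDerivAt.pow 2).div_const 2).add
      ((hVd (φ r)).comp r (hφ r hr).hasDerivAt)
    refine h.congr_deriv ?_
    have hr0 : r ≠ 0 := hr.ne'
    have h2 : deriv (deriv φ) r = -(deriv φ r / r) + ω * φ r - |φ r| ^ (p - 1) * φ r := by
      linarith [hode r hr]
    rw [h2]
    push_cast
    ring
  have hanti : AntitoneOn (fun r => deriv φ r ^ 2 / 2 + V (φ r)) (Set.Ici r₁) := by
    have hpos : ∀ r ∈ Set.Ici r₁, 0 < r := fun r hr => hr₁.trans_le hr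
    refine antitoneOn_of_deriv_nonpos (convex_Ici r₁)
      (fun r hr => (hEd r (hpos r hr)).continuousAt.continuousWithinAt)
      (fun r hr => (hEd r (hpos r (interior_subset hr))).differentiableAt.differentiableWithinAt)
      (fun r hr => ?_)
    have hr := hpos r (interior_subset hr)
    rw [(hEd r hr).deriv, neg_nonpos]
    positivity
  refine le_of_tendsto hVlim ?_
  filter_upwards [eventually_ge_atTop r₁] with r hr
  have h := hanti Set.self_mem_Ici hr hr
  simp only [hcrit] at h
  change V (φ r) ≤ V (φ r₁)
  nlinarith [sq_nonneg (deriv φ r)]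

theorem stmt15 (p ω : ℝ) (hp : 1 < p) (hω : 0 < ω) (m : ℕ)
    (φ : ℝ → ℝ) (hreg : ContDiffOn ℝ 2 φ (Set.Ioi 0))
    (hode : ∀ r ∈ Set.Ioi (0:ℝ),
      deriv (deriv φ) r + deriv φ r / r - (ω + (m : ℝ) ^ 2 / r ^ 2) * φ r
        + |φ r| ^ (p - 1) * φ r = 0)
    (h0 : Tendsto φ (nhdsWithin 0 (Set.Ioi 0)) (nhds 0))
    (hinf : Tendsto φ atTop (nhds 0))
    (hneg : ∃ r₀ > (0:ℝ), φ r₀ < 0) :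
    ∃ r > (0:ℝ), φ r < -ω ^ (1 / (p - 1)) := by
  obtain ⟨r, hr, hφneg, hmin⟩ := exists_neg_isMinOn_Ioi hreg.continuousOn h0 hinf hneg
  have hloc : IsLocalMin φ r := hmin.isLocalMin (Ioi_mem_nhds hr)
  have hφ : ∀ s > 0, DifferentiableAt ℝ φ s := fun s hs =>
    (hreg.differentiableOn (by norm_num)).differentiableAt (Ioi_mem_nhds hs)
  have hφ' : ∀ s > 0, DifferentiableAt ℝ (deriv φ) s := fun s hs =>
    ((hreg.deriv_of_isOpen (m := 1) isOpen_Ioi (by norm_num)).differentiableOn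
      (by norm_num)).differentiableAt (Ioi_mem_nhds hs)
  have hpos : 0 < |φ r| := abs_pos.2 hφneg.ne
  suffices hlt : ω < |φ r| ^ (p - 1) by
    refine ⟨r, hr, ?_⟩
    have h := Real.rpow_lt_rpow hω.le hlt (z := 1 / (p - 1))
      (one_div_pos.2 (sub_pos.2 hp))
    rw [← Real.rpow_mul hpos.le, mul_one_div_cancel (sub_pos.2 hp).ne', Real.rpow_one,
      abs_of_neg hφneg] at h
    linarith
  rcases Nat.eq_zero_or_pos m with rfl | hm
  · have h := potential_nonneg_of_deriv_eq_zero hp hφ hφ' (ω := ω)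
      (fun s hs => by simpa using hode s hs) hinf hr hloc.deriv_eq_zero
    have hsplit : |φ r| ^ (p + 1) = |φ r| ^ (p - 1) * φ r ^ 2 := by
      rw [← sq_abs (φ r), ← Real.rpow_natCast, ← Real.rpow_add hpos]
      congr 1
      push_cast
      ring
    have hsq : 0 < φ r ^ 2 := sq_pos_of_neg hφneg
    rw [hsplit, sub_nonneg, div_le_div_iff₀ two_pos (by linarith)] at h
    have h' : ω * (p + 1) ≤ |φ r| ^ (p - 1) * 2 := by
      refine le_of_mul_le_mul_right ?_ hsq
      linarith
    nlinarith
  · have h := hode r hr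
    have h2 := hloc.deriv_deriv_nonneg (hφ r hr).continuousAt
    rw [hloc.deriv_eq_zero, zero_div] at h
    have hm' : (0:ℝ) < (m : ℝ) ^ 2 / r ^ 2 := by positivity
    by_contra! hle
    nlinarith
end
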